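/- Let n ≥ 2 and let Ω ⊂ ℝⁿ be a connected bounded open set with smooth boundary, and let Γ ⊊ ∂Ω be a closed proper subset of the boundary. If f ∈ L^∞(Ω) satisfies ∫_Ω f u v dx = 0 for every pair of functions u, v ∈ C^∞(Ω̄) that are harmonic in Ω and vanish identically on Γ, then f = 0 almost everywhere on Ω. -/

import Mathlib

open MeasureTheory

noncomputable section

/-- The Laplacian of `u : ℝⁿ → ℝ`, as the sum of the second partial derivatives. -/
def lap {n : ℕ} (u : EuclideanSpace ℝ (Fin n) → ℝ) (x : EuclideanSpace ℝ (Fin n)) : ℝ :=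
  ∑ i, iteratedFDeriv ℝ 2 u x ![EuclideanSpace.single i 1, EuclideanSpace.single i 1]

/-- `u` is harmonic on `s`: twice continuously differentiable with vanishing Laplacian. -/
def IsHarmonicOn {n : ℕ} (u : EuclideanSpace ℝ (Fin n) → ℝ)
    (s : Set (EuclideanSpace ℝ (Fin n))) : Prop :=
  ContDiffOn ℝ 2 u s ∧ ∀ x ∈ s, lap u x = 0

/-- `Ω` has smooth boundary: near each boundary point there is a smooth local defining
function with nonvanishing differential. -/
def HasSmoothBoundary {n : ℕ} (Ω : Set (EuclideanSpace ℝ (Fin n))) : Prop :=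
  ∀ x ∈ frontier Ω, ∃ (U : Set (EuclideanSpace ℝ (Fin n))) (ρ : EuclideanSpace ℝ (Fin n) → ℝ),
    IsOpen U ∧ x ∈ U ∧ ContDiffOn ℝ (⊤ : ℕ∞) ρ U ∧ (∀ y ∈ U, fderiv ℝ ρ y ≠ 0) ∧
    Ω ∩ U = {y ∈ U | ρ y < 0} ∧ frontier Ω ∩ U = {y ∈ U | ρ y = 0}


section
open MeasureTheory InnerProductSpace Laplacian Set Filter Topology
open scoped ContDiff
set_option linter.all false
namespace LC
variable {E : Type} [NormedAddCommGroup E] [InnerProductSpace ℝ E] [FiniteDimensional ℝ E] [MeasurableSpace E] [BorelSpace E]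
local notation "L2E" => Lp ℝ 2 (volume : Measure E)

section
variable {F : Type} [NormedAddCommGroup F]
def TF (D : Set E) : Submodule ℝ (E → ℝ) where
  carrier := {φ | ContDiff ℝ ∞ φ ∧ HasCompactSupport φ ∧ tsupport φ ⊆ D}
  add_mem' {a b} ha hb := ⟨ha.1.add hb.1, ha.2.1.add hb.2.1,
    (tsupport_add a b).trans (union_subset ha.2.2 hb.2.2)⟩
  zero_mem' := ⟨contDiff_const, HasCompactSupport.zero, by simp [tsupport]⟩
  smul_mem' c a ha := ⟨contDiff_const.smul ha.1, ha.2.1.smul_left (f := fun _ => c),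
    (tsupport_smul_subset_right (fun _ => c) a).trans ha.2.2⟩
def tl (u : E → F) : Lp F 2 (volume : Measure E) :=
  open Classical in if h : MemLp u 2 volume then h.toLp u else 0
lemma tl_ae {u : E → F} (h : MemLp u 2 volume) : tl u =ᵐ[volume] u := by
  rw [tl, dif_pos h]; exact h.coeFn_toLp
lemma tl_eq {u : E → F} (h : MemLp u 2 volume) {w : Lp F 2 (volume : Measure E)}
    (hw : w =ᵐ[volume] u) : tl u = w := by
  apply Lp.ext; filter_upwards [tl_ae h, hw] with x h1 h2; rw [h1, h2]
lemma tl_add {u v : E → F} (hu : MemLp u 2 volume) (hv : MemLp v 2 volume) :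
    tl (u + v) = tl u + tl v := by
  apply tl_eq (hu.add hv)
  filter_upwards [Lp.coeFn_add (tl u) (tl v), tl_ae hu, tl_ae hv] with x h1 h2 h3
  rw [h1, Pi.add_apply, Pi.add_apply, h2, h3]
lemma tl_smul [NormedSpace ℝ F] {u : E → F} (hu : MemLp u 2 volume) (c : ℝ) :
    tl (c • u) = c • tl u := by
  apply tl_eq (hu.const_smul c)
  filter_upwards [Lp.coeFn_smul c (tl u), tl_ae hu] with x h1 h2
  rw [h1, Pi.smul_apply, Pi.smul_apply, h2]
lemma norm_tl_le {G : Type} [NormedAddCommGroup G] {u : E → F} {v : E → G} (hu : MemLp u 2 volume)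
    (hv : MemLp v 2 volume) {c : ℝ} (h : ∀ x, ‖u x‖ ≤ c * ‖v x‖) : ‖tl u‖ ≤ c * ‖tl v‖ := by
  apply Lp.norm_le_mul_norm_of_ae_le_mul
  filter_upwards [tl_ae hu, tl_ae hv] with x h1 h2
  rw [h1, h2]; exact h x
lemma inner_tl [InnerProductSpace ℝ F] (w : Lp F 2 (volume : Measure E)) {v : E → F}
    (hv : MemLp v 2 volume) : inner ℝ w (tl v) = ∫ x, inner ℝ (w x) (v x) := by
  rw [L2.inner_def]; apply integral_congr_ae
  filter_upwards [tl_ae hv] with x h; rw [h]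
lemma inner_tl_tl [InnerProductSpace ℝ F] {u v : E → F} (hu : MemLp u 2 volume)
    (hv : MemLp v 2 volume) : inner ℝ (tl u) (tl v) = ∫ x, inner ℝ (u x) (v x) := by
  rw [inner_tl _ hv]; apply integral_congr_ae
  filter_upwards [tl_ae hu] with x h; rw [h]
lemma inner_tlR (w : L2E) {v : E → ℝ}
    (hv : MemLp v 2 volume) : inner ℝ w (tl v) = ∫ x, w x * v x := by
  rw [inner_tl _ hv]; simp [mul_comm]
lemma inner_tlRR {u v : E → ℝ} (hu : MemLp u 2 volume)
    (hv : MemLp v 2 volume) : inner ℝ (tl u) (tl v) = ∫ x, u x * v x := by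
  rw [inner_tl_tl hu hv]; simp [mul_comm]
lemma memLp_cs {u : E → F} (hu : Continuous u) (hs : HasCompactSupport u) : MemLp u 2 volume :=
  hu.memLp_of_hasCompactSupport hs
lemma integ_cs {u : E → F} (hu : Continuous u) (hs : HasCompactSupport u) :
    Integrable u volume := hu.integrable_of_hasCompactSupport hs
lemma grad_eq (φ : E → ℝ) : gradient φ = fun x => (toDual ℝ E).symm (fderiv ℝ φ x) := rfl
lemma contDiff_grad {φ : E → ℝ} (h : ContDiff ℝ ∞ φ) : ContDiff ℝ ∞ (gradient φ) := by
  rw [grad_eq]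
  exact (toDual ℝ E).symm.contDiff.comp (h.fderiv_right (m := ∞) (by simp))
lemma cs_grad {φ : E → ℝ} (h : HasCompactSupport φ) : HasCompactSupport (gradient φ) :=
  (h.fderiv ℝ).comp_left (g := (toDual ℝ E).symm) (by simp)
lemma norm_grad (φ : E → ℝ) (x : E) : ‖gradient φ x‖ = ‖fderiv ℝ φ x‖ := by
  rw [grad_eq]; exact LinearIsometryEquiv.norm_map _ _
lemma memLp_grad {φ : E → ℝ} (h : ContDiff ℝ ∞ φ) (hc : HasCompactSupport φ) :
    MemLp (gradient φ) 2 volume := memLp_cs (contDiff_grad h).continuous (cs_grad hc)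
lemma tfm {D : Set E} (φ : TF D) : MemLp (φ : E → ℝ) 2 volume :=
  memLp_cs φ.2.1.continuous φ.2.2.1
lemma tfg {D : Set E} (φ : TF D) : MemLp (gradient (φ : E → ℝ)) 2 volume :=
  memLp_grad φ.2.1 φ.2.2.1
lemma tfd {D : Set E} (φ : TF D) : Differentiable ℝ (φ : E → ℝ) :=
  φ.2.1.differentiable (by simp)
def gL (D : Set E) : TF D →ₗ[ℝ] Lp E 2 (volume : Measure E) where
  toFun φ := tl (gradient (φ : E → ℝ))
  map_add' φ ψ := by
    rw [← tl_add (tfg φ) (tfg ψ)]; congr 1; ext1 x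
    simp [grad_eq, fderiv_add (tfd φ x) (tfd ψ x)]
  map_smul' c φ := by
    simp only [RingHom.id_apply]
    rw [← tl_smul (tfg φ)]; congr 1; ext1 x
    simp [grad_eq, fderiv_const_smul (tfd φ x)]
def iL (D : Set E) : TF D →ₗ[ℝ] L2E where
  toFun φ := tl (φ : E → ℝ)
  map_add' φ ψ := tl_add (tfm φ) (tfm ψ)
  map_smul' c φ := tl_smul (tfm φ) c
lemma poincare [Nontrivial E] {D : Set E} (hD : Bornology.IsBounded D) :
    ∃ C, ∀ φ : TF D, ‖iL D φ‖ ≤ C * ‖gL D φ‖ := by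
  obtain ⟨R, hR0, hR⟩ := hD.exists_pos_norm_le
  obtain ⟨e, he⟩ := exists_norm_eq E zero_le_one
  refine ⟨2 * R, fun φ => ?_⟩
  have hφ := φ.2.1
  have hc := φ.2.2.1
  have hdc : Continuous fun x => fderiv ℝ (φ : E → ℝ) x e :=
    (hφ.continuous_fderiv (by simp)).clm_apply continuous_const
  have hfd : ∀ x, HasFDerivAt (fun x => (φ : E → ℝ) x * (φ : E → ℝ) x)
      ((φ : E → ℝ) x • fderiv ℝ (φ : E → ℝ) x + (φ : E → ℝ) x • fderiv ℝ (φ : E → ℝ) x) x :=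
    fun x => (tfd φ x).hasFDerivAt.mul (tfd φ x).hasFDerivAt
  have hgd : ∀ x, HasFDerivAt (fun x => inner ℝ e x) (innerSL ℝ e) x :=
    fun x => (innerSL ℝ e).hasFDerivAt
  have hci : Continuous fun x : E => inner ℝ e x := by fun_prop
  have hc0 := hφ.continuous
  have key := integral_mul_fderiv_eq_neg_fderiv_mul_of_integrable (μ := (volume : Measure E))
    (f := fun x => (φ : E → ℝ) x * (φ : E → ℝ) x) (g := fun x => inner ℝ e x) (v := e) ?_ ?_ ?_
    (fun x _ => (hfd x).differentiableAt) (fun x _ => (hgd x).differentiableAt)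
  rotate_left
  · simp only [(hfd _).fderiv, add_apply, smul_apply,
      smul_eq_mul]
    refine integ_cs (by fun_prop) ?_
    apply HasCompactSupport.mul_right
    exact (hc.mul_right).add hc.mul_right
  · simp only [(hgd _).fderiv]
    exact integ_cs (by fun_prop) (hc.mul_right.mul_right)
  · exact integ_cs (by fun_prop) (hc.mul_right.mul_right)
  have hm : MemLp (fun x => -2 * (inner ℝ e x * fderiv ℝ (φ : E → ℝ) x e)) 2 (volume : Measure E) := by
    apply memLp_cs (by fun_prop)
    exact ((hc.fderiv_apply (𝕜 := ℝ) e).mul_left).mul_left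
  have h1 : ‖iL D φ‖ ^ 2 = inner ℝ (iL D φ)
      (tl (fun x => -2 * (inner ℝ e x * fderiv ℝ (φ : E → ℝ) x e))) := by
    rw [← real_inner_self_eq_norm_sq]
    change inner ℝ (tl _) (tl _) = inner ℝ (tl _) (tl _)
    rw [inner_tlRR (tfm φ) (tfm φ), inner_tlRR (tfm φ) hm]
    simp only [(hgd _).fderiv, (hfd _).fderiv] at key
    simp only [innerSL_apply_apply, real_inner_self_eq_norm_sq, he] at key
    rw [← integral_neg] at key
    simp only [one_pow, mul_one] at key
    rw [key]; congr 1; ext x; simp; ring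
  have h2 : ‖tl (fun x => -2 * (inner ℝ e x * fderiv ℝ (φ : E → ℝ) x e))‖ ≤ 2 * R * ‖gL D φ‖ := by
    apply norm_tl_le hm (tfg φ)
    intro x
    by_cases hx : x ∈ D
    · rw [norm_grad, norm_mul, norm_mul]
      have a1 : ‖inner ℝ e x‖ ≤ R := (norm_inner_le_norm e x).trans (by rw [he, one_mul]; exact hR x hx)
      have a2 : ‖fderiv ℝ (φ : E → ℝ) x e‖ ≤ ‖fderiv ℝ (φ : E → ℝ) x‖ := by
        simpa [he] using (fderiv ℝ (φ : E → ℝ) x).le_opNorm e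
      have : ‖(-2 : ℝ)‖ = 2 := by norm_num
      rw [this, mul_assoc]
      gcongr
    · have : fderiv ℝ (φ : E → ℝ) x = 0 :=
        image_eq_zero_of_notMem_tsupport (fun h => hx (φ.2.2.2 (tsupport_fderiv_subset ℝ h)))
      simp [this, norm_grad]
  have h3 := real_inner_le_norm (iL D φ) (tl (fun x => -2 * (inner ℝ e x * fderiv ℝ (φ : E → ℝ) x e)))
  rw [← h1] at h3
  rcases eq_or_lt_of_le (norm_nonneg (iL D φ)) with h0 | h0
  · rw [← h0]; positivity
  · have : ‖iL D φ‖ * ‖iL D φ‖ ≤ ‖iL D φ‖ * (2 * R * ‖gL D φ‖) := by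
      rw [← sq]; exact h3.trans (by gcongr)
    exact le_of_mul_le_mul_left this h0
end
section
variable {F : Type} [NormedAddCommGroup F]
def KK (D : Set E) : Submodule ℝ (Lp E 2 (volume : Measure E)) :=
  (LinearMap.range (gL D)).topologicalClosure
instance (D : Set E) : CompleteSpace (KK D) :=
  inferInstanceAs (CompleteSpace (LinearMap.range (gL D)).topologicalClosure)
def gK (D : Set E) : TF D →ₗ[ℝ] KK D :=
  (gL D).codRestrict (KK D) fun φ => Submodule.le_topologicalClosure _ ⟨φ, rfl⟩
lemma gK_dense (D : Set E) : DenseRange (gK D) := by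
  intro k
  rw [closure_subtype]
  have : (Subtype.val '' range (gK D)) = (LinearMap.range (gL D) : Set _) := by
    ext y; constructor
    · rintro ⟨_, ⟨φ, rfl⟩, rfl⟩; exact ⟨φ, rfl⟩
    · rintro ⟨φ, rfl⟩; exact ⟨gK D φ, ⟨φ, rfl⟩, rfl⟩
  rw [this]; exact k.2
def JJ (D : Set E) : KK D →L[ℝ] L2E := (iL D).extendOfNorm (gK D)
lemma JJ_g [Nontrivial E] {D : Set E} (hD : Bornology.IsBounded D) (φ : TF D) :
    JJ D (gK D φ) = tl (φ : E → ℝ) :=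
  LinearMap.extendOfNorm_eq (gK_dense D) (poincare hD) φ
def GG (D : Set E) : L2E →L[ℝ] L2E :=
  JJ D ∘L (ContinuousLinearMap.adjoint (JJ D))
lemma GG_symm (D : Set E) (a b : L2E) :
    inner ℝ (GG D a) b = inner ℝ a (GG D b) := by
  simp only [GG, ContinuousLinearMap.comp_apply]
  rw [← ContinuousLinearMap.adjoint_inner_right, ContinuousLinearMap.adjoint_inner_left]
lemma ibp {φ ψ : E → ℝ} (hφ : ContDiff ℝ 1 φ) (hψ : ContDiff ℝ 1 ψ) (hc : HasCompactSupport ψ)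
    (e : E) : ∫ x, φ x * fderiv ℝ ψ x e = -∫ x, fderiv ℝ φ x e * ψ x := by
  have h1 : Continuous fun x => fderiv ℝ φ x e :=
    (hφ.continuous_fderiv (by simp)).clm_apply continuous_const
  have h2 : Continuous fun x => fderiv ℝ ψ x e :=
    (hψ.continuous_fderiv (by simp)).clm_apply continuous_const
  have h3 := hφ.continuous
  have h4 := hψ.continuous
  exact integral_mul_fderiv_eq_neg_fderiv_mul_of_integrable
    (integ_cs (by fun_prop) hc.mul_left)
    (integ_cs (by fun_prop) (hc.fderiv_apply (𝕜 := ℝ) e).mul_left)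
    (integ_cs (by fun_prop) hc.mul_left)
    (fun x _ => hφ.differentiable (by simp) x) (fun x _ => hψ.differentiable (by simp) x)
lemma lap_at {φ : E → ℝ} {x : E} (h : ContDiffAt ℝ 2 φ x) {ι : Type*} [Fintype ι]
    (b : OrthonormalBasis ι ℝ E) :
    Δ φ x = ∑ i, fderiv ℝ (fun y => fderiv ℝ φ y (b i)) x (b i) := by
  rw [laplacian_eq_iteratedFDeriv_orthonormalBasis φ b]
  refine Finset.sum_congr rfl fun i _ => ?_
  rw [iteratedFDeriv_two_apply]
  have : DifferentiableAt ℝ (fderiv ℝ φ) x :=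
    (h.fderiv_right (m := 1) (by norm_num)).differentiableAt (by simp)
  rw [fderiv_clm_apply this (by fun_prop)]
  simp
lemma contDiff_fd {φ : E → ℝ} (h : ContDiff ℝ ∞ φ) (e : E) :
    ContDiff ℝ ∞ (fun y => fderiv ℝ φ y e) :=
  (h.fderiv_right (m := ∞) (by simp)).clm_apply contDiff_const
lemma lap_eq {φ : E → ℝ} (h : ContDiff ℝ ∞ φ) {ι : Type*} [Fintype ι]
    (b : OrthonormalBasis ι ℝ E) :
    Δ φ = fun x => ∑ i, fderiv ℝ (fun y => fderiv ℝ φ y (b i)) x (b i) := by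
  ext x; exact lap_at (contDiff_infty.1 h 2).contDiffAt b
lemma contDiff_lap {φ : E → ℝ} (h : ContDiff ℝ ∞ φ) : ContDiff ℝ ∞ (Δ φ) := by
  rw [lap_eq h (stdOrthonormalBasis ℝ E)]
  exact ContDiff.sum fun i _ => contDiff_fd (contDiff_fd h _) _
lemma tsupport_lap (φ : E → ℝ) : tsupport (Δ φ) ⊆ tsupport φ := by
  apply closure_minimal _ (isClosed_tsupport _)
  intro x hx
  by_contra h
  apply hx
  have : φ =ᶠ[𝓝 x] fun _ => (0 : ℝ) := notMem_tsupport_iff_eventuallyEq.1 h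
  rw [(laplacian_congr_nhds this).eq_of_nhds]
  exact congrFun laplacian_const x
lemma lap_mem {D : Set E} {φ : E → ℝ} (h : φ ∈ TF D) : Δ φ ∈ TF D :=
  ⟨contDiff_lap h.1, h.2.1.of_isClosed_subset (isClosed_tsupport _) (tsupport_lap φ), (tsupport_lap φ).trans h.2.2⟩
lemma ibp_lap {φ ψ : E → ℝ} (hφ : ContDiff ℝ ∞ φ) (hψ : ContDiff ℝ ∞ ψ)
    (hc : HasCompactSupport ψ) :
    ∫ x, Δ φ x * ψ x = -∫ x, inner ℝ (gradient φ x) (gradient ψ x) := by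
  have b := stdOrthonormalBasis ℝ E
  rw [lap_eq hφ b]
  have h4 := hψ.continuous
  have h1 : ∀ i, Continuous fun x => fderiv ℝ φ x (b i) := fun i => (contDiff_fd hφ _).continuous
  have h2 : ∀ i, Continuous fun x => fderiv ℝ ψ x (b i) := fun i => (contDiff_fd hψ _).continuous
  have h3 : ∀ i, Continuous fun x => fderiv ℝ (fun y => fderiv ℝ φ y (b i)) x (b i) :=
    fun i => (contDiff_fd (contDiff_fd hφ _) _).continuous
  have : ∀ x, inner ℝ (gradient φ x) (gradient ψ x)
      = ∑ i, fderiv ℝ φ x (b i) * fderiv ℝ ψ x (b i) := by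
    intro x
    rw [← b.sum_inner_mul_inner]
    refine Finset.sum_congr rfl fun i _ => ?_
    rw [inner_gradient_left, inner_gradient_right]; simp
  simp_rw [this, Finset.sum_mul]
  rw [integral_finset_sum, integral_finset_sum, ← Finset.sum_neg_distrib]
  rotate_left
  · exact fun i _ => integ_cs ((h1 i).mul (h2 i)) (hc.fderiv_apply (𝕜 := ℝ) (b i)).mul_left
  · exact fun i _ => integ_cs ((h3 i).mul h4) hc.mul_left
  refine Finset.sum_congr rfl fun i _ => ?_
  rw [ibp ((contDiff_fd hφ (b i)).of_le (by simp)) (hψ.of_le (by simp)) hc, neg_neg]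
lemma KK_ext {D : Set E} {a b : KK D}
    (h : ∀ φ : TF D, inner ℝ a (gK D φ) = inner ℝ b (gK D φ)) : a = b := by
  apply ext_inner_right ℝ
  intro k
  refine (gK_dense D).induction_on (p := fun k => inner ℝ a k = inner ℝ b k) k ?_ h
  exact isClosed_eq (by fun_prop) (by fun_prop)
lemma adj_g [Nontrivial E] {D : Set E} (hD : Bornology.IsBounded D) (r : L2E)
    (φ : TF D) : inner ℝ (ContinuousLinearMap.adjoint (JJ D) r) (gK D φ) = ∫ x, r x * (φ : E → ℝ) x := by
  rw [ContinuousLinearMap.adjoint_inner_left, JJ_g hD, inner_tlR _ (tfm φ)]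
lemma GG_lap [Nontrivial E] {D : Set E} (hD : Bornology.IsBounded D) {φ : E → ℝ} (h : φ ∈ TF D) :
    GG D (tl (Δ φ)) = - tl φ := by
  have : ContinuousLinearMap.adjoint (JJ D) (tl (Δ φ)) = - gK D ⟨φ, h⟩ := by
    apply KK_ext
    intro ψ
    have hm : MemLp (Δ φ) 2 volume := tfm ⟨_, lap_mem h⟩
    rw [ContinuousLinearMap.adjoint_inner_left, JJ_g hD, inner_tlRR hm (tfm ψ),
      ibp_lap h.1 ψ.2.1 ψ.2.2.1, inner_neg_left]
    congr 1
    change _ = inner ℝ (tl (gradient φ)) (tl (gradient (ψ : E → ℝ)))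
    rw [inner_tl_tl (tfg ⟨φ, h⟩) (tfg ψ)]
  simp only [GG, ContinuousLinearMap.comp_apply]
  rw [this, map_neg, JJ_g hD]
lemma weak_grad [Nontrivial E] {D : Set E} (hD : Bornology.IsBounded D) (k : KK D) {ψ : E → ℝ}
    (hψ : ContDiff ℝ ∞ ψ) (hc : HasCompactSupport ψ) (e : E) :
    ∫ x, JJ D k x * fderiv ℝ ψ x e = - ∫ x, inner ℝ ((k : Lp E 2 volume) x) e * ψ x := by
  have m1 : MemLp (fun x => fderiv ℝ ψ x e) 2 volume :=
    memLp_cs (contDiff_fd hψ e).continuous (hc.fderiv_apply (𝕜 := ℝ) e)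
  have m2 : MemLp (fun x => ψ x • e) 2 volume :=
    memLp_cs (hψ.continuous.smul continuous_const) hc.smul_right
  have e1 : ∀ k : KK D, inner ℝ (k : Lp E 2 volume) (tl fun x => ψ x • e)
      = ∫ x, inner ℝ ((k : Lp E 2 volume) x) e * ψ x := by
    intro k; rw [inner_tl _ m2]; simp [inner_smul_right, mul_comm]
  rw [← inner_tlR _ m1, ← e1]
  refine (gK_dense D).induction_on (p := fun k : KK D => inner ℝ (JJ D k) (tl fun x => fderiv ℝ ψ x e)
    = - inner ℝ (k : Lp E 2 volume) (tl fun x => ψ x • e)) k ?_ ?_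
  · exact isClosed_eq (by fun_prop) (by fun_prop)
  · intro φ
    rw [JJ_g hD, inner_tlRR (tfm φ) m1, ibp (φ.2.1.of_le (by simp)) (hψ.of_le (by simp)) hc]
    congr 1
    change _ = inner ℝ (tl (gradient (φ : E → ℝ))) (tl _)
    rw [inner_tl_tl (tfg _) m2]
    simp [inner_smul_right, mul_comm, inner_gradient_left]
lemma ae_zero_off {G : Type} [NormedAddCommGroup G] [InnerProductSpace ℝ G] {D : Set E}
    (hDm : MeasurableSet D) (w : Lp G 2 (volume : Measure E))
    (h : ∀ v : E → G, MemLp v 2 volume → (∀ x ∈ D, v x = 0) → inner ℝ w (tl v) = 0) :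
    ∀ᵐ x, x ∉ D → w x = 0 := by
  have m : MemLp (Dᶜ.indicator w) 2 volume := (Lp.memLp w).indicator hDm.compl
  have h1 := h _ m (fun x hx => by simp [hx])
  have h2 : inner ℝ (tl (Dᶜ.indicator w)) (tl (Dᶜ.indicator w)) = inner ℝ w (tl (Dᶜ.indicator w)) := by
    rw [inner_tl_tl m m, inner_tl _ m]
    congr 1; ext x; by_cases hx : x ∈ D <;> simp [hx]
  rw [h1, inner_self_eq_zero] at h2
  have h3 := tl_ae m
  rw [h2] at h3
  filter_upwards [h3, Lp.coeFn_zero G 2 (volume : Measure E)] with x a1 a2 hx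
  rw [a2] at a1
  simpa [hx] using a1.symm
lemma KK_off {D : Set E} (hDm : MeasurableSet D) (k : KK D) :
    ∀ᵐ x, x ∉ D → (k : Lp E 2 (volume : Measure E)) x = 0 := by
  apply ae_zero_off hDm
  intro v hv h0
  refine (gK_dense D).induction_on (p := fun k : KK D => inner ℝ (k : Lp E 2 volume) (tl v) = 0) k ?_ ?_
  · exact isClosed_eq (by fun_prop) (by fun_prop)
  · intro φ
    change inner ℝ (tl (gradient (φ : E → ℝ))) (tl v) = 0
    rw [inner_tl_tl (tfg _) hv, ← integral_zero E ℝ (μ := volume)]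
    congr 1; ext x
    by_cases hx : x ∈ D
    · simp [h0 x hx]
    · have : fderiv ℝ (φ : E → ℝ) x = 0 :=
        image_eq_zero_of_notMem_tsupport (fun h => hx (φ.2.2.2 (tsupport_fderiv_subset ℝ h)))
      rw [inner_gradient_left, this]; simp
lemma JJ_off [Nontrivial E] {D : Set E} (hD : Bornology.IsBounded D) (hDm : MeasurableSet D) (k : KK D) :
    ∀ᵐ x, x ∉ D → JJ D k x = 0 := by
  apply ae_zero_off hDm
  intro v hv h0
  refine (gK_dense D).induction_on (p := fun k : KK D => inner ℝ (JJ D k) (tl v) = 0) k ?_ ?_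
  · exact isClosed_eq (by fun_prop) (by fun_prop)
  · intro φ
    rw [JJ_g hD, inner_tl_tl (tfm _) hv, ← integral_zero E ℝ (μ := volume)]
    congr 1; ext x
    by_cases hx : x ∈ D
    · simp [h0 x hx]
    · have : (φ : E → ℝ) x = 0 := image_eq_zero_of_notMem_tsupport (fun h => hx (φ.2.2.2 h))
      rw [this]; simp
end
section
variable {F : Type} [NormedAddCommGroup F] [NormedSpace ℝ F]
def ti (u : E → F) : Lp F ⊤ (volume : Measure E) :=
  open Classical in if h : MemLp u ⊤ volume then h.toLp u else 0
lemma ti_ae {u : E → F} (h : MemLp u ⊤ volume) : ti u =ᵐ[volume] u := by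
  rw [ti, dif_pos h]; exact h.coeFn_toLp
lemma norm_ti_le {w : Lp F ⊤ (volume : Measure E)} {c : ℝ} (hc : 0 ≤ c) (h : ∀ᵐ x, ‖w x‖ ≤ c) : ‖w‖ ≤ c := by
  rw [Lp.norm_def, eLpNorm_exponent_top]
  exact ENNReal.toReal_le_of_le_ofReal hc (eLpNormEssSup_le_of_ae_bound h)
lemma memLp_ti {u : E → F} (hu : Continuous u) {C : Set E} (hC : IsCompact C)
    (h0 : ∀ x, x ∉ C → u x = 0) : MemLp u ⊤ volume :=
  hu.memLp_of_hasCompactSupport (HasCompactSupport.intro hC h0)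
lemma sc_hasFDerivAt {f : E → E → F} (hf : ContDiff ℝ ∞ (fun p : E × E => f p.1 p.2)) {C : Set E}
    (hC : IsCompact C) (h0 : ∀ t x, x ∉ C → f t x = 0) {ι : Type} [Fintype ι]
    (b : OrthonormalBasis ι ℝ E) (t : E) :
    HasFDerivAt (fun t => ti (f t)) (∑ i, (innerSL ℝ (b i)).smulRight
      (ti (fun x => fderiv ℝ (fun s => f s x) t (b i)))) t := by
  have hfc : ∀ t, Continuous (f t) := fun t => hf.continuous.comp (f := fun x => (t, x)) (by fun_prop)
  have hfd : ∀ x, ContDiff ℝ ∞ (fun s => f s x) := fun x => hf.comp (f := fun s => (s, x)) (by fun_prop)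
  have hm : ∀ t, MemLp (f t) ⊤ volume := fun t => memLp_ti (hfc t) hC (h0 t)
  have hD : Continuous fun p : E × E => fderiv ℝ (fun s => f s p.2) p.1 := by
    have := ContDiff.fderiv (𝕜 := ℝ) (n := ∞) (m := ∞) (f := fun (p : E × E) (s : E) => f s p.2)
      (g := fun p => p.1) (hf.comp (f := fun q : (E × E) × E => (q.2, q.1.2)) (by fun_prop)) contDiff_fst (by simp)
    exact this.continuous
  have hz : ∀ t x, x ∉ C → fderiv ℝ (fun s => f s x) t = 0 := by
    intro t x hx
    have : (fun s => f s x) = fun _ => 0 := by ext s; exact h0 s x hx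
    rw [this]; simp
  have hm' : ∀ i, MemLp (fun x => fderiv ℝ (fun s => f s x) t (b i)) ⊤ volume := fun i =>
    memLp_ti ((hD.comp (by fun_prop : Continuous fun x : E => (t, x))).clm_apply continuous_const) hC
      (fun x hx => by rw [hz t x hx]; simp)
  rw [hasFDerivAt_iff_isLittleO, Asymptotics.isLittleO_iff]
  intro ε hε
  have h1 : ∀ᶠ s in 𝓝 t, ∀ x ∈ C, ‖fderiv ℝ (fun s => f s x) s - fderiv ℝ (fun s => f s x) t‖ < ε := by
    apply hC.eventually_forall_of_forall_eventually
    intro x hx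
    have : Continuous fun p : E × E => ‖fderiv ℝ (fun s => f s p.2) p.1 - fderiv ℝ (fun s => f s p.2) t‖ :=
      (hD.sub (hD.comp (by fun_prop : Continuous fun p : E × E => (t, p.2)))).norm
    have h2 := this.tendsto (t, x)
    simp only [sub_self, norm_zero] at h2
    exact h2.eventually (gt_mem_nhds hε)
  obtain ⟨δ, hδ, h2⟩ := Metric.eventually_nhds_iff_ball.1 h1
  filter_upwards [Metric.ball_mem_nhds t hδ] with s hs
  apply norm_ti_le (by positivity)
  have e1 : ∀ᵐ x, ∀ i, (ti (fun x => fderiv ℝ (fun s => f s x) t (b i)) : E → F) x =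
      fderiv ℝ (fun s => f s x) t (b i) := ae_all_iff.2 fun i => ti_ae (hm' i)
  have e2 : ((ti (f s) - ti (f t) - (∑ i, (innerSL ℝ (b i)).smulRight
      (ti (fun x => fderiv ℝ (fun s => f s x) t (b i)))) (s - t) : Lp F ⊤ (volume : Measure E)) : E → F)
      =ᵐ[volume] fun x => f s x - f t x - fderiv ℝ (fun s => f s x) t (s - t) := by
    have e3 : (((∑ i, (innerSL ℝ (b i)).smulRight
      (ti (fun x => fderiv ℝ (fun s => f s x) t (b i)))) (s - t) : Lp F ⊤ (volume : Measure E)) : E → F)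
      =ᵐ[volume] fun x => fderiv ℝ (fun s => f s x) t (s - t) := by
      rw [ContinuousLinearMap.sum_apply]
      have e4 := Lp.coeFn_finsetSum (μ := (volume : Measure E)) (p := ⊤) Finset.univ
        (fun i => ((innerSL ℝ (b i)).smulRight
          (ti (fun x => fderiv ℝ (fun s => f s x) t (b i)))) (s - t))
      have e5 : ∀ᵐ x, ∀ i, ((((innerSL ℝ (b i)).smulRight
          (ti (fun x => fderiv ℝ (fun s => f s x) t (b i)))) (s - t) : Lp F ⊤ (volume : Measure E)) : E → F) x =
          inner ℝ (b i) (s - t) • (ti (fun x => fderiv ℝ (fun s => f s x) t (b i)) : E → F) x :=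
        ae_all_iff.2 fun i => Lp.coeFn_smul _ _
      filter_upwards [e1, e4, e5] with x a1 a4 a5
      rw [a4, Finset.sum_apply]
      simp_rw [a5, a1]
      conv_rhs => rw [← b.sum_repr' (s - t)]
      simp
    filter_upwards [e3, ti_ae (hm s), ti_ae (hm t), Lp.coeFn_sub (ti (f s) - ti (f t))
      ((∑ i, (innerSL ℝ (b i)).smulRight
      (ti (fun x => fderiv ℝ (fun s => f s x) t (b i)))) (s - t)), Lp.coeFn_sub (ti (f s)) (ti (f t))]
      with x a1 a2 a3 a4 a5
    rw [a4, Pi.sub_apply, a5, Pi.sub_apply, a1, a2, a3]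
  filter_upwards [e2] with x hx
  rw [hx]
  by_cases hxC : x ∈ C
  · exact (convex_ball t δ).norm_image_sub_le_of_norm_hasFDerivWithin_le'
      (fun r hr => (((hfd x).differentiable (by simp)) r).hasFDerivAt.hasFDerivWithinAt)
      (fun r hr => (h2 r hr x hxC).le) (Metric.mem_ball_self hδ) hs
  · simp only [h0 s x hxC, h0 t x hxC, hz t x hxC]
    simp; positivity
lemma sc_contDiff {f : E → E → F} (hf : ContDiff ℝ ∞ (fun p : E × E => f p.1 p.2)) {C : Set E}
    (hC : IsCompact C) (h0 : ∀ t x, x ∉ C → f t x = 0) : ContDiff ℝ ∞ (fun t => ti (f t)) := by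
  rw [contDiff_infty]
  intro m
  induction m generalizing f with
  | zero =>
    refine contDiff_zero.2 (continuous_iff_continuousAt.2 fun t => ?_)
    exact (sc_hasFDerivAt hf hC h0 (stdOrthonormalBasis ℝ E) t).continuousAt
  | succ m ih =>
    rw [show ((m + 1 : ℕ) : WithTop ℕ∞) = m + 1 by push_cast; rfl, contDiff_succ_iff_hasFDerivAt]
    refine ⟨_, ?_, fun t => sc_hasFDerivAt hf hC h0 (stdOrthonormalBasis ℝ E) t⟩
    refine ContDiff.sum fun i _ => ?_
    have : ContDiff ℝ m (fun t => ti (fun x => fderiv ℝ (fun s => f s x) t (stdOrthonormalBasis ℝ E i))) := by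
      apply ih
      · refine ContDiff.clm_apply ?_ contDiff_const
        exact ContDiff.fderiv (𝕜 := ℝ) (n := ∞) (m := ∞) (f := fun (p : E × E) (s : E) => f s p.2)
          (g := fun p => p.1) (hf.comp (f := fun q : (E × E) × E => (q.2, q.1.2)) (by fun_prop)) contDiff_fst (by simp)
      · intro t x hx
        have : (fun s => f s x) = fun _ => 0 := by ext s; exact h0 s x hx
        rw [this]; simp
    exact contDiff_const.smulRight this
end
structure Dif (E : Type) [NormedAddCommGroup E] [InnerProductSpace ℝ E] where
  f : E ≃ₜ E
  s : ContDiff ℝ ∞ f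
  s' : ContDiff ℝ ∞ f.symm
  off : ∃ C : Set E, IsCompact C ∧ ∀ x, x ∉ C → f x = x
def Dif.symm (Φ : Dif E) : Dif E where
  f := Φ.f.symm
  s := Φ.s'
  s' := by simpa using Φ.s
  off := by
    obtain ⟨C, hC, h⟩ := Φ.off
    refine ⟨Φ.f '' C, hC.image Φ.f.continuous, fun x hx => ?_⟩
    have : Φ.f.symm x ∉ C := fun h' => hx ⟨_, h', by simp⟩
    have := h _ this
    simpa using this.symm
lemma Dif.hfd (Φ : Dif E) (x : E) : HasFDerivAt Φ.f (fderiv ℝ Φ.f x) x :=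
  (Φ.s.differentiable (by simp) x).hasFDerivAt
lemma Dif.fd_comp (Φ : Dif E) (x : E) :
    (fderiv ℝ Φ.symm.f (Φ.f x)) ∘L (fderiv ℝ Φ.f x) = ContinuousLinearMap.id ℝ E := by
  have h := (Φ.symm.hfd (Φ.f x)).comp x (Φ.hfd x)
  have h2 : (Φ.symm.f ∘ Φ.f) = id := by ext y; simp [Dif.symm]
  rw [h2] at h
  exact h.unique (hasFDerivAt_id x)
lemma Dif.fd_comp' (Φ : Dif E) (x : E) :
    (fderiv ℝ Φ.f x) ∘L (fderiv ℝ Φ.symm.f (Φ.f x)) = ContinuousLinearMap.id ℝ E := by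
  have := Φ.symm.fd_comp (Φ.f x)
  simpa [Dif.symm] using this
lemma Dif.fd_inv (Φ : Dif E) (x : E) :
    (fderiv ℝ Φ.f x).inverse = fderiv ℝ Φ.symm.f (Φ.f x) :=
  ContinuousLinearMap.inverse_eq (Φ.fd_comp' x) (Φ.fd_comp x)
lemma Dif.cov (Φ : Dif E) (h : E → ℝ) :
    ∫ x, h x = ∫ x, |(fderiv ℝ Φ.f x).det| * h (Φ.f x) := by
  have := integral_image_eq_integral_abs_det_fderiv_smul (volume : Measure E) MeasurableSet.univ
    (fun x _ => (Φ.hfd x).hasFDerivWithinAt) Φ.f.injective.injOn h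
  simpa [image_univ, Φ.f.surjective.range_eq] using this
lemma bdd_of_off {g : E → ℝ} (hg : Continuous g) {C : Set E} (hC : IsCompact C) {c : ℝ}
    (h : ∀ x, x ∉ C → g x = c) : ∃ M, 0 < M ∧ ∀ x, |g x| ≤ M := by
  obtain ⟨M, hM⟩ := hC.exists_bound_of_continuousOn hg.continuousOn
  refine ⟨max M |c| + 1, by positivity, fun x => ?_⟩
  by_cases hx : x ∈ C
  · have := hM x hx; rw [Real.norm_eq_abs] at this; linarith [le_max_left M |c|]
  · rw [h x hx]; linarith [le_max_right M |c|]
lemma Dif.fd_off (Φ : Dif E) {C : Set E} (hC : IsCompact C) (h : ∀ x, x ∉ C → Φ.f x = x) (x : E)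
    (hx : x ∉ C) : fderiv ℝ Φ.f x = ContinuousLinearMap.id ℝ E := by
  have : Φ.f =ᶠ[𝓝 x] id := by
    filter_upwards [hC.isClosed.isOpen_compl.mem_nhds hx] with y hy using h y hy
  rw [this.fderiv_eq, fderiv_id]
lemma Dif.fd_cont (Φ : Dif E) : Continuous (fderiv ℝ Φ.f) := Φ.s.continuous_fderiv (by simp)
lemma Dif.bound (Φ : Dif E) : ∃ M, 0 < M ∧ ∀ x, ‖fderiv ℝ Φ.f x‖ ≤ M := by
  obtain ⟨C, hC, h⟩ := Φ.off
  obtain ⟨M, hM, h2⟩ := bdd_of_off (g := fun x => ‖fderiv ℝ Φ.f x‖) (Φ.fd_cont.norm) hC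
    (c := ‖ContinuousLinearMap.id ℝ E‖) (fun x hx => by simp only [Φ.fd_off hC h x hx])
  exact ⟨M, hM, fun x => by simpa using h2 x⟩
lemma Dif.bound_det (Φ : Dif E) : ∃ M, 0 < M ∧ ∀ x, |(fderiv ℝ Φ.f x).det| ≤ M := by
  obtain ⟨C, hC, h⟩ := Φ.off
  exact bdd_of_off (g := fun x => (fderiv ℝ Φ.f x).det)
    (ContinuousLinearMap.continuous_det.comp Φ.fd_cont) hC
    (c := (ContinuousLinearMap.id ℝ E).det) (fun x hx => by simp only [Φ.fd_off hC h x hx])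
lemma grad_comp (Φ : Dif E) {φ : E → ℝ} (hφ : Differentiable ℝ φ) (x : E) :
    gradient (φ ∘ Φ.f) x = ContinuousLinearMap.adjoint (fderiv ℝ Φ.f x) (gradient φ (Φ.f x)) := by
  apply ext_inner_right ℝ
  intro y
  rw [inner_gradient_left, ContinuousLinearMap.adjoint_inner_left, inner_gradient_left,
    ((hφ (Φ.f x)).hasFDerivAt.comp x (Φ.hfd x)).fderiv]
  rfl
lemma comp_mem (Φ : Dif E) {D : Set E} (hΦ : ∀ x, Φ.f x ∈ D ↔ x ∈ D) {φ : E → ℝ} (h : φ ∈ TF D) :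
    φ ∘ Φ.f ∈ TF D := by
  have hs : tsupport (φ ∘ Φ.f) ⊆ Φ.f ⁻¹' tsupport φ :=
    closure_minimal (fun x hx => subset_tsupport _ hx) ((isClosed_tsupport φ).preimage Φ.f.continuous)
  refine ⟨h.1.comp Φ.s, h.2.1.comp_homeomorph Φ.f, fun x hx => ?_⟩
  exact (hΦ x).1 (h.2.2 (hs hx))
lemma Dif.symm_iff (Φ : Dif E) {D : Set E} (hΦ : ∀ x, Φ.f x ∈ D ↔ x ∈ D) (x : E) :
    Φ.symm.f x ∈ D ↔ x ∈ D := by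
  rw [← hΦ (Φ.symm.f x)]; simp [Dif.symm]
def cmp (Φ : Dif E) {D : Set E} (hΦ : ∀ x, Φ.f x ∈ D ↔ x ∈ D) : TF D →ₗ[ℝ] TF D where
  toFun φ := ⟨(φ : E → ℝ) ∘ Φ.f, comp_mem Φ hΦ φ.2⟩
  map_add' _ _ := rfl
  map_smul' _ _ := rfl
lemma norm_tl_sq {G : Type} [NormedAddCommGroup G] [InnerProductSpace ℝ G] {u : E → G}
    (hu : MemLp u 2 volume) : ‖tl u‖ ^ 2 = ∫ x, ‖u x‖ ^ 2 := by
  rw [← real_inner_self_eq_norm_sq, inner_tl_tl hu hu]; simp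
lemma cmp_bound (Φ : Dif E) {D : Set E} (hΦ : ∀ x, Φ.f x ∈ D ↔ x ∈ D) :
    ∃ C, ∀ φ : TF D, ‖(gK D ∘ₗ cmp Φ hΦ) φ‖ ≤ C * ‖gK D φ‖ := by
  obtain ⟨M, hM0, hM⟩ := Φ.bound
  obtain ⟨N, hN0, hN⟩ := Φ.symm.bound_det
  refine ⟨M * √N, fun φ => ?_⟩
  change ‖tl (gradient ((φ : E → ℝ) ∘ Φ.f))‖ ≤ _ * ‖tl (gradient (φ : E → ℝ))‖
  refine (sq_le_sq₀ (norm_nonneg _) (by positivity)).1 ?_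
  have m1 : MemLp (gradient ((φ : E → ℝ) ∘ Φ.f)) 2 volume := tfg (cmp Φ hΦ φ)
  have hg := contDiff_grad φ.2.1
  rw [mul_pow, mul_pow, Real.sq_sqrt hN0.le, norm_tl_sq (tfg φ), norm_tl_sq m1,
    Φ.symm.cov (fun x => ‖gradient ((φ : E → ℝ) ∘ Φ.f) x‖ ^ 2), ← integral_const_mul]
  have hcs : HasCompactSupport (fun x => ‖gradient (φ : E → ℝ) x‖ ^ 2) :=
    (cs_grad φ.2.2.1).comp_left (g := fun v : E => ‖v‖ ^ 2) (by simp)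
  have hcn : Continuous (fun x => ‖gradient (φ : E → ℝ) x‖ ^ 2) := hg.continuous.norm.pow 2
  have hin : Integrable (fun x => M ^ 2 * N * ‖gradient (φ : E → ℝ) x‖ ^ 2) volume :=
    (integ_cs hcn hcs).const_mul _
  apply integral_mono_of_nonneg
  · exact Eventually.of_forall fun x => by positivity
  · exact hin
  · refine Eventually.of_forall fun x => ?_
    have h1 : ‖gradient ((φ : E → ℝ) ∘ Φ.f) (Φ.symm.f x)‖ ≤ M * ‖gradient (φ : E → ℝ) x‖ := by
      rw [grad_comp Φ (tfd φ)]
      have : Φ.f (Φ.symm.f x) = x := by simp [Dif.symm]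
      rw [this]
      refine (ContinuousLinearMap.le_opNorm _ _).trans ?_
      gcongr
      rw [LinearIsometryEquiv.norm_map]; exact hM _
    calc _ ≤ N * (M * ‖gradient (φ : E → ℝ) x‖) ^ 2 := by
          simp only; gcongr; exact hN x
      _ = _ := by ring
def TT (Φ : Dif E) {D : Set E} (hΦ : ∀ x, Φ.f x ∈ D ↔ x ∈ D) : KK D →L[ℝ] KK D :=
  (gK D ∘ₗ cmp Φ hΦ).extendOfNorm (gK D)
lemma TT_g (Φ : Dif E) {D : Set E} (hΦ : ∀ x, Φ.f x ∈ D ↔ x ∈ D) (φ : TF D) :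
    TT Φ hΦ (gK D φ) = gK D (cmp Φ hΦ φ) :=
  LinearMap.extendOfNorm_eq (gK_dense D) (cmp_bound Φ hΦ) φ
lemma JJ_TT [Nontrivial E] (Φ : Dif E) {D : Set E} (hD : Bornology.IsBounded D)
    (hΦ : ∀ x, Φ.f x ∈ D ↔ x ∈ D) (k : KK D) {u ψ : E → ℝ} (hu : JJ D k =ᵐ[volume] u)
    (hψ : Continuous ψ) (hc : HasCompactSupport ψ) :
    ∫ x, JJ D (TT Φ hΦ k) x * ψ x = ∫ x, u (Φ.f x) * ψ x := by
  have hcd : Continuous fun x => |(fderiv ℝ Φ.symm.f x).det| :=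
    (ContinuousLinearMap.continuous_det.comp Φ.symm.fd_cont).abs
  have m1 : MemLp ψ 2 volume := memLp_cs hψ hc
  have m2 : MemLp (fun x => |(fderiv ℝ Φ.symm.f x).det| * ψ (Φ.symm.f x)) 2 volume :=
    memLp_cs (hcd.mul (hψ.comp Φ.symm.f.continuous)) (hc.comp_homeomorph Φ.symm.f).mul_left
  have e1 : ∀ u : E → ℝ, ∫ x, u (Φ.f x) * ψ x
      = ∫ x, u x * (|(fderiv ℝ Φ.symm.f x).det| * ψ (Φ.symm.f x)) := by
    intro u
    rw [Φ.symm.cov (fun x => u (Φ.f x) * ψ x)]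
    congr 1; ext x
    have : Φ.f (Φ.symm.f x) = x := by simp [Dif.symm]
    rw [this]; ring
  have e2 : ∫ x, u (Φ.f x) * ψ x
      = inner ℝ (JJ D k) (tl (fun x => |(fderiv ℝ Φ.symm.f x).det| * ψ (Φ.symm.f x))) := by
    rw [e1, inner_tlR _ m2]
    apply integral_congr_ae
    filter_upwards [hu] with x hx; rw [hx]
  rw [e2, ← inner_tlR _ m1]
  refine (gK_dense D).induction_on (p := fun k : KK D => inner ℝ (JJ D (TT Φ hΦ k)) (tl ψ) =
    inner ℝ (JJ D k) (tl (fun x => |(fderiv ℝ Φ.symm.f x).det| * ψ (Φ.symm.f x)))) k ?_ ?_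
  · exact isClosed_eq (by fun_prop) (by fun_prop)
  · intro φ
    rw [TT_g, JJ_g hD, JJ_g hD, inner_tlRR (tfm _) m1, inner_tlRR (tfm _) m2, ← e1]
    rfl
def aF (g : E → E) (x : E) : E →L[ℝ] E :=
  |(fderiv ℝ g x).det| • ((fderiv ℝ g x).inverse ∘L ContinuousLinearMap.adjoint (fderiv ℝ g x).inverse)
def MO : Lp (E →L[ℝ] E) ⊤ (volume : Measure E) →L[ℝ] Lp E 2 (volume : Measure E) →L[ℝ]
    Lp E 2 (volume : Measure E) :=
  (ContinuousLinearMap.id ℝ (E →L[ℝ] E)).holderL volume ⊤ 2 2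
lemma MO_ae (a : Lp (E →L[ℝ] E) ⊤ (volume : Measure E)) (v : Lp E 2 (volume : Measure E)) :
    MO a v =ᵐ[volume] fun x => a x (v x) :=
  ContinuousLinearMap.coeFn_holder (ContinuousLinearMap.id ℝ (E →L[ℝ] E)) a v
lemma TT_form (Φ : Dif E) {D : Set E} (hΦ : ∀ x, Φ.f x ∈ D ↔ x ∈ D) (k : KK D) (φ : TF D)
    (hm : MemLp (fun x => aF Φ.f x - ContinuousLinearMap.id ℝ E) ⊤ volume) :
    inner ℝ ((TT Φ hΦ k : Lp E 2 volume)
      + MO (ti (fun x => aF Φ.f x - ContinuousLinearMap.id ℝ E)) (TT Φ hΦ k : Lp E 2 volume)) (gL D φ)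
     = inner ℝ k (gK D (cmp Φ.symm (Φ.symm_iff hΦ) φ)) := by
  refine (gK_dense D).induction_on (p := fun k : KK D => inner ℝ ((TT Φ hΦ k : Lp E 2 volume)
      + MO (ti (fun x => aF Φ.f x - ContinuousLinearMap.id ℝ E)) (TT Φ hΦ k : Lp E 2 volume)) (gL D φ)
     = inner ℝ k (gK D (cmp Φ.symm (Φ.symm_iff hΦ) φ))) k ?_ ?_
  · exact isClosed_eq (by fun_prop) (by fun_prop)
  intro ψ
  rw [TT_g]
  change inner ℝ (tl (gradient ((ψ : E → ℝ) ∘ Φ.f)) + MO _ (tl (gradient ((ψ : E → ℝ) ∘ Φ.f))))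
    (tl (gradient (φ : E → ℝ))) = inner ℝ (tl (gradient (ψ : E → ℝ))) (tl (gradient ((φ : E → ℝ) ∘ Φ.symm.f)))
  have m1 : MemLp (gradient ((ψ : E → ℝ) ∘ Φ.f)) 2 volume := tfg (cmp Φ hΦ ψ)
  have m2 : MemLp (gradient ((φ : E → ℝ) ∘ Φ.symm.f)) 2 volume := tfg (cmp Φ.symm (Φ.symm_iff hΦ) φ)
  rw [inner_tl_tl (tfg ψ) m2, inner_tl _ (tfg φ),
    Φ.cov (fun x => inner ℝ (gradient (ψ : E → ℝ) x) (gradient ((φ : E → ℝ) ∘ Φ.symm.f) x))]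
  apply integral_congr_ae
  filter_upwards [Lp.coeFn_add (tl (gradient ((ψ : E → ℝ) ∘ Φ.f)))
    (MO (ti (fun x => aF Φ.f x - ContinuousLinearMap.id ℝ E)) (tl (gradient ((ψ : E → ℝ) ∘ Φ.f)))),
    MO_ae (ti (fun x => aF Φ.f x - ContinuousLinearMap.id ℝ E)) (tl (gradient ((ψ : E → ℝ) ∘ Φ.f))),
    ti_ae hm, tl_ae m1] with x h1 h2 h3 h4
  rw [h1, Pi.add_apply, h2, h3]
  rw [h4, sub_apply, ContinuousLinearMap.id_apply, add_sub_cancel, grad_comp Φ (tfd ψ)]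
  change _ = _ * inner ℝ (gradient (ψ : E → ℝ) (Φ.f x)) (gradient ((φ : E → ℝ) ∘ Φ.symm.f) (Φ.f x))
  rw [grad_comp Φ.symm (tfd φ)]
  have : Φ.symm.f (Φ.f x) = x := by simp [Dif.symm]
  rw [this, ContinuousLinearMap.adjoint_inner_right, ← Φ.fd_inv, aF, smul_apply, real_inner_smul_left]
  congr 2
  rw [ContinuousLinearMap.comp_apply]
  congr 1
  rw [← ContinuousLinearMap.comp_apply, ← ContinuousLinearMap.adjoint_comp, Φ.fd_inv, Φ.fd_comp']
  rw [show ContinuousLinearMap.adjoint (ContinuousLinearMap.id ℝ E) = ContinuousLinearMap.id ℝ E from ContinuousLinearMap.adjoint_id, ContinuousLinearMap.id_apply]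
lemma cd_glue {G : Type} [NormedAddCommGroup G] [NormedSpace ℝ G] {χ : E → ℝ} {g : E → G} {U : Set E}
    (hU : IsOpen U) (hχ : ContDiff ℝ ∞ χ) (hs : tsupport χ ⊆ U) (hg : ContDiffOn ℝ ∞ g U) :
    ContDiff ℝ ∞ (fun x => χ x • g x) := by
  rw [contDiff_iff_contDiffAt]
  intro x
  by_cases hx : x ∈ U
  · exact hχ.contDiffAt.smul (hg.contDiffAt (hU.mem_nhds hx))
  · have h0 : χ =ᶠ[𝓝 x] 0 := notMem_tsupport_iff_eventuallyEq.1 (fun h => hx (hs h))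
    have : (fun x => χ x • g x) =ᶠ[𝓝 x] fun _ => 0 := by
      filter_upwards [h0] with y hy; simp [hy]
    exact contDiffAt_const.congr_of_eventuallyEq this
lemma mkDif {F : E → E} (hF : ContDiff ℝ ∞ F) (hc : HasCompactSupport F)
    (hb : ∀ x, ‖fderiv ℝ F x‖ ≤ 1 / 2) : ∃ Φ : Dif E, ∀ x, Φ.f x = x + F x := by
  have hFd : Differentiable ℝ F := hF.differentiable (by simp)
  have hL : LipschitzWith (1 / 2) F := by
    apply lipschitzWith_of_nnnorm_fderiv_le hFd
    intro x
    rw [← NNReal.coe_le_coe]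
    simpa using hb x
  have hA : ApproximatesLinearOn (fun x => x + F x)
      ((ContinuousLinearEquiv.refl ℝ E : E ≃L[ℝ] E) : E →L[ℝ] E) univ (1 / 2) := by
    intro x _ y _
    have := hL.norm_sub_le x y
    have e : x + F x - (y + F y) - ((ContinuousLinearEquiv.refl ℝ E : E ≃L[ℝ] E) : E →L[ℝ] E) (x - y)
        = F x - F y := by
      change x + F x - (y + F y) - (x - y) = F x - F y
      abel
    change ‖x + F x - (y + F y) - _‖ ≤ _
    rw [e]; exact this
  have hc' : Subsingleton E ∨ (1 / 2 : NNReal) <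
      ‖((ContinuousLinearEquiv.refl ℝ E).symm : E →L[ℝ] E)‖₊⁻¹ := by
    by_cases h : Subsingleton E
    · exact Or.inl h
    · right
      haveI : Nontrivial E := not_subsingleton_iff_nontrivial.1 h
      have : ‖((ContinuousLinearEquiv.refl ℝ E).symm : E →L[ℝ] E)‖₊ = 1 := by
        have : ‖((ContinuousLinearEquiv.refl ℝ E).symm : E →L[ℝ] E)‖ = 1 :=
          ContinuousLinearMap.norm_id
        exact NNReal.eq this
      rw [this]; norm_num
  let f : E ≃ₜ E := hA.toHomeomorph _ hc'
  have hf : ∀ x, f x = x + F x := fun x => rfl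
  have hs : ContDiff ℝ ∞ f := by
    have : (f : E → E) = fun x => x + F x := funext hf
    rw [this]; exact contDiff_id.add hF
  have hU : ∀ x, ‖-(fderiv ℝ F x)‖ < 1 := fun x => by rw [norm_neg]; linarith [hb x]
  refine ⟨⟨f, hs, ?_, tsupport F, hc, fun x hx => ?_⟩, hf⟩
  · refine f.contDiff_symm (f₀' := fun x => ContinuousLinearEquiv.ofUnit (Units.oneSub _ (hU x)))
      (fun x => ?_) hs
    have h1 : HasFDerivAt (fun x => x + F x) (ContinuousLinearMap.id ℝ E + fderiv ℝ F x) x :=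
      (hasFDerivAt_id x).add (hFd x).hasFDerivAt
    have e : ((ContinuousLinearEquiv.ofUnit (Units.oneSub _ (hU x)) : E ≃L[ℝ] E) : E →L[ℝ] E)
        = ContinuousLinearMap.id ℝ E + fderiv ℝ F x := by
      ext y
      change (1 - -fderiv ℝ F x) y = _
      simp
    rw [e]; exact h1
  · rw [hf, image_eq_zero_of_notMem_tsupport hx, add_zero]
def LocDef (D : Set E) (p : E) : Prop := ∃ (U : Set E) (σ : E → ℝ), IsOpen U ∧ p ∈ U ∧
  ContDiffOn ℝ ∞ σ U ∧ σ p = 0 ∧ fderiv ℝ σ p ≠ 0 ∧ ∀ x ∈ U, x ∈ D ↔ σ x < 0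
lemma flatten {D : Set E} {p : E} (h : LocDef D p) : ∃ (S : Dif E) (ν : E) (O : Set E),
    ‖ν‖ = 1 ∧ IsOpen O ∧ p ∈ O ∧ S.f p = p ∧ ∀ x ∈ O, x ∈ D ↔ inner ℝ (S.f x - p) ν < 0 := by
  obtain ⟨U, σ, hU, hpU, hσ, hσp, hdσ, hDσ⟩ := h
  have hg0 : gradient σ p ≠ 0 := by
    intro h; apply hdσ; ext y; rw [← inner_gradient_left, h]; simp
  set m := ‖gradient σ p‖ with hm
  have hm0 : 0 < m := norm_pos_iff.2 hg0
  set ν := m⁻¹ • gradient σ p with hν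
  have hν1 : ‖ν‖ = 1 := by
    rw [hν, norm_smul, norm_inv, Real.norm_of_nonneg hm0.le, ← hm, inv_mul_cancel₀ hm0.ne']
  let q : E → ℝ := fun x => m⁻¹ * σ x - inner ℝ (x - p) ν
  have hq : ContDiffOn ℝ ∞ q U :=
    (contDiffOn_const.mul hσ).sub ((contDiff_id.sub contDiff_const).inner ℝ contDiff_const).contDiffOn
  have hqp : q p = 0 := by simp [q, hσp]
  have hqd : fderiv ℝ q p = 0 := by
    have h1 : HasFDerivAt σ (fderiv ℝ σ p) p :=
      ((hσ.contDiffAt (hU.mem_nhds hpU)).differentiableAt (by simp)).hasFDerivAt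
    have h2 : HasFDerivAt (fun x => inner ℝ (x - p) ν) (innerSL ℝ ν) p := by
      have : (fun x => inner ℝ (x - p) ν) = fun x => innerSL ℝ ν (x - p) := by
        ext x; simp [real_inner_comm]
      rw [this]
      exact (innerSL ℝ ν).hasFDerivAt.comp p ((hasFDerivAt_id p).sub_const p)
    have h3 : fderiv ℝ q p = _ := ((h1.const_mul m⁻¹).sub h2).fderiv
    rw [h3]
    ext y
    simp [hν, real_inner_smul_left, inner_gradient_left]
  let κ : ContDiffBump (0 : E) := ⟨1 / 2, 1, by norm_num, by norm_num⟩
  have hκ : ContDiff ℝ ∞ κ := κ.contDiff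
  obtain ⟨C, hC⟩ := (hκ.continuous_fderiv (by simp)).bounded_above_of_compact_support
    (κ.hasCompactSupport.fderiv ℝ)
  have hC0 : 0 ≤ C := (norm_nonneg _).trans (hC 0)
  set ε := 1 / (2 * (1 + C)) with hε
  have hε0 : 0 < ε := by positivity
  have hcf : ContinuousAt (fderiv ℝ q) p :=
    (hq.continuousOn_fderiv_of_isOpen hU (by simp)).continuousAt (hU.mem_nhds hpU)
  have hev : ∀ᶠ x in 𝓝 p, x ∈ U ∧ ‖fderiv ℝ q x‖ ≤ ε := by
    have hu : ∀ᶠ x in 𝓝 p, x ∈ U := hU.mem_nhds hpU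
    refine hu.and ?_
    have : ∀ᶠ x in 𝓝 p, ‖fderiv ℝ q x‖ < ε := by
      apply hcf.norm.eventually_lt_const
      simp only [hqd]; simpa using hε0
    exact this.mono fun x hx => hx.le
  obtain ⟨δ0, hδ0, hball⟩ := Metric.eventually_nhds_iff_ball.1 hev
  have hbU : Metric.ball p δ0 ⊆ U := fun x hx => (hball x hx).1
  have hqL : ∀ x ∈ Metric.ball p δ0, |q x| ≤ ε * ‖x - p‖ := by
    intro x hx
    have := (convex_ball p δ0).norm_image_sub_le_of_norm_fderiv_le (f := q) (C := ε) (x := p) (y := x)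
      (fun y hy => (hq.contDiffAt (hU.mem_nhds (hbU hy))).differentiableAt (by simp))
      (fun y hy => (hball y hy).2) (Metric.mem_ball_self hδ0) hx
    simpa [hqp] using this
  set δ := δ0 / 2 with hδ
  have hδp : 0 < δ := by positivity
  let K : E → ℝ := fun x => κ (δ⁻¹ • (x - p))
  have hK : ContDiff ℝ ∞ K := hκ.comp (contDiff_const.smul (contDiff_id.sub contDiff_const))
  have hKs : tsupport K ⊆ Metric.closedBall p δ := by
    apply closure_minimal _ Metric.isClosed_closedBall
    intro x hx
    by_contra hx2
    apply hx
    apply κ.zero_of_le_dist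
    change 1 ≤ _
    rw [dist_zero_right, norm_smul, norm_inv, Real.norm_of_nonneg hδp.le, ← div_eq_inv_mul, one_le_div hδp]
    rw [Metric.mem_closedBall, dist_eq_norm] at hx2
    linarith
  have hcb : Metric.closedBall p δ ⊆ Metric.ball p δ0 :=
    Metric.closedBall_subset_ball (by rw [hδ]; linarith)
  let F : E → E := fun x => K x • (q x • ν)
  have hF : ContDiff ℝ ∞ F := cd_glue hU hK ((hKs.trans hcb).trans hbU) (hq.smul contDiffOn_const)
  have hFs : ∀ x, x ∉ tsupport K → F x = 0 := fun x hx => by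
    simp [F, image_eq_zero_of_notMem_tsupport hx]
  have hKc : HasCompactSupport K := HasCompactSupport.of_support_subset_isCompact
      (isCompact_closedBall p δ) ((subset_tsupport K).trans hKs)
  have hFc : HasCompactSupport F := HasCompactSupport.intro hKc hFs
  have hKd : ∀ x, ‖fderiv ℝ K x‖ ≤ C / δ := by
    intro x
    have h1 : HasFDerivAt (fun x => δ⁻¹ • (x - p)) (δ⁻¹ • ContinuousLinearMap.id ℝ E) x :=
      ((hasFDerivAt_id x).sub_const p).const_smul δ⁻¹
    have h2 := (hκ.differentiable (by simp) (δ⁻¹ • (x - p))).hasFDerivAt.comp x h1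
    have h3 : fderiv ℝ K x = _ := h2.fderiv
    rw [h3, ContinuousLinearMap.comp_smul, ContinuousLinearMap.comp_id, norm_smul, norm_inv,
      Real.norm_of_nonneg hδp.le, div_eq_inv_mul]
    gcongr; exact hC _
  have hFb : ∀ x, ‖fderiv ℝ F x‖ ≤ 1 / 2 := by
    intro x
    by_cases hx : x ∈ tsupport K
    · have hxb := hcb (hKs hx)
      have hqx := (hq.contDiffAt (hU.mem_nhds (hbU hxb))).differentiableAt (by simp)
      have h1 : HasFDerivAt F _ x := (hK.differentiable (by simp) x).hasFDerivAt.smul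
        (hqx.hasFDerivAt.smul_const ν)
      rw [h1.fderiv]
      have hxd : ‖x - p‖ ≤ δ := by rw [← dist_eq_norm]; exact hKs hx
      have hK1 : |K x| ≤ 1 := by rw [abs_of_nonneg κ.nonneg]; exact κ.le_one
      calc _ ≤ 1 * (ε * 1) + (C / δ) * ((ε * δ) * 1) := by
            refine (norm_add_le _ _).trans (add_le_add ?_ ?_)
            · rw [norm_smul]
              gcongr
              · exact hK1
              rw [ContinuousLinearMap.norm_smulRight_apply, hν1]
              gcongr; exact (hball x hxb).2
            · rw [ContinuousLinearMap.norm_smulRight_apply, norm_smul, hν1]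
              gcongr
              · exact hKd x
              · exact (hqL x hxb).trans (by gcongr)
        _ = 1 / 2 := by rw [hε]; field_simp
    · have : F =ᶠ[𝓝 x] fun _ => 0 := by
        filter_upwards [(isClosed_tsupport K).isOpen_compl.mem_nhds hx] with y hy using hFs y hy
      rw [this.fderiv_eq]; simp
  obtain ⟨S, hS⟩ := mkDif hF hFc hFb
  refine ⟨S, ν, Metric.ball p (δ / 2), hν1, Metric.isOpen_ball, Metric.mem_ball_self (by positivity), ?_, ?_⟩
  · rw [hS]; simp [F, hqp]
  · intro x hx
    have hxb : x ∈ Metric.ball p δ0 := Metric.ball_subset_ball (by rw [hδ]; linarith) hx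
    rw [hDσ x (hbU hxb), hS]
    have hK1 : K x = 1 := by
      apply κ.one_of_mem_closedBall
      rw [mem_closedBall_zero_iff, norm_smul, norm_inv, Real.norm_of_nonneg hδp.le, ← div_eq_inv_mul]
      change _ ≤ 1 / 2
      rw [div_le_iff₀ hδp]
      rw [Metric.mem_ball, dist_eq_norm] at hx; linarith
    have : inner ℝ (x + F x - p) ν = m⁻¹ * σ x := by
      simp only [F, hK1, one_smul]
      rw [add_sub_right_comm, inner_add_left, real_inner_smul_left, real_inner_self_eq_norm_sq, hν1]
      simp [q]
    rw [this]
    constructor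
    · intro h; exact mul_neg_of_pos_of_neg (by positivity) h
    · intro h
      by_contra h2
      push Not at h2
      have : 0 ≤ m⁻¹ * σ x := by positivity
      linarith
def Dif.trans (Φ Ψ : Dif E) : Dif E where
  f := Φ.f.trans Ψ.f
  s := Ψ.s.comp Φ.s
  s' := Φ.s'.comp Ψ.s'
  off := by
    obtain ⟨C, hC, h⟩ := Φ.off
    obtain ⟨C', hC', h'⟩ := Ψ.off
    refine ⟨C ∪ C', hC.union hC', fun x hx => ?_⟩
    rw [mem_union, not_or] at hx
    simp [h x hx.1, h' x hx.2]
structure Flat (D : Set E) where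
  S : Dif E
  p : E
  ν : E
  R : ℝ
  hR : 0 < R
  hν : ‖ν‖ = 1
  hD : ∀ y ∈ Metric.ball p (3 * R), S.symm.f y ∈ D ↔ inner ℝ (y - p) ν < 0
lemma flat_exists {D A : Set E} {p : E} (h : LocDef D p) (hA : IsClosed A) (hp : p ∉ A) :
    ∃ F : Flat D, F.p = p ∧ F.S.f p = p ∧ ∀ y ∈ Metric.ball p (3 * F.R), F.S.symm.f y ∉ A := by
  obtain ⟨S, ν, O, hν, hO, hpO, hSp, hD⟩ := flatten h
  have hSp' : S.symm.f p = p := by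
    have : S.symm.f (S.f p) = p := by simp [Dif.symm]
    rwa [hSp] at this
  have ho : IsOpen (S.symm.f ⁻¹' (O ∩ Aᶜ)) := (hO.inter hA.isOpen_compl).preimage S.symm.f.continuous
  obtain ⟨r, hr, hb⟩ := Metric.isOpen_iff.1 ho p (by rw [mem_preimage, hSp']; exact ⟨hpO, hp⟩)
  have e : 3 * (r / 3) = r := by ring
  refine ⟨⟨S, p, ν, r / 3, by positivity, hν, fun y hy => ?_⟩, rfl, hSp, fun y hy => ?_⟩
  · rw [e] at hy
    rw [hD _ (hb hy).1]
    simp [Dif.symm]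
  · simp only [e] at hy
    exact (hb hy).2
def PT (ν : E) : E →L[ℝ] E := ContinuousLinearMap.id ℝ E - (innerSL ℝ ν).smulRight ν
lemma PT_apply (ν a : E) : PT ν a = a - inner ℝ ν a • ν := by simp [PT]
lemma PT_inner {ν : E} (h : ‖ν‖ = 1) (a : E) : inner ℝ (PT ν a) ν = 0 := by
  rw [PT_apply, inner_sub_left, real_inner_smul_left, real_inner_self_eq_norm_sq, h, real_inner_comm]
  simp
lemma family {D : Set E} (F : Flat D) : ∃ Φ : E → Dif E,
    ContDiff ℝ ∞ (fun z : E × E => (Φ z.1).f z.2) ∧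
    (∀ t x, F.S.f x ∉ Metric.closedBall F.p (2 * F.R) → (Φ t).f x = x) ∧
    (∀ t x, (Φ t).f x ∈ D ↔ x ∈ D) ∧
    (∀ᶠ t in 𝓝 (0 : E), ∀ x, F.S.f x ∈ Metric.ball F.p F.R → (Φ t).f x = F.S.symm.f (F.S.f x + PT F.ν t)) ∧
    (∀ x, (Φ 0).f x = x) := by
  let χ : ContDiffBump F.p := ⟨F.R, 2 * F.R, F.hR, by linarith [F.hR]⟩
  have hχ : ContDiff ℝ ∞ χ := χ.contDiff
  obtain ⟨C, hC⟩ := (hχ.continuous_fderiv (by simp)).bounded_above_of_compact_support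
    (χ.hasCompactSupport.fderiv ℝ)
  have hC0 : 0 ≤ C := (norm_nonneg _).trans (hC 0)
  set A := ‖PT F.ν‖ + 1 with hA
  have hA0 : 0 < A := by positivity
  set ε := min F.R (1 / (2 * (C + 1))) / A with hε
  have hε0 : 0 < ε := by have := F.hR; positivity
  have hεA : A * ε = min F.R (1 / (2 * (C + 1))) := by rw [hε]; field_simp
  let b : ContDiffBump (0 : E) := ⟨ε / 2, ε, by positivity, by linarith⟩
  have hb : ContDiff ℝ ∞ b := b.contDiff
  let τ : E → E := fun t => b t • PT F.ν t
  have hτ : ContDiff ℝ ∞ τ := hb.smul (PT F.ν).contDiff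
  have hτb : ∀ t, ‖τ t‖ ≤ min F.R (1 / (2 * (C + 1))) := by
    intro t
    rw [← hεA]
    by_cases ht : ε ≤ dist t 0
    · have : b t = 0 := b.zero_of_le_dist ht
      simp only [τ, this, zero_smul, norm_zero]; positivity
    · rw [dist_zero_right, not_le] at ht
      simp only [τ]; rw [norm_smul, Real.norm_of_nonneg b.nonneg]
      calc b t * ‖PT F.ν t‖ ≤ 1 * (‖PT F.ν‖ * ‖t‖) := by
            gcongr
            · exact b.le_one
            · exact ContinuousLinearMap.le_opNorm _ _
        _ ≤ A * ε := by rw [one_mul]; gcongr; rw [hA]; linarith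
  have hτν : ∀ t, inner ℝ (τ t) F.ν = 0 := fun t => by
    simp only [τ]; rw [real_inner_smul_left, PT_inner F.hν, mul_zero]
  have hY : ∀ t, ∃ Y : Dif E, ∀ y, Y.f y = y + χ y • τ t := by
    intro t
    refine mkDif (F := fun y => χ y • τ t) (hχ.smul contDiff_const) χ.hasCompactSupport.smul_right ?_
    intro x
    have h1 : HasFDerivAt (fun y => χ y • τ t) _ x :=
      (hχ.differentiable (by simp) x).hasFDerivAt.smul_const (τ t)
    rw [h1.fderiv, ContinuousLinearMap.norm_smulRight_apply]
    calc _ ≤ C * (1 / (2 * (C + 1))) := by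
          gcongr
          · exact hC x
          · exact (hτb t).trans (min_le_right _ _)
      _ ≤ 1 / 2 := by
        rw [mul_one_div, div_le_div_iff₀ (by positivity) (by norm_num)]; linarith
  choose Y hY using hY
  have hval : ∀ t x, ((F.S.trans (Y t)).trans F.S.symm).f x
      = F.S.symm.f (F.S.f x + χ (F.S.f x) • τ t) := by
    intro t x
    rw [← hY]; rfl
  have hSS : ∀ x, F.S.symm.f (F.S.f x) = x := fun x => by simp [Dif.symm]
  have hz : ∀ t x, F.S.f x ∉ Metric.closedBall F.p (2 * F.R) →
      F.S.symm.f (F.S.f x + χ (F.S.f x) • τ t) = x := by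
    intro t x hx
    have : χ (F.S.f x) = 0 := by
      apply χ.zero_of_le_dist
      rw [Metric.mem_closedBall, not_le] at hx
      exact hx.le
    rw [this, zero_smul, add_zero, hSS]
  refine ⟨fun t => (F.S.trans (Y t)).trans F.S.symm, ?_, ?_, ?_, ?_, ?_⟩
  · simp only [hval]
    have h1 : ContDiff ℝ ∞ (fun z : E × E => F.S.f z.2) := F.S.s.comp contDiff_snd
    exact F.S.symm.s.comp (h1.add ((hχ.comp h1).smul (hτ.comp contDiff_fst)))
  · intro t x hx; rw [hval]; exact hz t x hx
  · intro t x
    rw [hval]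
    by_cases hx : F.S.f x ∈ Metric.closedBall F.p (2 * F.R)
    · have h2 : F.S.f x ∈ Metric.ball F.p (3 * F.R) :=
        Metric.closedBall_subset_ball (by linarith [F.hR]) hx
      have h3 : F.S.f x + χ (F.S.f x) • τ t ∈ Metric.ball F.p (3 * F.R) := by
        by_cases h4 : F.S.f x ∈ Metric.ball F.p (2 * F.R)
        · have h5 : ‖χ (F.S.f x) • τ t‖ ≤ F.R := by
            rw [norm_smul, Real.norm_of_nonneg χ.nonneg]
            calc _ ≤ 1 * ‖τ t‖ := by gcongr; exact χ.le_one
              _ ≤ F.R := by rw [one_mul]; exact (hτb t).trans (min_le_left _ _)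
          rw [Metric.mem_ball, dist_eq_norm] at h4 ⊢
          calc _ = ‖(F.S.f x - F.p) + χ (F.S.f x) • τ t‖ := by congr 1; abel
            _ ≤ _ := norm_add_le _ _
            _ < _ := by linarith
        · have : χ (F.S.f x) = 0 := by
            apply χ.zero_of_le_dist
            rwa [Metric.mem_ball, not_lt] at h4
          rw [this, zero_smul, add_zero]; exact h2
      rw [F.hD _ h3, add_sub_right_comm, inner_add_left, real_inner_smul_left, hτν, mul_zero, add_zero,
        ← F.hD _ h2, hSS]
    · rw [hz t x hx]
  · filter_upwards [Metric.ball_mem_nhds (0 : E) (show 0 < ε / 2 by positivity)] with t ht x hx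
    rw [hval]
    have h1 : χ (F.S.f x) = 1 := χ.one_of_mem_closedBall (Metric.ball_subset_closedBall hx)
    have h2 : b t = 1 := b.one_of_mem_closedBall (Metric.ball_subset_closedBall ht)
    simp only [τ, h1, h2, one_smul]
  · intro x
    rw [hval]
    simp only [τ, map_zero, smul_zero, add_zero, hSS]
def adjR : (E →L[ℝ] E) →L[ℝ] (E →L[ℝ] E) :=
  LinearMap.mkContinuous
    { toFun := fun A => ContinuousLinearMap.adjoint A
      map_add' := fun A B => map_add _ A B
      map_smul' := fun c A => by simp } 1 (fun A => by simp)
lemma contDiff_det : ContDiff ℝ ∞ (fun A : E →L[ℝ] E => A.det) := by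
  let b := stdOrthonormalBasis ℝ E
  have : (fun A : E →L[ℝ] E => A.det) = fun A : E →L[ℝ] E =>
      (Matrix.of fun i j => inner ℝ (b i) (A (b j))).det := by
    ext A
    rw [ContinuousLinearMap.det, ← LinearMap.det_toMatrix b.toBasis]
    congr 1
    ext i j
    simp [LinearMap.toMatrix_apply, OrthonormalBasis.repr_apply_apply]
  rw [this]
  simp only [Matrix.det_apply]
  refine ContDiff.sum fun σ _ => ?_
  refine ContDiff.const_smul _ ?_
  refine contDiff_prod fun i _ => ?_
  exact contDiff_const.inner ℝ (contDiff_id.clm_apply contDiff_const)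
lemma aF_smooth {Φ : E → Dif E} (h : ContDiff ℝ ∞ (fun z : E × E => (Φ z.1).f z.2)) :
    ContDiff ℝ ∞ (fun z : E × E => aF (Φ z.1).f z.2) := by
  have h1 : ContDiff ℝ ∞ (fun z : E × E => fderiv ℝ (Φ z.1).f z.2) := by
    refine ContDiff.fderiv (n := ∞) (m := ∞) (f := fun (z : E × E) (s : E) => (Φ z.1).f s)
      (g := fun z : E × E => z.2) ?_ contDiff_snd (by simp)
    exact h.comp (f := fun q : (E × E) × E => (q.1.1, q.2)) (by fun_prop)
  have hcomp : ∀ z : E × E, ∃ e : E ≃L[ℝ] E, (e : E →L[ℝ] E) = fderiv ℝ (Φ z.1).f z.2 := fun z =>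
    ⟨ContinuousLinearEquiv.equivOfInverse (fderiv ℝ (Φ z.1).f z.2)
      (fderiv ℝ (Φ z.1).symm.f ((Φ z.1).f z.2))
      (fun x => by have := (Φ z.1).fd_comp z.2; exact congrArg (fun A => A x) this)
      (fun x => by have := (Φ z.1).fd_comp' z.2; exact congrArg (fun A => A x) this), rfl⟩
  have h2 : ContDiff ℝ ∞ (fun z : E × E => (fderiv ℝ (Φ z.1).f z.2).inverse) := by
    rw [contDiff_iff_contDiffAt]
    intro z
    obtain ⟨e, he⟩ := hcomp z
    have := contDiffAt_map_inverse (n := ∞) (𝕜 := ℝ) e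
    rw [he] at this
    exact this.comp z h1.contDiffAt
  have h3 : ContDiff ℝ ∞ (fun z : E × E => |(fderiv ℝ (Φ z.1).f z.2).det|) := by
    rw [contDiff_iff_contDiffAt]
    intro z
    obtain ⟨e, he⟩ := hcomp z
    have hne : (fderiv ℝ (Φ z.1).f z.2).det ≠ 0 := by
      rw [← he]; exact (LinearEquiv.isUnit_det' e.toLinearEquiv).ne_zero
    exact (contDiffAt_abs hne).comp z (contDiff_det.comp h1).contDiffAt
  have h4 : ContDiff ℝ ∞ (fun z : E × E =>
      ContinuousLinearMap.adjoint (fderiv ℝ (Φ z.1).f z.2).inverse) :=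
    (adjR (E := E)).contDiff.comp h2
  exact h3.smul (h2.clm_comp h4)
lemma aF_id {g : E → E} {x : E} (h : g =ᶠ[𝓝 x] id) : aF g x = ContinuousLinearMap.id ℝ E := by
  have h1 : fderiv ℝ g x = ContinuousLinearMap.id ℝ E := by rw [h.fderiv_eq, fderiv_id]
  rw [aF, h1, ContinuousLinearMap.inverse_id, ContinuousLinearMap.adjoint_id]
  have : (ContinuousLinearMap.id ℝ E).det = 1 := LinearMap.det_id
  rw [this]; simp
lemma smooth_dep [Nontrivial E] {D : Set E} (hD : Bornology.IsBounded D) (F : Flat D)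
    (r : L2E)
    (hr : ∀ᵐ x, F.S.f x ∈ Metric.closedBall F.p (2 * F.R) → r x = 0) {w : E → ℝ}
    (hw : GG D r =ᵐ[volume] w) : ∃ k : E → KK D, ContDiffAt ℝ ∞ k 0 ∧
      ∀ᶠ t in 𝓝 (0 : E), ∀ ψ : E → ℝ, Continuous ψ → HasCompactSupport ψ →
        (∀ x, ψ x ≠ 0 → F.S.f x ∈ Metric.ball F.p F.R) →
        ∫ x, JJ D (k t) x * ψ x = ∫ x, w (F.S.symm.f (F.S.f x + PT F.ν t)) * ψ x := by
  obtain ⟨Φ, hΦs, hΦo, hΦD, hΦt, hΦ0⟩ := family F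
  set C : Set E := F.S.symm.f '' Metric.closedBall F.p (2 * F.R) with hCdef
  have hC : IsCompact C := (isCompact_closedBall _ _).image F.S.symm.f.continuous
  have hxC : ∀ x, x ∉ C → F.S.f x ∉ Metric.closedBall F.p (2 * F.R) := fun x hx h =>
    hx ⟨_, h, by simp [Dif.symm]⟩
  let a : E → E → (E →L[ℝ] E) := fun t x => aF (Φ t).f x - ContinuousLinearMap.id ℝ E
  have ha : ContDiff ℝ ∞ (fun z : E × E => a z.1 z.2) := (aF_smooth hΦs).sub contDiff_const
  have ha0 : ∀ t x, x ∉ C → a t x = 0 := by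
    intro t x hx
    have : (Φ t).f =ᶠ[𝓝 x] id := by
      filter_upwards [hC.isClosed.isOpen_compl.mem_nhds hx] with y hy using hΦo t y (hxC y hy)
    simp only [a]; rw [aF_id this, sub_self]
  have hac : ∀ t, Continuous (a t) := fun t =>
    ha.continuous.comp (f := fun x => (t, x)) (by fun_prop)
  have hsc : ContDiff ℝ ∞ (fun t => ti (a t)) := sc_contDiff ha hC ha0
  have hm : ∀ t, MemLp (a t) ⊤ volume := fun t => memLp_ti (hac t) hC (ha0 t)
  let ι : KK D →L[ℝ] Lp E 2 (volume : Measure E) := (KK D).subtypeL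
  let M : E → (KK D →L[ℝ] KK D) := fun t =>
    1 + (ContinuousLinearMap.adjoint ι) ∘L (MO (ti (a t)) ∘L ι)
  have hMO0 : ContDiff ℝ ∞ (fun A : Lp (E →L[ℝ] E) ⊤ (volume : Measure E) => MO A) :=
    by fun_prop
  have hMO : ContDiff ℝ ∞ (fun t => MO (ti (a t))) := hMO0.comp hsc
  have hM : ContDiff ℝ ∞ M :=
    contDiff_const.add (contDiff_const.clm_comp (hMO.clm_comp contDiff_const))
  have hM0 : M 0 = 1 := by
    have h1 : a 0 = 0 := by
      ext1 x
      have : (Φ 0).f =ᶠ[𝓝 x] id := Eventually.of_forall hΦ0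
      simp only [a]; rw [aF_id this, sub_self]; rfl
    have h2 : ti (a 0) = 0 := by
      rw [Lp.eq_zero_iff_ae_eq_zero]
      rw [h1]
      exact ti_ae (h1 ▸ hm 0)
    simp only [M, h2, map_zero]
    simp
  set k0 := ContinuousLinearMap.adjoint (JJ D) r with hk0
  have key : ∀ t, M t (TT (Φ t) (hΦD t) k0) = k0 := by
    intro t
    apply KK_ext
    intro φ
    have h1 := TT_form (Φ t) (hΦD t) k0 φ (hm t)
    have h2 : inner ℝ (M t (TT (Φ t) (hΦD t) k0)) (gK D φ)
        = inner ℝ k0 (gK D (cmp (Φ t).symm ((Φ t).symm_iff (hΦD t)) φ)) := by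
      rw [← h1]
      simp only [M, add_apply, ContinuousLinearMap.one_apply, ContinuousLinearMap.comp_apply]
      rw [inner_add_left, inner_add_left, ContinuousLinearMap.adjoint_inner_left]
      rfl
    rw [h2, hk0, adj_g hD, adj_g hD]
    apply integral_congr_ae
    filter_upwards [hr] with x hx
    by_cases hxS : F.S.f x ∈ Metric.closedBall F.p (2 * F.R)
    · simp [hx hxS]
    · have h3 : (Φ t).symm.f x = x := by
        have h4 := hΦo t x hxS
        have h5 : (Φ t).symm.f ((Φ t).f x) = x := by simp [Dif.symm]
        rwa [h4] at h5
      change _ * (φ : E → ℝ) ((Φ t).symm.f x) = _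
      rw [h3]
  have hu : IsUnit (M 0) := by rw [hM0]; exact isUnit_one
  refine ⟨fun t => Ring.inverse (M t) k0, ?_, ?_⟩
  · have h1 : ContDiffAt ℝ ∞ (fun t => Ring.inverse (M t)) 0 := by
      have h2 := contDiffAt_ringInverse ℝ (n := ∞) (R := KK D →L[ℝ] KK D) hu.unit
      rw [hu.unit_spec] at h2
      exact h2.comp (0 : E) hM.contDiffAt
    exact h1.clm_apply contDiffAt_const
  · have ho : IsOpen {x : KK D →L[ℝ] KK D | IsUnit x} := Units.isOpen (R := KK D →L[ℝ] KK D)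
    have ho2 : {x : KK D →L[ℝ] KK D | IsUnit x} ∈ 𝓝 (M 0) := ho.mem_nhds hu
    have hu2 : ∀ᶠ t in 𝓝 (0 : E), IsUnit (M t) := hM.continuous.continuousAt ho2
    filter_upwards [hu2, hΦt] with t ht ht2 ψ hψ hc hs
    have h3 : Ring.inverse (M t) k0 = TT (Φ t) (hΦD t) k0 := by
      conv_lhs => rw [← key t]
      rw [← ContinuousLinearMap.mul_apply, Ring.inverse_mul_cancel _ ht, ContinuousLinearMap.one_apply]
    rw [h3, JJ_TT (Φ t) hD (hΦD t) k0 (u := w) hw hψ hc]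
    congr 1; ext x
    by_cases hx : ψ x = 0
    · simp [hx]
    · rw [ht2 x (hs x hx)]
lemma cdo_fd {u : E → ℝ} {O : Set E} (hO : IsOpen O) (hu : ContDiffOn ℝ ∞ u O) (e : E) :
    ContDiffOn ℝ ∞ (fun x => fderiv ℝ u x e) O :=
  (hu.fderiv_of_isOpen hO (m := ∞) (by simp)).clm_apply contDiffOn_const
lemma glue_cs {ψ u : E → ℝ} {O : Set E} (hO : IsOpen O) (hu : ContDiffOn ℝ ∞ u O) (hψ : ContDiff ℝ ∞ ψ)
    (hc : HasCompactSupport ψ) (hs : tsupport ψ ⊆ O) :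
    ContDiff ℝ ∞ (fun x => u x * ψ x) ∧ HasCompactSupport (fun x => u x * ψ x) := by
  have h := cd_glue hO hψ hs hu
  simp only [smul_eq_mul, mul_comm (ψ _)] at h
  exact ⟨h, hc.mul_left⟩
lemma ibp_loc {ψ u : E → ℝ} {O : Set E} (hO : IsOpen O) (hu : ContDiffOn ℝ ∞ u O) (hψ : ContDiff ℝ ∞ ψ)
    (hc : HasCompactSupport ψ) (hs : tsupport ψ ⊆ O) (e : E) :
    ∫ x, u x * fderiv ℝ ψ x e = - ∫ x, fderiv ℝ u x e * ψ x := by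
  obtain ⟨h1, h2⟩ := glue_cs hO hu hψ hc hs
  have h3 := ibp (φ := fun _ => (1 : ℝ)) contDiff_const (h1.of_le (by simp)) h2 e
  simp only [one_mul, fderiv_fun_const, Pi.zero_apply, zero_apply, zero_mul,
    integral_zero, neg_zero] at h3
  have hsd : tsupport (fun x => fderiv ℝ ψ x e) ⊆ O := (tsupport_fderiv_apply_subset ℝ e).trans hs
  have h4 := glue_cs hO hu (contDiff_fd hψ e) (hc.fderiv_apply (𝕜 := ℝ) e) hsd
  have h5 := glue_cs hO (cdo_fd hO hu e) hψ hc hs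
  have h6 : ∀ x, fderiv ℝ (fun x => u x * ψ x) x e = u x * fderiv ℝ ψ x e + fderiv ℝ u x e * ψ x := by
    intro x
    by_cases hx : x ∈ O
    · have hud := ((hu.contDiffAt (hO.mem_nhds hx)).differentiableAt (by simp))
      rw [fderiv_fun_mul hud (hψ.differentiable (by simp) x)]
      simp [mul_comm]
    · have hx' : x ∉ tsupport ψ := fun h => hx (hs h)
      have e0 : ψ =ᶠ[𝓝 x] 0 := notMem_tsupport_iff_eventuallyEq.1 hx'
      have e1 : (fun x => u x * ψ x) =ᶠ[𝓝 x] fun _ => 0 := by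
        filter_upwards [e0] with y hy; simp [hy]
      rw [e1.fderiv_eq, e0.fderiv_eq, e0.eq_of_nhds]; simp
  simp only [h6] at h3
  rw [integral_add (integ_cs h4.1.continuous h4.2) (integ_cs h5.1.continuous h5.2)] at h3
  linarith
lemma lp_li (w : L2E) : LocallyIntegrable w volume :=
  (Lp.memLp w).locallyIntegrable (by norm_num)
lemma ident [Nontrivial E] {D : Set E} (hD : Bornology.IsBounded D) (k : KK D) {O : Set E} (hO : IsOpen O)
    {u : E → ℝ} (hu : ContDiffOn ℝ ∞ u O)
    (h : ∀ ψ : E → ℝ, ContDiff ℝ ∞ ψ → HasCompactSupport ψ → tsupport ψ ⊆ O →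
      ∫ x, JJ D k x * ψ x = ∫ x, u x * ψ x) :
    (∀ᵐ x, x ∈ O → JJ D k x = u x) ∧
    ∀ e, ∀ᵐ x, x ∈ O → inner ℝ ((k : Lp E 2 volume) x) e = fderiv ℝ u x e := by
  have gen : ∀ (a u : E → ℝ), LocallyIntegrable a volume → ContDiffOn ℝ ∞ u O →
      (∀ ψ : E → ℝ, ContDiff ℝ ∞ ψ → HasCompactSupport ψ → tsupport ψ ⊆ O →
      ∫ x, a x * ψ x = ∫ x, u x * ψ x) → ∀ᵐ x, x ∈ O → a x = u x := by
    intro a u ha hu h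
    have : ∀ᵐ x, x ∈ O → a x - u x = 0 := by
      apply hO.ae_eq_zero_of_integral_contDiff_smul_eq_zero
      · exact (ha.locallyIntegrableOn O).sub (hu.continuousOn.locallyIntegrableOn hO.measurableSet)
      · intro ψ hψ hc hs
        have h1 := glue_cs hO hu hψ hc hs
        have h2 : Integrable (fun x => a x * ψ x) volume := by
          have := ha.integrable_smul_left_of_hasCompactSupport hψ.continuous hc
          simpa [mul_comm] using this
        have h3 := integral_sub h2 (integ_cs h1.1.continuous h1.2)
        rw [h ψ hψ hc hs, sub_self] at h3
        rw [← h3]; congr 1; ext x; simp; ring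
    filter_upwards [this] with x hx hxO using sub_eq_zero.1 (hx hxO)
  refine ⟨gen _ u (lp_li _) hu h, fun e => gen _ _ ?_ (cdo_fd hO hu e) ?_⟩
  · have : MemLp (fun x => inner ℝ ((k : Lp E 2 (volume : Measure E)) x) e) 2 volume :=
      (Lp.memLp (k : Lp E 2 (volume : Measure E))).inner_const e
    exact this.locallyIntegrable (by norm_num)
  · intro ψ hψ hc hs
    have h1 := weak_grad hD k hψ hc e
    rw [h _ (contDiff_fd hψ e) (hc.fderiv_apply (𝕜 := ℝ) e) ((tsupport_fderiv_apply_subset ℝ e).trans hs),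
      ibp_loc hO hu hψ hc hs] at h1
    linarith
def HB (p ν : E) (r : ℝ) : Set E := Metric.ball p r ∩ {y | inner ℝ (y - p) ν < 0}
lemma HB_open (p ν : E) (r : ℝ) : IsOpen (HB p ν r) :=
  Metric.isOpen_ball.inter (isOpen_lt (by fun_prop) continuous_const)
lemma HB_mono (p ν : E) {r s : ℝ} (h : r ≤ s) : HB p ν r ⊆ HB p ν s :=
  inter_subset_inter_left _ (Metric.ball_subset_ball h)
lemma HB_shift {p ν : E} (hν : ‖ν‖ = 1) {r s : ℝ} {y a : E} (hy : y ∈ HB p ν r) (ha : ‖PT ν a‖ < s) :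
    y + PT ν a ∈ HB p ν (r + s) := by
  refine ⟨?_, ?_⟩
  · have := hy.1
    rw [Metric.mem_ball, dist_eq_norm] at this ⊢
    calc _ = ‖(y - p) + PT ν a‖ := by congr 1; abel
      _ ≤ _ := norm_add_le _ _
      _ < _ := by linarith
  · have := hy.2
    rw [mem_setOf_eq] at this ⊢
    rwa [add_sub_right_comm, inner_add_left, PT_inner hν, add_zero]
lemma HB_convex (p ν : E) (r : ℝ) : Convex ℝ (HB p ν r) := by
  refine (convex_ball p r).inter ?_
  have : {y | inner ℝ (y - p) ν < 0} = {y | innerSL ℝ ν y < inner ℝ p ν} := by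
    ext y; simp [inner_sub_left, real_inner_comm]
  rw [this]
  exact convex_halfSpace_lt (innerSL ℝ ν).isLinear _
def Tc {D : Set E} (F : Flat D) (V : E → ℝ) : Prop := ContDiffOn ℝ ∞ V (HB F.p F.ν F.R) ∧
  ∃ k : E → KK D, ContDiffAt ℝ ∞ k 0 ∧ ∀ᶠ t in 𝓝 (0 : E), ∀ ψ : E → ℝ, ContDiff ℝ ∞ ψ →
    HasCompactSupport ψ → tsupport ψ ⊆ F.S.f ⁻¹' (HB F.p F.ν (F.R / 2)) →
    ∫ x, JJ D (k t) x * ψ x = ∫ x, V (F.S.f x + PT F.ν t) * ψ x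
lemma Tc_D {D : Set E} (F : Flat D) {V : E → ℝ} (hV : Tc F V) (a : E) :
    Tc F (fun y => fderiv ℝ V y (PT F.ν a)) := by
  obtain ⟨hs, k, hk, hev⟩ := hV
  have hO := HB_open F.p F.ν F.R
  refine ⟨cdo_fd hO hs _, fun t => fderiv ℝ k t a, ?_, ?_⟩
  · exact (hk.fderiv_right (m := ∞) (by simp)).clm_apply contDiffAt_const
  have hd : ∀ᶠ t in 𝓝 (0 : E), DifferentiableAt ℝ k t := by
    have h1 : ContDiffAt ℝ 1 k 0 := hk.of_le (by simp)
    filter_upwards [h1.eventually (by simp)] with t ht using ht.differentiableAt (by simp)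
  have hsm : ∀ᶠ t in 𝓝 (0 : E), ‖PT F.ν t‖ < F.R / 2 := by
    have : ContinuousAt (fun t => ‖PT F.ν t‖) 0 := by fun_prop
    apply this.eventually_lt_const
    simpa using F.hR
  filter_upwards [hd, hev.eventually_nhds, hsm.eventually_nhds] with t htd htev htsm ψ hψ hc hψs
  have m1 : MemLp ψ 2 volume := memLp_cs hψ.continuous hc
  have hl0 : t + (0 : ℝ) • a = t := by simp
  have hline : Tendsto (fun r : ℝ => t + r • a) (𝓝 0) (𝓝 t) := by
    have : ContinuousAt (fun r : ℝ => t + r • a) 0 := by fun_prop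
    rw [ContinuousAt, hl0] at this; exact this
  have ev1 : ∀ᶠ r in 𝓝 (0 : ℝ), ∫ x, JJ D (k (t + r • a)) x * ψ x
      = ∫ x, V (F.S.f x + PT F.ν (t + r • a)) * ψ x := by
    have := hline.eventually (p := fun s => ∀ ψ : E → ℝ, ContDiff ℝ ∞ ψ →
    HasCompactSupport ψ → tsupport ψ ⊆ F.S.f ⁻¹' (HB F.p F.ν (F.R / 2)) →
    ∫ x, JJ D (k s) x * ψ x = ∫ x, V (F.S.f x + PT F.ν s) * ψ x) htev
    filter_upwards [this] with r hr using hr ψ hψ hc hψs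
  have ev2 : ∀ᶠ r in 𝓝 (0 : ℝ), ‖PT F.ν (t + r • a)‖ < F.R / 2 :=
    hline.eventually (p := fun s => ‖PT F.ν s‖ < F.R / 2) htsm
  obtain ⟨ε, hε, hball⟩ := Metric.eventually_nhds_iff_ball.1 ev2
  have hmem : ∀ r ∈ Metric.ball (0 : ℝ) ε, ∀ x ∈ tsupport ψ,
      F.S.f x + PT F.ν (t + r • a) ∈ HB F.p F.ν F.R := by
    intro r hr x hx
    have := HB_shift F.hν (hψs hx) (hball r hr)
    rwa [add_halves] at this
  have hOr : ∀ r : ℝ, IsOpen {x | F.S.f x + PT F.ν (t + r • a) ∈ HB F.p F.ν F.R} := fun r =>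
    hO.preimage (F.S.f.continuous.add continuous_const)
  have hg : ∀ (W : E → ℝ), ContDiffOn ℝ ∞ W (HB F.p F.ν F.R) → ∀ r ∈ Metric.ball (0 : ℝ) ε,
      ContDiff ℝ ∞ (fun x => W (F.S.f x + PT F.ν (t + r • a)) * ψ x) ∧
      HasCompactSupport (fun x => W (F.S.f x + PT F.ν (t + r • a)) * ψ x) := by
    intro W hW r hr
    refine glue_cs (u := fun x => W (F.S.f x + PT F.ν (t + r • a))) (hOr r) ?_ hψ hc (hmem r hr)
    exact hW.comp (F.S.s.add contDiff_const).contDiffOn (fun x hx => hx)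
  have h0 : (0 : ℝ) ∈ Metric.ball (0 : ℝ) (ε / 2) := Metric.mem_ball_self (by positivity)
  have hsub : Metric.closedBall (0 : ℝ) (ε / 2) ⊆ Metric.ball (0 : ℝ) ε :=
    Metric.closedBall_subset_ball (by linarith)
  have hsub' : Metric.ball (0 : ℝ) (ε / 2) ⊆ Metric.ball (0 : ℝ) ε :=
    Metric.ball_subset_ball (by linarith)
  have hVa := cdo_fd hO hs (PT F.ν a)
  obtain ⟨M, hM⟩ : ∃ M, ∀ r ∈ Metric.closedBall (0 : ℝ) (ε / 2), ∀ x ∈ tsupport ψ,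
      ‖fderiv ℝ V (F.S.f x + PT F.ν (t + r • a)) (PT F.ν a)‖ ≤ M := by
    have hcomp : IsCompact (Metric.closedBall (0 : ℝ) (ε / 2) ×ˢ tsupport ψ) :=
      (isCompact_closedBall _ _).prod hc
    have hcont : ContinuousOn (fun z : ℝ × E => fderiv ℝ V (F.S.f z.2 + PT F.ν (t + z.1 • a)) (PT F.ν a))
        (Metric.closedBall (0 : ℝ) (ε / 2) ×ˢ tsupport ψ) := by
      refine hVa.continuousOn.comp (f := fun z : ℝ × E => F.S.f z.2 + PT F.ν (t + z.1 • a)) ?_ ?_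
      · have := F.S.f.continuous
        fun_prop
      · intro z hz; exact hmem z.1 (hsub hz.1) z.2 hz.2
    obtain ⟨M, hM⟩ := hcomp.exists_bound_of_continuousOn hcont
    exact ⟨M, fun r hr x hx => hM (r, x) ⟨hr, hx⟩⟩
  have hR := hasDerivAt_integral_of_dominated_loc_of_deriv_le (μ := (volume : Measure E)) (𝕜 := ℝ)
    (F := fun r x => V (F.S.f x + PT F.ν (t + r • a)) * ψ x)
    (F' := fun r x => fderiv ℝ V (F.S.f x + PT F.ν (t + r • a)) (PT F.ν a) * ψ x) (x₀ := 0)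
    (s := Metric.ball 0 (ε / 2)) (bound := fun x => M * ‖ψ x‖) (Metric.ball_mem_nhds _ (by positivity)) ?_ ?_ ?_ ?_ ?_ ?_
  rotate_left
  · filter_upwards [Metric.ball_mem_nhds (0 : ℝ) hε] with r hr
    exact (hg V hs r hr).1.continuous.aestronglyMeasurable
  · exact integ_cs (hg V hs 0 (hsub' h0)).1.continuous (hg V hs 0 (hsub' h0)).2
  · exact (hg _ hVa 0 (hsub' h0)).1.continuous.aestronglyMeasurable
  · refine Eventually.of_forall fun x r hr => ?_
    rw [norm_mul]
    by_cases hx : x ∈ tsupport ψ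
    · gcongr; exact hM r (Metric.ball_subset_closedBall hr) x hx
    · simp [image_eq_zero_of_notMem_tsupport hx]
  · exact (integ_cs hψ.continuous hc).norm.const_mul M
  · refine Eventually.of_forall fun x r hr => ?_
    by_cases hx : x ∈ tsupport ψ
    · have hy := hmem r (hsub' hr) x hx
      have h1 := ((hs.contDiffAt (hO.mem_nhds hy)).differentiableAt (by simp)).hasFDerivAt
      have h2 : HasDerivAt (fun r : ℝ => F.S.f x + PT F.ν (t + r • a)) (PT F.ν a) r := by
        have h3 : HasDerivAt (fun r : ℝ => t + r • a) a r := by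
          simpa using ((hasDerivAt_id r).smul_const a).const_add t
        exact ((PT F.ν).hasFDerivAt.comp_hasDerivAt r h3).const_add _
      exact (h1.comp_hasDerivAt r h2).mul_const _
    · simp only [image_eq_zero_of_notMem_tsupport hx, mul_zero]
      exact hasDerivAt_const _ _
  have hL : HasDerivAt (fun r : ℝ => ∫ x, JJ D (k (t + r • a)) x * ψ x)
      (∫ x, JJ D (fderiv ℝ k t a) x * ψ x) 0 := by
    have h3 : HasDerivAt (fun r : ℝ => t + r • a) a 0 := by
      simpa using ((hasDerivAt_id (0 : ℝ)).smul_const a).const_add t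
    have h4 : HasDerivAt (fun r : ℝ => k (t + r • a)) (fderiv ℝ k t a) 0 := by
      have h5 : HasFDerivAt k (fderiv ℝ k t) (t + (0 : ℝ) • a) := by rw [hl0]; exact htd.hasFDerivAt
      exact h5.comp_hasDerivAt (0 : ℝ) h3
    have h6 : HasDerivAt (fun r : ℝ => (innerSL ℝ (tl ψ)) (JJ D (k (t + r • a))))
        ((innerSL ℝ (tl ψ)) (JJ D (fderiv ℝ k t a))) 0 :=
      (innerSL ℝ (tl ψ)).hasFDerivAt.comp_hasDerivAt (0 : ℝ) ((JJ D).hasFDerivAt.comp_hasDerivAt (0 : ℝ) h4)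
    simp only [innerSL_apply_apply, real_inner_comm _ (tl ψ)] at h6
    simpa only [inner_tlR _ m1] using h6
  have := hL.unique (hR.2.congr_of_eventuallyEq ev1)
  rw [this]
  simp
lemma cov_memLp (S : Dif E) {N : Set E} (hN : IsOpen N) {g : E → ℝ} (hg : ContinuousOn g N)
    (h : MemLp (fun x => g (S.f x)) 2 (volume.restrict (S.f ⁻¹' N))) : MemLp g 2 (volume.restrict N) := by
  have hO : IsOpen (S.f ⁻¹' N) := hN.preimage S.f.continuous
  rw [memLp_two_iff_integrable_sq (hg.aestronglyMeasurable hN.measurableSet)]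
  have h1 := h.integrable_sq
  have h2 := integrableOn_image_iff_integrableOn_abs_det_fderiv_smul (volume : Measure E) hO.measurableSet
    (fun x _ => (S.hfd x).hasFDerivWithinAt) S.f.injective.injOn (fun y => g y ^ 2)
  rw [image_preimage_eq _ S.f.surjective] at h2
  apply h2.2
  obtain ⟨M, hM0, hM⟩ := S.bound_det
  have hcd : Continuous fun x => |(fderiv ℝ S.f x).det| :=
    (ContinuousLinearMap.continuous_det.comp S.fd_cont).abs
  simp only [smul_eq_mul]
  refine Integrable.bdd_mul (c := M) h1 hcd.aestronglyMeasurable (Eventually.of_forall fun x => ?_)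
  simpa using hM x
lemma Tc_L2 [Nontrivial E] {D : Set E} (hD : Bornology.IsBounded D) (F : Flat D) {V : E → ℝ} (hV : Tc F V) :
    MemLp V 2 (volume.restrict (HB F.p F.ν (F.R / 2))) ∧
    ∀ e, MemLp (fun y => fderiv ℝ V y e) 2 (volume.restrict (HB F.p F.ν (F.R / 2))) := by
  obtain ⟨hs, k, hk, hev⟩ := hV
  have h0 := hev.self_of_nhds
  simp only [map_zero, add_zero] at h0
  set N := HB F.p F.ν (F.R / 2) with hN
  have hNo : IsOpen N := HB_open _ _ _
  have hNR : N ⊆ HB F.p F.ν F.R := HB_mono _ _ (by linarith [F.hR])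
  have hVN : ContDiffOn ℝ ∞ V N := hs.mono hNR
  have hO : IsOpen (F.S.f ⁻¹' N) := hNo.preimage F.S.f.continuous
  have hu : ContDiffOn ℝ ∞ (fun x => V (F.S.f x)) (F.S.f ⁻¹' N) :=
    hVN.comp F.S.s.contDiffOn (fun x hx => hx)
  obtain ⟨i1, i2⟩ := ident hD (k 0) hO hu h0
  refine ⟨cov_memLp F.S hNo hVN.continuousOn ?_, fun e => cov_memLp F.S hNo (cdo_fd hNo hVN e).continuousOn ?_⟩
  · refine ((Lp.memLp (JJ D (k 0))).restrict (F.S.f ⁻¹' N)).ae_eq ?_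
    rw [EventuallyEq, ae_restrict_iff' hO.measurableSet]
    exact i1
  · let b := stdOrthonormalBasis ℝ E
    obtain ⟨M, hM0, hM⟩ := F.S.symm.bound
    have hk := (Lp.memLp ((k 0 : KK D) : Lp E 2 (volume : Measure E))).restrict (F.S.f ⁻¹' N)
    refine hk.of_le_mul (c := M * ‖e‖) ?_ ?_
    · refine ContinuousOn.aestronglyMeasurable ?_ hO.measurableSet
      exact (cdo_fd hNo hVN e).continuousOn.comp F.S.f.continuous.continuousOn (fun x hx => hx)
    rw [ae_restrict_iff' hO.measurableSet]
    have i3 : ∀ᵐ x, ∀ i, x ∈ F.S.f ⁻¹' N → inner ℝ (((k 0 : KK D) : Lp E 2 (volume : Measure E)) x) (b i)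
        = fderiv ℝ (fun x => V (F.S.f x)) x (b i) := ae_all_iff.2 fun i => i2 (b i)
    filter_upwards [i3] with x hx hxN
    have h1 : ∀ v, inner ℝ (((k 0 : KK D) : Lp E 2 (volume : Measure E)) x) v
        = fderiv ℝ (fun x => V (F.S.f x)) x v := by
      intro v
      rw [← b.sum_repr v, inner_sum, map_sum]
      refine Finset.sum_congr rfl fun i _ => ?_
      rw [real_inner_smul_right, map_smul, hx i hxN, smul_eq_mul]
    have hVd := ((hVN.contDiffAt (hNo.mem_nhds hxN)).differentiableAt (by simp)).hasFDerivAt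
    have h2 : fderiv ℝ (fun x => V (F.S.f x)) x = fderiv ℝ V (F.S.f x) ∘L fderiv ℝ F.S.f x :=
      (hVd.comp x (F.S.hfd x)).fderiv
    have h3 := h1 (fderiv ℝ F.S.symm.f (F.S.f x) e)
    have h4 : fderiv ℝ F.S.f x (fderiv ℝ F.S.symm.f (F.S.f x) e) = e :=
      congrArg (fun A => A e) (F.S.fd_comp' x)
    rw [h2, ContinuousLinearMap.comp_apply, h4] at h3
    rw [← h3]
    refine (norm_inner_le_norm _ _).trans ?_
    rw [mul_comm]
    gcongr
    exact (ContinuousLinearMap.le_opNorm _ _).trans (by gcongr; exact hM _)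
section
def dd (a : E) (g : E → ℝ) : E → ℝ := fun y => fderiv ℝ g y a
def DL : List E → (E → ℝ) → (E → ℝ)
  | [], g => g
  | a :: l, g => DL l (dd a g)
section
variable {N : Set E} (hN : IsOpen N)
lemma dd_smooth (hN : IsOpen N) {g : E → ℝ} (hg : ContDiffOn ℝ ∞ g N) (a : E) : ContDiffOn ℝ ∞ (dd a g) N :=
  cdo_fd hN hg a
lemma dd_congr (hN : IsOpen N) {g h : E → ℝ} (hgh : EqOn g h N) (a : E) : EqOn (dd a g) (dd a h) N := by
  intro y hy
  have : g =ᶠ[𝓝 y] h := hgh.eventuallyEq_of_mem (hN.mem_nhds hy)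
  simp only [dd, this.fderiv_eq]
lemma dfa (hN : IsOpen N) {g : E → ℝ} (hg : ContDiffOn ℝ ∞ g N) {y : E} (hy : y ∈ N) :
    DifferentiableAt ℝ g y := (hg.contDiffAt (hN.mem_nhds hy)).differentiableAt (by simp)
lemma dd_add (hN : IsOpen N) {g h : E → ℝ} (hg : ContDiffOn ℝ ∞ g N) (hh : ContDiffOn ℝ ∞ h N) (a : E) :
    EqOn (dd a (g + h)) (dd a g + dd a h) N := by
  intro y hy
  simp only [dd, Pi.add_apply]
  rw [fderiv_add (dfa hN hg hy) (dfa hN hh hy)]; rfl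
lemma dd_mul (hN : IsOpen N) {c g : E → ℝ} (hc : ContDiffOn ℝ ∞ c N) (hg : ContDiffOn ℝ ∞ g N) (a : E) :
    EqOn (dd a (c * g)) (dd a c * g + c * dd a g) N := by
  intro y hy
  simp only [dd, Pi.add_apply, Pi.mul_apply]
  rw [fderiv_mul (dfa hN hc hy) (dfa hN hg hy)]; simp; ring
lemma dd_eq (hN : IsOpen N) {g : E → ℝ} (hg : ContDiffOn ℝ ∞ g N) (a b : E) {y : E} (hy : y ∈ N) :
    dd a (dd b g) y = fderiv ℝ (fderiv ℝ g) y a b := by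
  have h1 : DifferentiableAt ℝ (fderiv ℝ g) y :=
    ((hg.fderiv_of_isOpen hN (m := ∞) (by simp)).contDiffAt (hN.mem_nhds hy)).differentiableAt (by simp)
  change fderiv ℝ (fun y => fderiv ℝ g y b) y a = _
  rw [fderiv_clm_apply h1 (differentiableAt_const b)]
  simp
lemma dd_comm (hN : IsOpen N) {g : E → ℝ} (hg : ContDiffOn ℝ ∞ g N) (a b : E) :
    EqOn (dd a (dd b g)) (dd b (dd a g)) N := by
  intro y hy
  rw [dd_eq hN hg a b hy, dd_eq hN hg b a hy]
  have : IsSymmSndFDerivAt ℝ g y :=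
    (hg.contDiffAt (hN.mem_nhds hy)).isSymmSndFDerivAt (by simpa using WithTop.coe_le_coe.2 (le_top : (2 : ℕ∞) ≤ ⊤))
  exact this a b
lemma DL_smooth (hN : IsOpen N) (l : List E) : ∀ {g : E → ℝ}, ContDiffOn ℝ ∞ g N → ContDiffOn ℝ ∞ (DL l g) N := by
  induction l with
  | nil => exact fun h => h
  | cons a l ih => exact fun h => ih (dd_smooth hN h a)
lemma DL_congr (hN : IsOpen N) (l : List E) : ∀ {g h : E → ℝ}, EqOn g h N → EqOn (DL l g) (DL l h) N := by
  induction l with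
  | nil => exact fun h => h
  | cons a l ih => exact fun h => ih (dd_congr hN h a)
lemma DL_add (hN : IsOpen N) (l : List E) : ∀ {g h : E → ℝ}, ContDiffOn ℝ ∞ g N → ContDiffOn ℝ ∞ h N →
    EqOn (DL l (g + h)) (DL l g + DL l h) N := by
  induction l with
  | nil => exact fun _ _ _ _ => rfl
  | cons a l ih => exact fun hg hh =>
      (DL_congr hN l (dd_add hN hg hh a)).trans (ih (dd_smooth hN hg a) (dd_smooth hN hh a))
lemma DL_dd_comm (hN : IsOpen N) (l : List E) (b : E) : ∀ {g : E → ℝ}, ContDiffOn ℝ ∞ g N →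
    EqOn (DL l (dd b g)) (dd b (DL l g)) N := by
  induction l with
  | nil => exact fun _ _ _ => rfl
  | cons a l ih => exact fun hg =>
      (DL_congr hN l (dd_comm hN hg a b)).trans (ih (dd_smooth hN hg a))
lemma l2_congr (hN : IsOpen N) {g h : E → ℝ} (hgh : EqOn g h N) (hg : MemLp g 2 (volume.restrict N)) :
    MemLp h 2 (volume.restrict N) := by
  refine hg.ae_eq ?_
  rw [EventuallyEq, ae_restrict_iff' hN.measurableSet]
  exact Eventually.of_forall hgh
def QA (N : Set E) (A : Set E) (g : E → ℝ) : Prop := ContDiffOn ℝ ∞ g N ∧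
  ∀ l : List E, (∀ a ∈ l, a ∈ A) → MemLp (DL l g) 2 (volume.restrict N)
lemma QA_congr (hN : IsOpen N) {A : Set E} {g h : E → ℝ} (hgh : EqOn g h N) (hg : QA N A g) : QA N A h :=
  ⟨hg.1.congr fun x hx => (hgh hx).symm, fun l hl => l2_congr hN (DL_congr hN l hgh) (hg.2 l hl)⟩
lemma QA_add (hN : IsOpen N) {A : Set E} {g h : E → ℝ} (hg : QA N A g) (hh : QA N A h) : QA N A (g + h) :=
  ⟨hg.1.add hh.1, fun l hl => l2_congr hN (DL_add hN l hg.1 hh.1).symm ((hg.2 l hl).add (hh.2 l hl))⟩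
lemma QA_dd (hN : IsOpen N) {A : Set E} {g : E → ℝ} (hg : QA N A g) {a : E} (ha : a ∈ A) : QA N A (dd a g) :=
  ⟨dd_smooth hN hg.1 a, fun l hl => hg.2 (a :: l) (by simpa using ⟨ha, hl⟩)⟩
lemma QA_mul (hN : IsOpen N) (hb : Bornology.IsBounded N) {A : Set E} {c g : E → ℝ} (hc : ContDiff ℝ ∞ c)
    (hg : QA N A g) : QA N A (c * g) := by
  refine ⟨hc.contDiffOn.mul hg.1, fun l => ?_⟩
  induction l generalizing c g with
  | nil =>
    intro _
    obtain ⟨M, hM⟩ := hb.isCompact_closure.exists_bound_of_continuousOn hc.continuous.continuousOn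
    have h1 := hg.2 [] (by simp)
    refine h1.of_le_mul (c := M) ?_ ?_
    · exact (hc.continuous.continuousOn.mul hg.1.continuousOn).aestronglyMeasurable hN.measurableSet
    · rw [ae_restrict_iff' hN.measurableSet]
      refine Eventually.of_forall fun x hx => ?_
      change ‖c x * g x‖ ≤ M * ‖g x‖
      rw [norm_mul]
      gcongr; exact hM x (subset_closure hx)
  | cons a l ih =>
    intro hl
    have ha : a ∈ A := hl a (by simp)
    have hl' : ∀ b ∈ l, b ∈ A := fun b hb => hl b (by simp [hb])
    have hga := QA_dd hN hg ha
    have hca : ContDiff ℝ ∞ (dd a c) := contDiff_fd hc a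
    have h1 := ih hca hg hl'
    have h2 := ih hc hga hl'
    refine l2_congr hN ?_ (h1.add h2)
    exact (DL_add hN l (hca.contDiffOn.mul hg.1) (hc.contDiffOn.mul hga.1)).symm.trans
      (DL_congr hN l (dd_mul hN hc.contDiffOn hg.1 a).symm)
def QJ (N : Set E) (ν : E) : ℕ → (E → ℝ) → Prop
  | 0, g => QA N (range (PT ν)) g
  | j + 1, g => QJ N ν j g ∧ QJ N ν j (dd ν g)
variable {ν : E}
lemma QJ_zero : ∀ {j : ℕ} {g : E → ℝ}, QJ N ν j g → QA N (range (PT ν)) g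
  | 0, g, h => h
  | j + 1, g, h => QJ_zero h.1
lemma QJ_congr (hN : IsOpen N) : ∀ {j : ℕ} {g h : E → ℝ}, EqOn g h N → QJ N ν j g → QJ N ν j h
  | 0, _, _, e, h => QA_congr hN e h
  | j + 1, _, _, e, h => ⟨QJ_congr hN e h.1, QJ_congr hN (dd_congr hN e ν) h.2⟩
lemma QJ_add (hN : IsOpen N) : ∀ {j : ℕ} {g h : E → ℝ}, QJ N ν j g → QJ N ν j h → QJ N ν j (g + h)
  | 0, _, _, a, b => QA_add hN a b
  | j + 1, _, _, a, b => ⟨QJ_add hN a.1 b.1, QJ_congr hN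
      (dd_add hN (QJ_zero a.1).1 (QJ_zero b.1).1 ν).symm (QJ_add hN a.2 b.2)⟩
lemma QJ_mul (hN : IsOpen N) (hb : Bornology.IsBounded N) : ∀ {j : ℕ} {c g : E → ℝ}, ContDiff ℝ ∞ c →
    QJ N ν j g → QJ N ν j (c * g)
  | 0, _, _, hc, h => QA_mul hN hb hc h
  | j + 1, c, _, hc, h => ⟨QJ_mul hN hb hc h.1, QJ_congr hN
      (dd_mul hN hc.contDiffOn (QJ_zero h.1).1 ν).symm
      (QJ_add hN (QJ_mul hN hb (c := dd ν c) (contDiff_fd hc ν) h.1) (QJ_mul hN hb hc h.2))⟩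
lemma QJ_dd (hN : IsOpen N) {a : E} (ha : a ∈ range (PT ν)) : ∀ {j : ℕ} {g : E → ℝ}, QJ N ν j g → QJ N ν j (dd a g)
  | 0, _, h => QA_dd hN h ha
  | j + 1, _, h => ⟨QJ_dd hN ha h.1, QJ_congr hN (dd_comm hN (QJ_zero h.1).1 a ν) (QJ_dd hN ha h.2)⟩
lemma QJ_fzero (hN : IsOpen N) (hb : Bornology.IsBounded N) {j : ℕ} {g : E → ℝ} (h : QJ N ν j g) :
    QJ N ν j (0 : E → ℝ) := by
  have := QJ_mul hN hb (c := fun _ => (0 : ℝ)) contDiff_const h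
  refine QJ_congr hN (fun x _ => ?_) this
  simp
lemma QJ_sum (hN : IsOpen N) (hb : Bornology.IsBounded N) {ι : Type} (s : Finset ι) {j : ℕ} {g0 : E → ℝ}
    (h0 : QJ N ν j g0) {g : ι → E → ℝ} (h : ∀ i, QJ N ν j (g i)) : QJ N ν j (∑ i ∈ s, g i) := by
  classical
  induction s using Finset.induction_on with
  | empty => simpa using QJ_fzero hN hb h0
  | insert a s ha ih => rw [Finset.sum_insert ha]; exact QJ_add hN (h a) ih
lemma PT_add (ν a : E) : a = PT ν a + inner ℝ ν a • ν := by rw [PT_apply]; abel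
lemma all_L2 (hN : IsOpen N) (hb : Bornology.IsBounded N) (hν : ‖ν‖ = 1) {v : E → ℝ}
    (h1 : QJ N ν 1 v) {ι : Type} [Fintype ι] {w : ι → E → E} {z : E → E} (hw : ∀ k, ContDiff ℝ ∞ (w k))
    (hz : ContDiff ℝ ∞ z) (hc0 : ∀ y, ∑ k, inner ℝ ν (w k y) ^ 2 ≠ 0)
    (heq : ∀ y ∈ N, ∑ k, fderiv ℝ (fderiv ℝ v) y (w k y) (w k y) + fderiv ℝ v y (z y) = 0) :
    QA N univ v := by
  have hv : ContDiffOn ℝ ∞ v N := (QJ_zero h1).1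
  let b := stdOrthonormalBasis ℝ E
  let m := Module.finrank ℝ E
  let c0 : E → ℝ := fun y => (∑ k, inner ℝ ν (w k y) ^ 2)⁻¹
  have hc0s : ContDiff ℝ ∞ c0 := by
    refine ContDiff.inv ?_ hc0
    exact ContDiff.sum fun k _ => (contDiff_const.inner ℝ (hw k)).pow 2
  let β : ι → Fin m → E → ℝ := fun k i y => inner ℝ (b i) (w k y)
  let γ : ι → E → ℝ := fun k y => inner ℝ ν (w k y)
  have hβ : ∀ k i, ContDiff ℝ ∞ (β k i) := fun k i => contDiff_const.inner ℝ (hw k)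
  have hγ : ∀ k, ContDiff ℝ ∞ (γ k) := fun k => contDiff_const.inner ℝ (hw k)
  have hexp : ∀ a : E, a = ∑ i, inner ℝ (b i) a • PT ν (b i) + inner ℝ ν a • ν := by
    intro a
    conv_lhs => rw [PT_add ν a]
    congr 1
    conv_lhs => rw [← b.sum_repr a]
    simp [map_sum, OrthonormalBasis.repr_apply_apply]
  let G : E → ℝ := (fun y => -c0 y) * (
      (∑ k, ((∑ i, ∑ j, (β k i * β k j) * dd (PT ν (b i)) (dd (PT ν (b j)) v))
        + (∑ i, (fun y => 2 * (β k i y * γ k y)) * dd (PT ν (b i)) (dd ν v))))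
      + ((∑ i, (fun y => inner ℝ (b i) (z y)) * dd (PT ν (b i)) v) + (fun y => inner ℝ ν (z y)) * dd ν v))
  have hG : EqOn G (dd ν (dd ν v)) N := by
    intro y hy
    have e1 : ∀ k, fderiv ℝ (fderiv ℝ v) y (w k y) (w k y) =
        (∑ i, ∑ j, (β k i y * β k j y) * dd (PT ν (b i)) (dd (PT ν (b j)) v) y)
        + (∑ i, (2 * (β k i y * γ k y)) * dd (PT ν (b i)) (dd ν v) y) + γ k y ^ 2 * dd ν (dd ν v) y := by
      intro k
      have hsym : IsSymmSndFDerivAt ℝ v y :=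
        (hv.contDiffAt (hN.mem_nhds hy)).isSymmSndFDerivAt (by simpa using WithTop.coe_le_coe.2 (le_top : (2 : ℕ∞) ≤ ⊤))
      simp only [dd_eq hN hv _ _ hy]
      set B := fderiv ℝ (fderiv ℝ v) y with hB
      have hs : ∀ a c, B a c = B c a := fun a c => hsym a c
      set T := ∑ i, inner ℝ (b i) (w k y) • PT ν (b i) with hT
      have hwk : w k y = T + inner ℝ ν (w k y) • ν := hexp (w k y)
      have f1 : B (w k y) (w k y) = B T T + 2 * (γ k y * B T ν) + γ k y ^ 2 * B ν ν := by
        conv_lhs => rw [hwk]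
        simp only [map_add, add_apply, map_smul, smul_apply, smul_eq_mul, hs ν T]
        simp only [γ]; ring
      have f2 : ∀ c, B T c = ∑ i, β k i y * B (PT ν (b i)) c := by
        intro c; rw [hT]; simp [map_sum, β]; rfl
      have f3 : B T T = ∑ i, ∑ j, (β k i y * β k j y) * B (PT ν (b i)) (PT ν (b j)) := by
        rw [f2]
        refine Finset.sum_congr rfl fun i _ => ?_
        conv_lhs => rw [hT]
        simp only [map_sum, map_smul, smul_eq_mul, Finset.mul_sum]
        refine Finset.sum_congr rfl fun j _ => ?_
        simp only [β]; ring
      rw [f1, f3, f2, Finset.mul_sum, Finset.mul_sum]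
      congr 2
      refine Finset.sum_congr rfl fun i _ => ?_
      ring
    have e2 : fderiv ℝ v y (z y) = (∑ i, inner ℝ (b i) (z y) * dd (PT ν (b i)) v y)
        + inner ℝ ν (z y) * dd ν v y := by
      conv_lhs => rw [hexp (z y)]
      simp [map_sum, dd]
    have e3 := heq y hy
    simp only [e1] at e3
    rw [Finset.sum_add_distrib, ← Finset.sum_mul, e2] at e3
    have e4 : c0 y * (∑ k, γ k y ^ 2) = 1 := inv_mul_cancel₀ (hc0 y)
    simp only [G, Pi.mul_apply, Pi.add_apply, Finset.sum_apply]
    linear_combination (-c0 y) * e3 + (dd ν (dd ν v) y) * e4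
  have step : ∀ j, QJ N ν (j + 1) v := by
    intro j
    induction j with
    | zero => exact h1
    | succ j ih =>
      refine ⟨ih, ih.2, ?_⟩
      refine QJ_congr hN hG ?_
      have hT : ∀ i, PT ν (b i) ∈ range (PT ν) := fun i => ⟨_, rfl⟩
      refine QJ_mul hN hb hc0s.neg (QJ_add hN ?_ (QJ_add hN ?_ ?_))
      · refine QJ_sum hN hb _ ih.1 fun k => QJ_add hN ?_ ?_
        · refine QJ_sum hN hb _ ih.1 fun i => QJ_sum hN hb _ ih.1 fun j => ?_
          exact QJ_mul hN hb ((hβ k i).mul (hβ k j)) (QJ_dd hN (hT i) (QJ_dd hN (hT j) ih.1))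
        · refine QJ_sum hN hb _ ih.1 fun i => ?_
          exact QJ_mul hN hb (contDiff_const.mul ((hβ k i).mul (hγ k))) (QJ_dd hN (hT i) ih.2)
      · refine QJ_sum hN hb _ ih.1 fun i => ?_
        exact QJ_mul hN hb (contDiff_const.inner ℝ hz) (QJ_dd hN (hT i) ih.1)
      · exact QJ_mul hN hb (contDiff_const.inner ℝ hz) ih.2
  refine ⟨hv, fun l _ => ?_⟩
  have fin : ∀ (l : List E) (g : E → ℝ), (∀ j, QJ N ν j g) → MemLp (DL l g) 2 (volume.restrict N) := by
    intro l
    induction l with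
    | nil => exact fun g hg => (hg 0).2 [] (by simp)
    | cons a l ih =>
      intro g hg
      refine ih _ fun j => ?_
      have := QJ_add hN (QJ_dd hN (a := PT ν a) ⟨_, rfl⟩ (hg j))
        (QJ_mul hN hb (c := fun _ => inner ℝ ν a) contDiff_const (hg (j + 1)).2)
      refine QJ_congr hN (fun y _ => ?_) this
      simp only [Pi.add_apply, Pi.mul_apply, dd]
      conv_rhs => rw [PT_add ν a]
      simp
  exact fin l v fun j => (step j).1
end
end
lemma kernel [Nontrivial E] : ∃ ζ η : E → ℝ, ContDiff ℝ ∞ ζ ∧ ContDiff ℝ ∞ η ∧ (∀ z, 1 ≤ ‖z‖ → ζ z = 0) ∧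
    (∀ z, 1 ≤ ‖z‖ → η z = 0) ∧ ∫ z, η z = 1 ∧
    ∀ z, Δ ζ z = Module.finrank ℝ E * η z + fderiv ℝ η z z := by
  have hgs : ContDiff ℝ ∞ expNegInvGlue := expNegInvGlue.contDiff
  have hds : ContDiff ℝ ∞ (deriv expNegInvGlue) := ((contDiff_infty_iff_deriv).1 hgs).2
  let ζ : E → ℝ := fun z => expNegInvGlue (1 - ‖z‖ ^ 2)
  let η : E → ℝ := fun z => -2 * deriv expNegInvGlue (1 - ‖z‖ ^ 2)
  have hq : ContDiff ℝ ∞ fun z : E => 1 - ‖z‖ ^ 2 := contDiff_const.sub (contDiff_norm_sq ℝ)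
  have hζ : ContDiff ℝ ∞ ζ := hgs.comp hq
  have hη : ContDiff ℝ ∞ η := contDiff_const.mul (hds.comp hq)
  have hd0 : ∀ t ≤ 0, deriv expNegInvGlue t = 0 := by
    have h1 : ∀ t < 0, deriv expNegInvGlue t = 0 := by
      intro t ht
      have : expNegInvGlue =ᶠ[𝓝 t] fun _ => 0 := by
        filter_upwards [Iio_mem_nhds ht] with s hs using expNegInvGlue.zero_of_nonpos (le_of_lt hs)
      rw [this.deriv_eq]; simp
    intro t ht
    have h2 : IsClosed {t | deriv expNegInvGlue t = 0} := isClosed_eq hds.continuous continuous_const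
    have h3 : closure (Iio (0:ℝ)) ⊆ {t | deriv expNegInvGlue t = 0} := closure_minimal h1 h2
    rw [closure_Iio] at h3
    exact h3 ht
  have hz0 : ∀ z : E, 1 ≤ ‖z‖ → 1 - ‖z‖ ^ 2 ≤ 0 := fun z hz => by nlinarith
  have z1 : ∀ z, 1 ≤ ‖z‖ → ζ z = 0 := fun z hz => expNegInvGlue.zero_of_nonpos (hz0 z hz)
  have z2 : ∀ z, 1 ≤ ‖z‖ → η z = 0 := fun z hz => by simp [η, hd0 _ (hz0 z hz)]
  have hf : ∀ z e, fderiv ℝ ζ z e = η z * inner ℝ z e := by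
    intro z e
    have h1 : HasFDerivAt ζ _ z := HasDerivAt.comp_hasFDerivAt (h₂ := expNegInvGlue) (f := fun z : E => 1 - ‖z‖ ^ 2) z
      ((hgs.differentiable (by simp)) (1 - ‖z‖ ^ 2)).hasDerivAt ((hasStrictFDerivAt_norm_sq z).hasFDerivAt.const_sub 1)
    rw [h1.fderiv]
    simp [η]; ring
  have hne : ∀ z, η z ≤ 0 := fun z => by
    have := expNegInvGlue.monotone.deriv_nonneg (x := 1 - ‖z‖ ^ 2)
    simp only [η]; linarith
  have hcs : HasCompactSupport η := HasCompactSupport.intro (isCompact_closedBall (0:E) 1) fun z hz => z2 z (by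
    simp at hz; exact hz.le)
  have hI : ∫ z, η z ≠ 0 := by
    intro h0
    have h1 : ∫ z, -η z = 0 := by rw [integral_neg, h0, neg_zero]
    have h2 : ∀ z, η z = 0 := by
      intro z
      by_contra hz
      have := Continuous.integral_pos_of_hasCompactSupport_nonneg_nonzero (μ := volume) (f := fun z => -η z) (x := z)
        hη.continuous.neg (hcs.comp_left (g := fun t => -t) (by simp)) (fun z => by simpa using hne z) (by simpa using hz)
      linarith
    have h3 : ∀ z, fderiv ℝ ζ z = 0 := fun z => by
      ext e; rw [hf]
      simp [h2 z]
    obtain ⟨x, hx⟩ := NormedSpace.exists_lt_norm ℝ E 1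
    have h4 := is_const_of_fderiv_eq_zero (hζ.differentiable (by simp)) h3 0 x
    rw [z1 x hx.le] at h4
    have : 0 < ζ 0 := expNegInvGlue.pos_of_pos (by simp)
    linarith
  have hl : ∀ z, Δ ζ z = Module.finrank ℝ E * η z + fderiv ℝ η z z := by
    intro z
    rw [lap_eq hζ (stdOrthonormalBasis ℝ E)]
    simp only [hf]
    have : ∀ i, fderiv ℝ (fun y => η y * inner ℝ y (stdOrthonormalBasis ℝ E i)) z (stdOrthonormalBasis ℝ E i) =
      η z + inner ℝ (stdOrthonormalBasis ℝ E i) z * fderiv ℝ η z (stdOrthonormalBasis ℝ E i) := by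
      intro i
      have h5 : HasFDerivAt (fun y => inner ℝ y (stdOrthonormalBasis ℝ E i)) (innerSL ℝ (stdOrthonormalBasis ℝ E i)) z := by
        simp_rw [fun y => real_inner_comm (stdOrthonormalBasis ℝ E i) y]
        exact (innerSL ℝ (stdOrthonormalBasis ℝ E i)).hasFDerivAt
      rw [((hη.differentiable (by simp) z).hasFDerivAt.fun_mul h5).fderiv]
      simp [real_inner_comm]
    simp only [this, Finset.sum_add_distrib]
    congr 1
    · simp
    · conv_rhs => arg 2; rw [← (stdOrthonormalBasis ℝ E).sum_repr z]
      simp [map_sum, OrthonormalBasis.repr_apply_apply]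
  set I := ∫ z, η z with hIdef
  refine ⟨fun z => I⁻¹ * ζ z, fun z => I⁻¹ * η z, contDiff_const.mul hζ, contDiff_const.mul hη,
    fun z hz => by simp [z1 z hz], fun z hz => by simp [z2 z hz], ?_, fun z => ?_⟩
  · rw [integral_const_mul]; exact inv_mul_cancel₀ hI
  · have e1 : Δ (fun z => I⁻¹ * ζ z) z = I⁻¹ * Δ ζ z := by
      have := laplacian_smul (f := ζ) (x := z) I⁻¹ (contDiff_infty.1 hζ 2).contDiffAt
      exact this
    have e2 : fderiv ℝ (fun z => I⁻¹ * η z) z z = I⁻¹ * fderiv ℝ η z z := by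
      rw [fderiv_const_mul (hη.differentiable (by simp) z)]; simp
    rw [e1, e2, hl]; ring
lemma lap_scale {ζ : E → ℝ} (hζ : ContDiff ℝ ∞ ζ) (s : ℝ) (x y : E) :
    Δ (fun y => ζ (s • (x - y))) y = s ^ 2 * Δ ζ (s • (x - y)) := by
  have hs : ContDiff ℝ ∞ fun y => ζ (s • (x - y)) := hζ.comp (by fun_prop)
  have key : ∀ (g : E → ℝ), ContDiff ℝ ∞ g → ∀ y e, fderiv ℝ (fun y => g (s • (x - y))) y e =
      -s * fderiv ℝ g (s • (x - y)) e := by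
    intro g hg y e
    have h1 : HasFDerivAt (fun y => g (s • (x - y))) _ y :=
      ((hg.differentiable (by simp)) (s • (x - y))).hasFDerivAt.comp y
        (((hasFDerivAt_id y).const_sub x).const_smul s)
    rw [h1.fderiv]; simp
  rw [lap_eq hs (stdOrthonormalBasis ℝ E), lap_eq hζ (stdOrthonormalBasis ℝ E), Finset.mul_sum]
  refine Finset.sum_congr rfl fun i _ => ?_
  simp only [key ζ hζ]
  have h2 := contDiff_fd hζ (stdOrthonormalBasis ℝ E i)
  have h3 : ContDiff ℝ ∞ fun y => fderiv ℝ ζ (s • (x - y)) (stdOrthonormalBasis ℝ E i) :=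
    h2.comp (f := fun y => s • (x - y)) (by fun_prop)
  have h4 := key _ h2 y (stdOrthonormalBasis ℝ E i)
  rw [fderiv_const_mul (h3.differentiable (by simp) y), smul_apply, h4, smul_eq_mul]
  ring
lemma ibp_lap_loc {ψ u : E → ℝ} {O : Set E} (hO : IsOpen O) (hu : ContDiffOn ℝ ∞ u O) (hψ : ψ ∈ TF O) :
    ∫ x, u x * Δ ψ x = ∫ x, Δ u x * ψ x := by
  have hs : ∀ e, tsupport (fun x => fderiv ℝ ψ x e) ⊆ O := fun e => (tsupport_fderiv_apply_subset ℝ e).trans hψ.2.2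
  have hc : ∀ e, HasCompactSupport (fun x => fderiv ℝ ψ x e) := fun e => hψ.2.1.fderiv_apply (𝕜 := ℝ) e
  let b := stdOrthonormalBasis ℝ E
  have e1 : ∀ x, Δ u x * ψ x = ∑ i, fderiv ℝ (fun y => fderiv ℝ u y (b i)) x (b i) * ψ x := by
    intro x
    by_cases hx : x ∈ O
    · rw [lap_at (contDiffAt_infty.1 (hu.contDiffAt (hO.mem_nhds hx)) 2) b, Finset.sum_mul]
    · rw [image_eq_zero_of_notMem_tsupport (fun h => hx (hψ.2.2 h))]; simp
  simp only [e1]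
  rw [lap_eq hψ.1 b]
  simp only [Finset.mul_sum]
  rw [integral_finsetSum, integral_finsetSum]
  · refine Finset.sum_congr rfl fun i _ => ?_
    rw [ibp_loc hO hu (contDiff_fd hψ.1 (b i)) (hc _) (hs _), ibp_loc hO (cdo_fd hO hu (b i)) hψ.1 hψ.2.1 hψ.2.2, neg_neg]
  · intro i _
    have h1 := glue_cs hO (cdo_fd hO (cdo_fd hO hu (b i)) (b i)) hψ.1 hψ.2.1 hψ.2.2
    exact integ_cs h1.1.continuous h1.2
  · intro i _
    have h1 := glue_cs hO hu (contDiff_fd (contDiff_fd hψ.1 (b i)) (b i)) ((hc (b i)).fderiv_apply (𝕜 := ℝ) (b i))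
      ((tsupport_fderiv_apply_subset ℝ (b i)).trans (hs (b i)))
    exact integ_cs h1.1.continuous h1.2
lemma weyl [Nontrivial E] {W : Set E} (hW : IsOpen W) {w : E → ℝ} (hw : LocallyIntegrable w volume)
    (h : ∀ ψ ∈ TF W, ∫ x, w x * Δ ψ x = 0) :
    ∃ u : E → ℝ, ContDiffOn ℝ ∞ u W ∧ (∀ x ∈ W, Δ u x = 0) ∧ ∀ᵐ x, x ∈ W → w x = u x := by
  obtain ⟨ζ, η, hζ, hη, z1, z2, hI, hl⟩ := kernel (E := E)
  set n := Module.finrank ℝ E with hn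
  have hn0 : n ≠ 0 := Module.finrank_pos.ne'
  obtain ⟨m, hm⟩ := Nat.exists_eq_succ_of_ne_zero hn0
  let F : E → ℝ → ℝ := fun x s => ∫ y, w y * (s ^ n * η (s • (x - y)))
  have hcη : HasCompactSupport η := HasCompactSupport.intro (isCompact_closedBall (0:E) 1) fun z hz => z2 z (by
    simp at hz; exact hz.le)
  have zl : ∀ z, 1 < ‖z‖ → Δ ζ z = 0 := by
    intro z hz
    have : z ∉ tsupport (Δ ζ) := fun hh => by
      have h1 := tsupport_lap ζ hh
      have h2 : tsupport ζ ⊆ Metric.closedBall 0 1 := by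
        apply closure_minimal _ Metric.isClosed_closedBall
        intro y hy
        by_contra h3
        simp at h3
        exact hy (z1 y h3.le)
      have := h2 h1
      simp at this; linarith
    exact image_eq_zero_of_notMem_tsupport this
  obtain ⟨M, hM⟩ : ∃ M, ∀ z, ‖Δ ζ z‖ ≤ M := by
    have hcl : HasCompactSupport (Δ ζ) := HasCompactSupport.intro (isCompact_closedBall (0:E) 1) fun z hz => zl z (by
      simpa using hz)
    obtain ⟨M, hM⟩ := hcl.exists_bound_of_continuous (contDiff_lap hζ).continuous
    exact ⟨M, hM⟩
  have hsm : ∀ s > 0, ContDiff ℝ ∞ fun x => F x s := by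
    intro s hs
    have hg : ContDiff ℝ ∞ fun z : E => s ^ n * η (s • z) := contDiff_const.mul (hη.comp (by fun_prop))
    have hgc : HasCompactSupport fun z : E => s ^ n * η (s • z) := by
      refine HasCompactSupport.intro (isCompact_closedBall (0:E) s⁻¹) fun z hz => ?_
      rw [z2 _, mul_zero]
      simp at hz
      rw [norm_smul, Real.norm_of_nonneg hs.le]
      rw [inv_lt_iff_one_lt_mul₀' hs] at hz
      exact hz.le
    exact hgc.contDiff_convolution_right (ContinuousLinearMap.mul ℝ ℝ) hw (hg.of_le (by simp))
  have hconst : ∀ x r, 0 < r → Metric.ball x r ⊆ W → ∀ s > r⁻¹, ∀ s' > r⁻¹, F x s = F x s' := by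
    intro x r hr hb
    have hd : ∀ s > r⁻¹, HasDerivAt (F x) 0 s := by
      intro s hs
      have hs0 : 0 < s := lt_trans (by positivity) hs
      have hK : IsCompact (Metric.closedBall x (2 / s)) := isCompact_closedBall _ _
      have main := hasDerivAt_integral_of_dominated_loc_of_deriv_le (μ := volume) (𝕜 := ℝ)
        (F := fun s y => w y * (s ^ n * η (s • (x - y))))
        (F' := fun s y => w y * (s ^ m * Δ ζ (s • (x - y)))) (x₀ := s) (s := Ioo (s / 2) (2 * s))
        (bound := (Metric.closedBall x (2 / s)).indicator fun y => ‖w y‖ * ((2 * s) ^ m * M))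
        (Ioo_mem_nhds (by linarith) (by linarith)) ?_ ?_ ?_ ?_ ?_ ?_
      · have h0 : ∫ y, w y * (s ^ m * Δ ζ (s • (x - y))) = 0 := by
          have hψ : (fun y => ζ (s • (x - y))) ∈ TF W := by
            have hc : Function.support (fun y => ζ (s • (x - y))) ⊆ Metric.closedBall x s⁻¹ := by
              intro y hy
              by_contra h3
              apply hy
              apply z1
              simp [dist_eq_norm] at h3
              rw [norm_smul, Real.norm_of_nonneg hs0.le, norm_sub_rev]
              rw [inv_lt_iff_one_lt_mul₀' hs0] at h3
              exact h3.le
            have hc2 := closure_minimal hc Metric.isClosed_closedBall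
            refine ⟨hζ.comp (by fun_prop), (isCompact_closedBall _ _).of_isClosed_subset (isClosed_tsupport _) hc2,
              hc2.trans (subset_trans (Metric.closedBall_subset_ball ?_) hb)⟩
            exact inv_lt_of_inv_lt₀ hr hs
          have h1 := h _ hψ
          simp only [lap_scale hζ] at h1
          have h2 : ∀ y, w y * (s ^ m * Δ ζ (s • (x - y))) = (s ^ m / s ^ 2) * (w y * (s ^ 2 * Δ ζ (s • (x - y)))) := by
            intro y; field_simp
          simp only [h2, integral_const_mul, h1, mul_zero]
        have := main.2
        rw [h0] at this
        exact this
      · refine Eventually.of_forall fun s => ?_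
        exact hw.aestronglyMeasurable.mul (Continuous.aestronglyMeasurable (by have := hη.continuous; fun_prop))
      · have hg : Continuous fun y : E => s ^ n * η (s • (x - y)) := by have := hη.continuous; fun_prop
        have := hw.integrable_smul_left_of_hasCompactSupport hg ?_
        · simpa [mul_comm] using this
        · refine HasCompactSupport.intro (isCompact_closedBall x s⁻¹) fun z hz => ?_
          rw [z2 _, mul_zero]
          simp [dist_eq_norm] at hz
          rw [norm_smul, Real.norm_of_nonneg hs0.le, norm_sub_rev]
          rw [inv_lt_iff_one_lt_mul₀' hs0] at hz
          exact hz.le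
      · have := (contDiff_lap hζ).continuous
        exact hw.aestronglyMeasurable.mul (Continuous.aestronglyMeasurable (by fun_prop))
      · refine Eventually.of_forall fun y t ht => ?_
        have ht0 : 0 < t := by linarith [ht.1]
        by_cases hy : y ∈ Metric.closedBall x (2 / s)
        · rw [indicator_of_mem hy, norm_mul, norm_mul, norm_pow, Real.norm_of_nonneg ht0.le]
          have := hM (t • (x - y))
          have h2 := ht.2.le
          gcongr
        · rw [indicator_of_notMem hy, zl, mul_zero, mul_zero, norm_zero]
          simp [dist_eq_norm] at hy
          rw [norm_smul, Real.norm_of_nonneg ht0.le, norm_sub_rev]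
          rw [div_lt_iff₀ hs0] at hy
          nlinarith [ht.1, norm_nonneg (y - x)]
      · rw [integrable_indicator_iff hK.measurableSet]
        exact ((hw.integrableOn_isCompact hK).norm.mul_const _)
      · refine Eventually.of_forall fun y t ht => ?_
        refine HasDerivAt.const_mul (w y) ?_
        have h1 : HasDerivAt (fun t : ℝ => t • (x - y)) (x - y) t := by
          simpa using (hasDerivAt_id t).smul_const (x - y)
        have h2 : HasDerivAt (fun t : ℝ => η (t • (x - y))) _ t :=
          ((hη.differentiable (by simp)) (t • (x - y))).hasFDerivAt.comp_hasDerivAt t h1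
        refine ((hasDerivAt_pow n t).mul h2).congr_deriv ?_
        rw [hl, hm]
        simp only [map_smul, smul_eq_mul]
        push_cast
        simp only [Nat.succ_sub_one, pow_succ]
        ring
    intro s hs s' hs'
    exact isOpen_Ioi.is_const_of_deriv_eq_zero isPreconnected_Ioi
      (fun t ht => (hd t ht).differentiableAt.differentiableWithinAt) (fun t ht => (hd t ht).deriv) hs hs'
  let u : E → ℝ := fun x => limUnder atTop (F x)
  have hu : ∀ x r, 0 < r → Metric.ball x r ⊆ W → ∀ s > r⁻¹, u x = F x s := by
    intro x r hr hb s hs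
    refine Tendsto.limUnder_eq (tendsto_const_nhds.congr' ?_)
    filter_upwards [Ioi_mem_atTop r⁻¹] with t ht using hconst x r hr hb s hs t ht
  have hus : ContDiffOn ℝ ∞ u W := by
    intro x hx
    obtain ⟨r, hr, hb⟩ := Metric.isOpen_iff.1 hW x hx
    have : u =ᶠ[𝓝 x] fun y => F y (r / 2 / 2)⁻¹ := by
      filter_upwards [Metric.ball_mem_nhds x (half_pos hr)] with y hy
      refine hu y (r / 2) (by positivity) (subset_trans ?_ hb) _ ?_
      · refine Metric.ball_subset_ball' ?_
        have := Metric.mem_ball.1 hy; linarith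
      · exact (inv_lt_inv₀ (by positivity) (by positivity)).2 (by linarith)
    exact ((hsm _ (by positivity)).contDiffAt.congr_of_eventuallyEq this).contDiffWithinAt
  have hae : ∀ᵐ x, x ∈ W → w x = u x := by
    filter_upwards [IsUnifLocDoublingMeasure.ae_tendsto_average_norm_sub volume hw 1] with x hx hxW
    obtain ⟨r, hr, hb⟩ := Metric.isOpen_iff.1 hW x hxW
    obtain ⟨B, hB⟩ := hcη.exists_bound_of_continuous hη.continuous
    have hlim := hx (ι := ℝ) (l := atTop) (fun _ => x) (fun s => s⁻¹)
      (tendsto_inv_atTop_nhdsGT_zero) (by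
        filter_upwards [Ioi_mem_atTop (0:ℝ)] with s hs
        have : 0 < s := hs
        simp; positivity)
    set V := (volume (Metric.ball (0:E) 1)).toReal with hV
    have hlim2 := hlim.const_mul (B * V)
    rw [mul_zero] at hlim2
    have hle : ∀ᶠ s in atTop, ‖u x - w x‖ ≤ B * V * ⨍ y in Metric.closedBall x s⁻¹, ‖w y - w x‖ := by
      filter_upwards [Ioi_mem_atTop r⁻¹] with s hs
      have hs0 : 0 < s := lt_trans (by positivity) hs
      rw [hu x r hr hb s hs]
      have hg : Continuous fun y : E => s ^ n * η (s • (x - y)) := by have := hη.continuous; fun_prop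
      have hz : ∀ y, y ∉ Metric.closedBall x s⁻¹ → η (s • (x - y)) = 0 := by
        intro z hz
        apply z2
        simp [dist_eq_norm] at hz
        rw [norm_smul, Real.norm_of_nonneg hs0.le, norm_sub_rev]
        rw [inv_lt_iff_one_lt_mul₀' hs0] at hz
        exact hz.le
      have hgc : HasCompactSupport fun y : E => s ^ n * η (s • (x - y)) :=
        HasCompactSupport.intro (isCompact_closedBall x s⁻¹) fun z h => by rw [hz z h, mul_zero]
      have i1 : Integrable (fun y => w y * (s ^ n * η (s • (x - y)))) volume := by
        simpa [mul_comm] using hw.integrable_smul_left_of_hasCompactSupport hg hgc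
      have i2 : Integrable (fun y => s ^ n * η (s • (x - y))) volume := integ_cs hg hgc
      have i3 : ∫ y, s ^ n * η (s • (x - y)) = 1 := by
        rw [integral_sub_left_eq_self (fun z => s ^ n * η (s • z)) volume x, integral_const_mul,
          Measure.integral_comp_smul_of_nonneg volume (hR := hs0.le), hI]
        simp only [smul_eq_mul, mul_one]
        exact mul_inv_cancel₀ (by positivity)
      have i4 : F x s - w x = ∫ y, (w y - w x) * (s ^ n * η (s • (x - y))) := by
        simp only [sub_mul]
        rw [integral_sub i1 (i2.const_mul _), integral_const_mul, i3, mul_one]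
      have i5 : ∀ y, (w y - w x) * (s ^ n * η (s • (x - y))) = (Metric.closedBall x s⁻¹).indicator
          (fun y => (w y - w x) * (s ^ n * η (s • (x - y)))) y := by
        intro y
        by_cases hy : y ∈ Metric.closedBall x s⁻¹
        · rw [indicator_of_mem hy]
        · rw [indicator_of_notMem hy, hz y hy]; ring
      have hmeas := (Metric.isClosed_closedBall (x := x) (ε := s⁻¹)).measurableSet
      rw [i4, integral_congr_ae (Eventually.of_forall i5), integral_indicator hmeas]
      have hint : IntegrableOn (fun y => ‖w y - w x‖) (Metric.closedBall x s⁻¹) volume :=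
        ((hw.integrableOn_isCompact (isCompact_closedBall _ _)).sub
          (continuousOn_const.integrableOn_compact (isCompact_closedBall _ _))).norm
      calc _ ≤ ∫ y in Metric.closedBall x s⁻¹, (s ^ n * B) * ‖w y - w x‖ := by
            refine norm_integral_le_of_norm_le (hint.const_mul _) (Eventually.of_forall fun y => ?_)
            rw [norm_mul, norm_mul, norm_pow, Real.norm_of_nonneg hs0.le, mul_comm]
            have := hB (s • (x - y))
            gcongr
        _ = _ := by
            rw [integral_const_mul, setAverage_eq, measureReal_def, Measure.addHaar_closedBall _ _ (by positivity),
              ENNReal.toReal_mul, ENNReal.toReal_ofReal (by positivity), ← hV, smul_eq_mul]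
            have hV0 : V ≠ 0 := (ENNReal.toReal_pos (Metric.measure_ball_pos volume _ one_pos).ne'
              (measure_ball_lt_top).ne).ne'
            rw [← hn, inv_pow]
            generalize ∫ (a : E) in Metric.closedBall x s⁻¹, ‖w a - w x‖ = I0
            field_simp
    have := ge_of_tendsto hlim2 hle
    have h0 : u x - w x = 0 := by simpa using this
    linarith
  refine ⟨u, hus, ?_, hae⟩
  have hlapc : ContinuousOn (Δ u) W := by
    have : ContinuousOn (fun x => ∑ i, fderiv ℝ (fun y => fderiv ℝ u y (stdOrthonormalBasis ℝ E i)) x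
        (stdOrthonormalBasis ℝ E i)) W :=
      continuousOn_finset_sum _ fun i _ => (cdo_fd hW (cdo_fd hW hus _) _).continuousOn
    exact this.congr fun x hx => lap_at (contDiffAt_infty.1 (hus.contDiffAt (hW.mem_nhds hx)) 2) _
  have hz : ∀ᵐ x, x ∈ W → Δ u x = 0 := by
    apply hW.ae_eq_zero_of_integral_contDiff_smul_eq_zero (hlapc.locallyIntegrableOn hW.measurableSet)
    intro ψ hψ hc hs
    have hT : ψ ∈ TF W := ⟨hψ, hc, hs⟩
    simp only [smul_eq_mul, mul_comm (ψ _)]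
    rw [← ibp_lap_loc hW hus hT, ← h ψ hT]
    refine integral_congr_ae ?_
    filter_upwards [hae] with x hx
    by_cases hxW : x ∈ W
    · simp only [hx hxW]
    · have : Δ ψ x = 0 := image_eq_zero_of_notMem_tsupport fun hh => hxW (hs (tsupport_lap ψ hh))
      simp only [this, mul_zero]
  have := Measure.eqOn_open_of_ae_eq (μ := volume) (f := Δ u) (g := fun _ => 0)
    ((ae_restrict_iff' hW.measurableSet).2 hz) hW hlapc continuousOn_const
  exact fun x hx => this hx
lemma Tc_DL {D : Set E} (F : Flat D) (l : List E) : (∀ a ∈ l, a ∈ range (PT F.ν)) →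
    ∀ {V : E → ℝ}, Tc F V → Tc F (DL l V) := by
  induction l with
  | nil => exact fun _ _ h => h
  | cons a l ih =>
    intro hl V hV
    obtain ⟨b, rfl⟩ := hl a (by simp)
    exact ih (fun c hc => hl c (by simp [hc])) (Tc_D F hV b)
lemma bdry_L2 [Nontrivial E] {D : Set E} (hD : Bornology.IsBounded D) (F : Flat D)
    (r : L2E)
    (hr : ∀ᵐ x, F.S.f x ∈ Metric.closedBall F.p (2 * F.R) → r x = 0) {w : E → ℝ}
    (hw : GG D r =ᵐ[volume] w) {W : Set E} (hW : IsOpen W) (hWs : ContDiffOn ℝ ∞ w W) (hWl : ∀ x ∈ W, Δ w x = 0)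
    (hFW : ∀ y ∈ HB F.p F.ν F.R, F.S.symm.f y ∈ W) :
    QA (HB F.p F.ν (F.R / 2)) univ (fun y => w (F.S.symm.f y)) := by
  set v : E → ℝ := fun y => w (F.S.symm.f y) with hv
  set N := HB F.p F.ν (F.R / 2) with hN
  have hNo : IsOpen N := HB_open _ _ _
  have hNR : N ⊆ HB F.p F.ν F.R := HB_mono _ _ (by linarith [F.hR])
  have hvs : ContDiffOn ℝ ∞ v (HB F.p F.ν F.R) := hWs.comp F.S.symm.s.contDiffOn hFW
  have hvN := hvs.mono hNR
  have hTc : Tc F v := by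
    obtain ⟨k, hk, hev⟩ := smooth_dep hD F r hr hw
    refine ⟨hvs, k, hk, ?_⟩
    filter_upwards [hev] with t ht ψ hψ hc hs
    exact ht ψ hψ.continuous hc fun x hx =>
      Metric.ball_subset_ball (by linarith [F.hR]) (hs (subset_tsupport _ hx)).1
  have hss : ∀ x, F.S.symm.f (F.S.f x) = x := fun x => by simp [Dif.symm]
  have hss' : ∀ x, F.S.f (F.S.symm.f x) = x := fun x => by simp [Dif.symm]
  let b := stdOrthonormalBasis ℝ E
  have hfS : ∀ e, ContDiff ℝ ∞ fun x => fderiv ℝ F.S.f x e := fun e =>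
    (F.S.s.fderiv_right (m := ∞) (by simp)).clm_apply contDiff_const
  have hfS2 : ∀ e, ContDiff ℝ ∞ fun x => fderiv ℝ (fun x => fderiv ℝ F.S.f x e) x e := fun e =>
    ((hfS e).fderiv_right (m := ∞) (by simp)).clm_apply contDiff_const
  refine all_L2 hNo (Metric.isBounded_ball.subset inter_subset_left) F.hν (ι := Fin (Module.finrank ℝ E)) ?_
    (w := fun k y => fderiv ℝ F.S.f (F.S.symm.f y) (b k))
    (z := fun y => ∑ k, fderiv ℝ (fun x => fderiv ℝ F.S.f x (b k)) (F.S.symm.f y) (b k)) ?_ ?_ ?_ ?_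
  · refine ⟨⟨hvN, fun l hl => (Tc_L2 hD F (Tc_DL F l hl hTc)).1⟩, dd_smooth hNo hvN _, fun l hl => ?_⟩
    exact l2_congr hNo (DL_dd_comm hNo l F.ν hvN).symm ((Tc_L2 hD F (Tc_DL F l hl hTc)).2 F.ν)
  · exact fun k => (hfS (b k)).comp F.S.symm.s
  · exact ContDiff.sum fun k _ => (hfS2 (b k)).comp F.S.symm.s
  · intro y h0
    have h1 : ∀ k, inner ℝ F.ν (fderiv ℝ F.S.f (F.S.symm.f y) (b k)) = 0 := by
      intro k
      have := (Finset.sum_eq_zero_iff_of_nonneg (fun i _ => sq_nonneg _)).1 h0 k (Finset.mem_univ k)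
      exact pow_eq_zero_iff (two_ne_zero) |>.1 this
    have h2 : ∀ a, inner ℝ F.ν (fderiv ℝ F.S.f (F.S.symm.f y) a) = 0 := by
      intro a
      rw [← b.sum_repr a, map_sum, inner_sum]
      refine Finset.sum_eq_zero fun i _ => ?_
      rw [map_smul, real_inner_smul_right, h1, mul_zero]
    have h3 := congrArg (fun L => L F.ν) (F.S.fd_comp' (F.S.symm.f y))
    simp only [ContinuousLinearMap.comp_apply, ContinuousLinearMap.id_apply] at h3
    have h4 := h2 (fderiv ℝ F.S.symm.f (F.S.f (F.S.symm.f y)) F.ν)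
    rw [h3, real_inner_self_eq_norm_sq, F.hν] at h4
    norm_num at h4
  · intro y hy
    set x := F.S.symm.f y with hx
    have hSx : F.S.f x = y := hss' y
    have hxW : x ∈ W := hFW y (hNR hy)
    have hlap := hWl x hxW
    rw [lap_at (contDiffAt_infty.1 (hWs.contDiffAt (hW.mem_nhds hxW)) 2) b] at hlap
    have hO : IsOpen (F.S.f ⁻¹' N) := hNo.preimage F.S.f.continuous
    have hxO : x ∈ F.S.f ⁻¹' N := by rw [mem_preimage, hSx]; exact hy
    have hwv : w = fun x => v (F.S.f x) := by ext x; simp only [hv, hss]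
    have hvd : ContDiffOn ℝ ∞ (fderiv ℝ v) N := hvN.fderiv_of_isOpen hNo (m := ∞) (by simp)
    have h1 : ∀ e, (fun x => fderiv ℝ w x e) =ᶠ[𝓝 x] fun x => fderiv ℝ v (F.S.f x) (fderiv ℝ F.S.f x e) := by
      intro e
      filter_upwards [hO.mem_nhds hxO] with x' hx'
      have : HasFDerivAt w ((fderiv ℝ v (F.S.f x')).comp (fderiv ℝ F.S.f x')) x' := by
        rw [hwv]
        exact (dfa hNo hvN hx').hasFDerivAt.comp x' (F.S.hfd x')
      rw [this.fderiv]; rfl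
    have h2 : ∀ e, fderiv ℝ (fun x => fderiv ℝ w x e) x e = fderiv ℝ (fderiv ℝ v) y (fderiv ℝ F.S.f x e) (fderiv ℝ F.S.f x e)
        + fderiv ℝ v y (fderiv ℝ (fun x => fderiv ℝ F.S.f x e) x e) := by
      intro e
      rw [(h1 e).fderiv_eq]
      have d1 : HasFDerivAt (fderiv ℝ v) (fderiv ℝ (fderiv ℝ v) y) (F.S.f x) := by
        rw [hSx]
        exact ((hvd.contDiffAt (hNo.mem_nhds hy)).differentiableAt (by simp)).hasFDerivAt
      have d2 := d1.comp x (F.S.hfd x)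
      have d3 := ((hfS e).differentiable (by simp) x).hasFDerivAt
      have d4 : HasFDerivAt (fun x => fderiv ℝ v (F.S.f x) (fderiv ℝ F.S.f x e)) _ x := d2.clm_apply d3
      rw [d4.fderiv]
      simp [hSx, add_comm]
    simp only [h2, Finset.sum_add_distrib] at hlap
    rw [map_sum]
    exact hlap
section
open scoped ContDiff ENNReal
def HH : ℕ → (E → ℝ) → (E → ℝ)
  | 0, g => fun x => |g x|
  | j + 1, g => fun x => ∑ i, HH j (dd (stdOrthonormalBasis ℝ E i) g) x
lemma DL_smul {N : Set E} (hN : IsOpen N) (l : List E) : ∀ {g : E → ℝ}, ContDiffOn ℝ ∞ g N → ∀ c : ℝ,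
    EqOn (DL l (c • g)) (c • DL l g) N := by
  induction l with
  | nil => exact fun _ _ _ _ => rfl
  | cons a l ih =>
    intro g hg c
    have h1 : EqOn (dd a (c • g)) (c • dd a g) N := by
      intro y hy
      simp only [dd, Pi.smul_apply]
      rw [fderiv_const_smul (dfa hN hg hy)]; rfl
    exact (DL_congr hN l h1).trans (ih (dd_smooth hN hg a) c)
lemma DL_sum {N : Set E} (hN : IsOpen N) (l : List E) {ι : Type} (s : Finset ι) {g : ι → E → ℝ}
    (hg : ∀ i, ContDiffOn ℝ ∞ (g i) N) (c : ι → ℝ) :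
    EqOn (DL l (∑ i ∈ s, c i • g i)) (∑ i ∈ s, c i • DL l (g i)) N := by
  classical
  induction s using Finset.induction_on with
  | empty =>
    simp only [Finset.sum_empty]
    have := DL_smul hN l (g := fun _ => 0) contDiffOn_const 0
    intro y hy
    have h2 := this hy
    have h3 : (0 : ℝ) • (fun _ : E => (0 : ℝ)) = 0 := by ext; simp
    rw [h3] at h2
    rw [h2]; simp
  | insert a s ha ih =>
    rw [Finset.sum_insert ha, Finset.sum_insert ha]
    have hs : ContDiffOn ℝ ∞ (∑ i ∈ s, c i • g i) N := by
      have : (∑ i ∈ s, c i • g i) = fun x => ∑ i ∈ s, c i • g i x := by ext; simp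
      rw [this]
      exact ContDiffOn.sum fun i _ => (hg i).const_smul (c i)
    refine (DL_add hN l ((hg a).const_smul (c a)) hs).trans fun y hy => ?_
    exact congrArg₂ (· + ·) (DL_smul hN l (hg a) (c a) hy) (ih hy)
lemma DL_le_HH {N : Set E} (hN : IsOpen N) {z : E} (hz : ‖z‖ ≤ 1) (j : ℕ) : ∀ {g : E → ℝ}, ContDiffOn ℝ ∞ g N →
    ∀ x ∈ N, |DL (List.replicate j z) g x| ≤ HH j g x := by
  induction j with
  | zero => exact fun _ x _ => le_refl _
  | succ j ih =>
    intro g hg x hx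
    let b := stdOrthonormalBasis ℝ E
    have h1 : dd z g = ∑ i, inner ℝ (b i) z • dd (b i) g := by
      ext y
      simp only [dd, Finset.sum_apply, Pi.smul_apply]
      conv_lhs => rw [← b.sum_repr z]
      simp [map_sum, OrthonormalBasis.repr_apply_apply]
    rw [List.replicate_succ]
    change |DL (List.replicate j z) (dd z g) x| ≤ ∑ i, HH j (dd (b i) g) x
    rw [h1, DL_sum hN _ _ (fun i => dd_smooth hN hg (b i)) _ hx, Finset.sum_apply]
    refine (Finset.abs_sum_le_sum_abs _ _).trans (Finset.sum_le_sum fun i _ => ?_)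
    rw [Pi.smul_apply, smul_eq_mul, abs_mul]
    have h2 : |inner ℝ (b i) z| ≤ 1 := (abs_real_inner_le_norm _ _).trans (by rw [b.norm_eq_one]; linarith)
    have h3 := ih (dd_smooth hN hg (b i)) x hx
    calc _ ≤ 1 * |DL (List.replicate j z) (dd (b i) g) x| := by gcongr
      _ ≤ _ := by rw [one_mul]; exact h3
lemma HH_nn (j : ℕ) : ∀ (g : E → ℝ) x, 0 ≤ HH j g x := by
  induction j with
  | zero => exact fun _ _ => abs_nonneg _
  | succ j ih => exact fun g x => Finset.sum_nonneg fun i _ => ih _ x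
lemma HH_cont {N : Set E} (hN : IsOpen N) (j : ℕ) : ∀ {g : E → ℝ}, ContDiffOn ℝ ∞ g N → ContinuousOn (HH j g) N := by
  induction j with
  | zero => exact fun h => h.continuousOn.abs
  | succ j ih => exact fun h => continuousOn_finset_sum _ fun i _ => ih (dd_smooth hN h _)
lemma HH_int {N : Set E} (hN : IsOpen N) (hb : Bornology.IsBounded N) (j : ℕ) : ∀ {g : E → ℝ}, QA N univ g →
    IntegrableOn (HH j g) N volume := by
  have : IsFiniteMeasure (volume.restrict N) := ⟨by rw [Measure.restrict_apply_univ]; exact hb.measure_lt_top⟩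
  induction j with
  | zero => exact fun h => ((h.2 [] (by simp)).integrable (by norm_num)).abs
  | succ j ih => exact fun h => integrable_finsetSum _ fun i _ => ih (QA_dd hN h (mem_univ _))
lemma lint_le {N : Set E} (hN : IsOpen N) {H : E → ℝ} (hn : ∀ x, 0 ≤ H x) (hc : ContinuousOn H N)
    (hi : IntegrableOn H N volume) : ∃ K : E → ℝ≥0∞, Measurable K ∧ (∀ x ∈ N, ENNReal.ofReal (H x) ≤ K x) ∧
    ∫⁻ x, K x ≠ ⊤ := by
  classical
  refine ⟨fun x => ENNReal.ofReal (N.piecewise H (fun _ => 0) x), ?_, fun x hx => ?_, ?_⟩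
  · exact ENNReal.measurable_ofReal.comp (hc.measurable_piecewise continuousOn_const hN.measurableSet)
  · simp [hx]
  · have h1 : Integrable (N.indicator H) volume := (integrable_indicator_iff hN.measurableSet).2 hi
    have := h1.lintegral_lt_top
    rw [← Set.piecewise_eq_indicator] at this
    exact this.ne
lemma taylor0 {N : Set E} (hN : IsOpen N) {g : E → ℝ} (hg : ContDiffOn ℝ ∞ g N) {y z : E} (hz : ‖z‖ ≤ 1)
    (hyz : ∀ s ∈ Icc (0:ℝ) 1, y + s • z ∈ N) (m : ℕ) :
    ENNReal.ofReal |g y| ≤ ∑ j ∈ Finset.range (m + 1), ENNReal.ofReal (HH j g (y + z)) +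
      ∫⁻ s in Ioc (0:ℝ) 1, ENNReal.ofReal (s ^ m) * ENNReal.ofReal (HH (m + 1) g (y + s • z)) := by
  let h : ℕ → ℝ → ℝ := fun j s => DL (List.replicate j z) g (y + s • z)
  have hh : ∀ j, ∀ s ∈ Icc (0:ℝ) 1, HasDerivAt (h j) (h (j + 1) s) s := by
    intro j s hs
    have hsm := DL_smooth hN (List.replicate j z) hg
    have h1 : HasDerivAt (fun s : ℝ => y + s • z) z s := by
      simpa using ((hasDerivAt_id s).smul_const z).const_add y
    have h2 := (dfa hN hsm (hyz s hs)).hasFDerivAt.comp_hasDerivAt s h1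
    refine h2.congr_deriv ?_
    exact ((DL_dd_comm hN (List.replicate j z) z hg) (hyz s hs)).symm
  let Φ : ℕ → ℝ → ℝ := fun m s => ∑ j ∈ Finset.range (m + 1), ((-s) ^ j / j.factorial) * h j s
  have hΦ : ∀ m, ∀ s ∈ Icc (0:ℝ) 1, HasDerivAt (Φ m) ((-s) ^ m / m.factorial * h (m + 1) s) s := by
    intro m s hs
    induction m with
    | zero => simpa [Φ] using hh 0 s hs
    | succ m ih =>
      have e : Φ (m + 1) = fun s => Φ m s + ((-s) ^ (m + 1) / (m + 1).factorial) * h (m + 1) s := by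
        ext s; simp only [Φ]; rw [Finset.sum_range_succ]
      rw [e]
      have h1 : HasDerivAt (fun s : ℝ => (-s) ^ (m + 1) / ((m + 1).factorial : ℝ)) (-((-s) ^ m / m.factorial)) s := by
        have := (((hasDerivAt_id s).neg).pow (m + 1)).div_const ((m + 1).factorial : ℝ)
        refine this.congr_deriv ?_
        rw [Nat.factorial_succ]; push_cast
        simp; field_simp
      refine (ih.add (h1.mul (hh (m + 1) s hs))).congr_deriv ?_
      ring
  have hcont : ContinuousOn (fun s : ℝ => (-s) ^ m / m.factorial * h (m + 1) s) (Icc 0 1) := by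
    refine ContinuousOn.mul (by fun_prop) fun s hs => (hh (m + 1) s hs).continuousAt.continuousWithinAt
  have hFTC := intervalIntegral.integral_eq_sub_of_hasDerivAt (f := Φ m) (a := 0) (b := 1)
    (fun s hs => hΦ m s (by rwa [uIcc_of_le zero_le_one] at hs))
    (ContinuousOn.intervalIntegrable (by rwa [uIcc_of_le zero_le_one]))
  have e0 : Φ m 0 = g y := by
    simp only [Φ]
    rw [Finset.sum_range_succ']
    simp [h, DL]
  have e1 : g y = Φ m 1 - ∫ s in (0:ℝ)..1, (-s) ^ m / m.factorial * h (m + 1) s := by rw [hFTC, e0]; ring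
  have b1 : |Φ m 1| ≤ ∑ j ∈ Finset.range (m + 1), HH j g (y + z) := by
    refine (Finset.abs_sum_le_sum_abs _ _).trans (Finset.sum_le_sum fun j _ => ?_)
    rw [abs_mul, abs_div, abs_pow, abs_neg, abs_one, one_pow, Nat.abs_cast]
    have h2 := DL_le_HH hN hz j hg (y + (1:ℝ) • z) (hyz 1 (by simp))
    have h3 : 1 / (j.factorial : ℝ) ≤ 1 := by
      rw [div_le_one (by positivity)]; exact_mod_cast Nat.one_le_iff_ne_zero.2 (Nat.factorial_ne_zero j)
    calc _ ≤ 1 * |h j 1| := by gcongr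
      _ ≤ _ := by rw [one_mul]; simpa [h] using h2
  have b2 : ENNReal.ofReal |∫ s in (0:ℝ)..1, (-s) ^ m / m.factorial * h (m + 1) s| ≤
      ∫⁻ s in Ioc (0:ℝ) 1, ENNReal.ofReal (s ^ m) * ENNReal.ofReal (HH (m + 1) g (y + s • z)) := by
    rw [intervalIntegral.integral_of_le zero_le_one, ← Real.norm_eq_abs, ofReal_norm_eq_enorm]
    refine (enorm_integral_le_lintegral_enorm _).trans ?_
    refine setLIntegral_mono' measurableSet_Ioc fun s hs => ?_
    rw [← ofReal_norm_eq_enorm, ← ENNReal.ofReal_mul (pow_nonneg hs.1.le m)]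
    apply ENNReal.ofReal_le_ofReal
    rw [norm_mul, Real.norm_eq_abs, Real.norm_eq_abs, abs_div, abs_pow, abs_neg, abs_of_pos hs.1, Nat.abs_cast]
    have h2 := DL_le_HH hN hz (m + 1) hg (y + s • z) (hyz s ⟨hs.1.le, hs.2⟩)
    have h3 : s ^ m / (m.factorial : ℝ) ≤ s ^ m := by
      apply div_le_self (pow_nonneg hs.1.le m)
      exact_mod_cast Nat.one_le_iff_ne_zero.2 (Nat.factorial_ne_zero m)
    have := hs.1.le
    gcongr
  rw [e1]
  calc _ ≤ ENNReal.ofReal (|Φ m 1| + |∫ s in (0:ℝ)..1, (-s) ^ m / m.factorial * h (m + 1) s|) :=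
        ENNReal.ofReal_le_ofReal (abs_sub _ _)
    _ = ENNReal.ofReal |Φ m 1| + _ := ENNReal.ofReal_add (abs_nonneg _) (abs_nonneg _)
    _ ≤ _ := by
      refine add_le_add ?_ b2
      rw [← ENNReal.ofReal_sum_of_nonneg fun j _ => HH_nn j g _]
      exact ENNReal.ofReal_le_ofReal b1
lemma lint_scale (K : E → ℝ≥0∞) (hK : Measurable K) (y : E) {s : ℝ} (hs : 0 < s) :
    ENNReal.ofReal (s ^ Module.finrank ℝ E) * ∫⁻ z, K (y + s • z) = ∫⁻ x, K x := by
  have h1 : ∫⁻ z, K (y + s • z) = ENNReal.ofReal |(s ^ Module.finrank ℝ E)⁻¹| * ∫⁻ x, K (y + x) := by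
    have := lintegral_map (μ := (volume : Measure E)) (f := fun x => K (y + x)) (g := fun z => s • z)
      (by fun_prop) (by fun_prop)
    rw [← this, Measure.map_addHaar_smul _ hs.ne', lintegral_smul_measure]; rfl
  rw [h1, lintegral_add_left_eq_self, ← mul_assoc, ← ENNReal.ofReal_mul (by positivity), abs_of_nonneg (by positivity),
    mul_inv_cancel₀ (by positivity), ENNReal.ofReal_one, one_mul]
lemma sob {p ν : E} (hν : ‖ν‖ = 1) {r : ℝ} (hr : 0 < r) (hr1 : r ≤ 1) {g : E → ℝ} (hg : QA (HB p ν r) univ g) :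
    ∃ C, ∀ y ∈ HB p ν (r / 2), |g y| ≤ C := by
  set N := HB p ν r with hNd
  have hN : IsOpen N := HB_open _ _ _
  have hb : Bornology.IsBounded N := Metric.isBounded_ball.subset inter_subset_left
  set n := Module.finrank ℝ E with hn
  choose K hKm hKle hKint using fun j => lint_le hN (HH_nn j g) (HH_cont hN j hg.1) (HH_int hN hb j hg)
  set B := Metric.ball (-(r / 4) • ν) (r / 8) with hB
  have hBm : MeasurableSet B := measurableSet_ball
  have hBz : ∀ z ∈ B, ‖z‖ < r / 2 ∧ inner ℝ z ν < 0 := by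
    intro z hz
    rw [hB, Metric.mem_ball, dist_eq_norm] at hz
    have e : z = (z - (-(r / 4) • ν)) + (-(r / 4) • ν) := by abel
    have h4 : ‖-(r / 4) • ν‖ = r / 4 := by
      rw [norm_smul, hν, mul_one, norm_neg, Real.norm_of_nonneg (by positivity)]
    constructor
    · rw [e]
      refine (norm_add_le _ _).trans_lt ?_
      rw [h4]; linarith
    · rw [e, inner_add_left, real_inner_smul_left, real_inner_self_eq_norm_sq, hν]
      have := (abs_le.1 (abs_real_inner_le_norm (z - (-(r / 4) • ν)) ν)).2
      rw [hν] at this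
      linarith
  set A : ℝ≥0∞ := ∑ j ∈ Finset.range (n + 1), (∫⁻ x, K j x) + ∫⁻ x, K (n + 1) x with hA
  have hAfin : A ≠ ⊤ := by
    rw [hA]
    exact ENNReal.add_ne_top.2 ⟨ENNReal.sum_ne_top.2 fun j _ => hKint j, hKint _⟩
  have key : ∀ y ∈ HB p ν (r / 2), ENNReal.ofReal |g y| * volume B ≤ A := by
    intro y hy
    have hyz : ∀ z ∈ B, ∀ s ∈ Icc (0:ℝ) 1, y + s • z ∈ N := by
      intro z hz s hs
      obtain ⟨h1, h2⟩ := hBz z hz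
      refine ⟨?_, ?_⟩
      · have := hy.1
        rw [Metric.mem_ball, dist_eq_norm] at this ⊢
        calc _ = ‖(y - p) + s • z‖ := by congr 1; abel
          _ ≤ ‖y - p‖ + ‖s • z‖ := norm_add_le _ _
          _ < r := by
            rw [norm_smul, Real.norm_of_nonneg hs.1]
            nlinarith [hs.2, norm_nonneg z, hs.1]
      · have := hy.2
        rw [mem_setOf_eq] at this ⊢
        rw [add_sub_right_comm, inner_add_left, real_inner_smul_left]
        nlinarith [hs.1]
    have hpt : ∀ z ∈ B, ENNReal.ofReal |g y| ≤ ∑ j ∈ Finset.range (n + 1), K j (y + z) +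
        ∫⁻ s in Ioc (0:ℝ) 1, ENNReal.ofReal (s ^ n) * K (n + 1) (y + s • z) := by
      intro z hz
      have hz1 : ‖z‖ ≤ 1 := by linarith [(hBz z hz).1]
      refine (taylor0 hN hg.1 hz1 (hyz z hz) n).trans (add_le_add ?_ ?_)
      · refine Finset.sum_le_sum fun j _ => hKle j _ ?_
        simpa using hyz z hz 1 (by simp)
      · refine setLIntegral_mono' measurableSet_Ioc fun s hs => ?_
        gcongr
        exact hKle _ _ (hyz z hz s ⟨hs.1.le, hs.2⟩)
    have hm1 : ∀ j, Measurable fun z => K j (y + z) := fun j => (hKm j).comp (by fun_prop)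
    have hm2 : Measurable (Function.uncurry fun (z : E) (s : ℝ) => ENNReal.ofReal (s ^ n) * K (n + 1) (y + s • z)) := by
      refine Measurable.mul (by fun_prop) ((hKm (n + 1)).comp (by fun_prop))
    calc ENNReal.ofReal |g y| * volume B = ∫⁻ z in B, ENNReal.ofReal |g y| := by rw [setLIntegral_const]
      _ ≤ ∫⁻ z in B, (∑ j ∈ Finset.range (n + 1), K j (y + z) +
        ∫⁻ s in Ioc (0:ℝ) 1, ENNReal.ofReal (s ^ n) * K (n + 1) (y + s • z)) := setLIntegral_mono' hBm hpt
      _ ≤ ∫⁻ z, (∑ j ∈ Finset.range (n + 1), K j (y + z) +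
        ∫⁻ s in Ioc (0:ℝ) 1, ENNReal.ofReal (s ^ n) * K (n + 1) (y + s • z)) := setLIntegral_le_lintegral _ _
      _ = ∑ j ∈ Finset.range (n + 1), (∫⁻ z, K j (y + z)) +
        ∫⁻ z, ∫⁻ s in Ioc (0:ℝ) 1, ENNReal.ofReal (s ^ n) * K (n + 1) (y + s • z) := by
          rw [lintegral_add_left (Finset.measurable_sum _ fun j _ => hm1 j), lintegral_finset_sum _ fun j _ => hm1 j]
      _ ≤ A := by
          refine add_le_add (Finset.sum_le_sum fun j _ => by rw [lintegral_add_left_eq_self]) ?_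
          rw [lintegral_lintegral_swap hm2.aemeasurable]
          calc _ ≤ ∫⁻ s in Ioc (0:ℝ) 1, ∫⁻ x, K (n + 1) x := by
                refine setLIntegral_mono' measurableSet_Ioc fun s hs => ?_
                have hmm : Measurable fun x => K (n + 1) (y + s • x) := (hKm _).comp (by fun_prop)
                rw [lintegral_const_mul _ hmm, lint_scale _ (hKm _) y hs.1]
            _ = _ := by rw [setLIntegral_const]; simp
  have hV0 : volume B ≠ 0 := (Metric.measure_ball_pos volume _ (by positivity)).ne'
  have hVt : volume B ≠ ⊤ := measure_ball_lt_top.ne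
  refine ⟨(A / volume B).toReal, fun y hy => ?_⟩
  have := (ENNReal.le_div_iff_mul_le (Or.inl hV0) (Or.inl hVt)).2 (key y hy)
  exact (ENNReal.ofReal_le_iff_le_toReal (ENNReal.div_ne_top hAfin hV0)).1 this
end
def BD (N : Set E) (g : E → ℝ) : Prop := ContDiffOn ℝ ∞ g N ∧ ∀ l : List E, ∃ C, ∀ y ∈ N, |DL l g y| ≤ C
lemma BD_dd {N : Set E} (hN : IsOpen N) {g : E → ℝ} (h : BD N g) (a : E) : BD N (dd a g) :=
  ⟨dd_smooth hN h.1 a, fun l => h.2 (a :: l)⟩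
lemma fd_sum (g : E → ℝ) (x : E) :
    fderiv ℝ g x = ∑ i, dd (stdOrthonormalBasis ℝ E i) g x • innerSL ℝ (stdOrthonormalBasis ℝ E i) := by
  ext a
  conv_lhs => rw [← (stdOrthonormalBasis ℝ E).sum_repr a]
  simp [map_sum, OrthonormalBasis.repr_apply_apply, dd, mul_comm]
lemma BD_fd {N : Set E} {g : E → ℝ} (h : BD N g) : ∃ M, 0 ≤ M ∧ ∀ y ∈ N, ‖fderiv ℝ g y‖ ≤ M := by
  choose C hC using fun i => h.2 [stdOrthonormalBasis ℝ E i]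
  refine ⟨∑ i, |C i|, Finset.sum_nonneg fun i _ => abs_nonneg _, fun y hy => ?_⟩
  rw [fd_sum]
  refine (norm_sum_le _ _).trans (Finset.sum_le_sum fun i _ => ?_)
  rw [norm_smul, innerSL_apply_norm, OrthonormalBasis.norm_eq_one, mul_one]
  exact (hC i y hy).trans (le_abs_self _)
lemma BD_lim {N : Set E} (hN : IsOpen N) (hc : Convex ℝ N) {g : E → ℝ} (h : BD N g) (x : E) (hx : x ∈ closure N) :
    ∃ y, Tendsto g (𝓝[N] x) (𝓝 y) := by
  obtain ⟨M, hM0, hM⟩ := BD_fd h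
  have hl : LipschitzOnWith ⟨M, hM0⟩ g N :=
    hc.lipschitzOnWith_of_nnnorm_fderiv_le (fun y hy => dfa hN h.1 hy) fun y hy => by exact hM y hy
  have hu := hl.uniformContinuousOn
  have : (𝓝[N] x).NeBot := mem_closure_iff_nhdsWithin_neBot.1 hx
  have h1 : Cauchy (𝓝[N] x) := cauchy_nhds.mono nhdsWithin_le_nhds
  have h2 : Cauchy (map g (𝓝[N] x)) := h1.map_of_le hu inf_le_right
  exact CompleteSpace.complete h2
lemma BD_ext {N : Set E} (hN : IsOpen N) (hc : Convex ℝ N) (m : ℕ) : ∀ {g : E → ℝ}, BD N g →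
    ContDiffOn ℝ m (extendFrom N g) (closure N) := by
  induction m with
  | zero =>
    intro g h
    rw [Nat.cast_zero, contDiffOn_zero]
    exact continuousOn_extendFrom subset_rfl (BD_lim hN hc h)
  | succ m ih =>
    intro g h
    rw [Nat.cast_succ, contDiffOn_succ_iff_hasFDerivWithinAt (by simp)]
    intro x hx
    let b := stdOrthonormalBasis ℝ E
    refine ⟨closure N, by rw [insert_eq_of_mem hx]; exact self_mem_nhdsWithin, by simp,
      fun x => ∑ i, extendFrom N (dd (b i) g) x • innerSL ℝ (b i), fun x hx => ?_,
      ContDiffOn.sum fun i _ => (ih (BD_dd hN h _)).smul contDiffOn_const⟩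
    have he : EqOn (extendFrom N g) g N := extendFrom_extends h.1.continuousOn
    have hco : ContinuousOn (extendFrom N g) (closure N) := continuousOn_extendFrom subset_rfl (BD_lim hN hc h)
    refine hasFDerivWithinAt_closure_of_tendsto_fderiv ?_ hc hN ?_ ?_
    · exact (h.1.congr he).differentiableOn (by simp)
    · exact fun y hy => (hco y hy).mono subset_closure
    · have h1 : Tendsto (fun y => ∑ i, dd (b i) g y • innerSL ℝ (b i)) (𝓝[N] x)
          (𝓝 (∑ i, extendFrom N (dd (b i) g) x • innerSL ℝ (b i))) := by
        refine tendsto_finset_sum _ fun i _ => Tendsto.smul_const ?_ _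
        exact tendsto_extendFrom (BD_lim hN hc (BD_dd hN h _) x hx)
      refine h1.congr' ?_
      filter_upwards [self_mem_nhdsWithin] with y hy
      rw [(he.eventuallyEq_of_mem (hN.mem_nhds hy)).fderiv_eq, fd_sum g y]
lemma BD_of_QA {p ν : E} (hν : ‖ν‖ = 1) {r : ℝ} (hr : 0 < r) (hr1 : r ≤ 1) {g : E → ℝ} (hg : QA (HB p ν r) univ g) :
    BD (HB p ν (r / 2)) g := by
  refine ⟨hg.1.mono (HB_mono _ _ (by linarith)), fun l => ?_⟩
  have : ∀ {g : E → ℝ}, QA (HB p ν r) univ g → QA (HB p ν r) univ (DL l g) := by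
    induction l with
    | nil => exact fun h => h
    | cons a l ih => exact fun h => ih (QA_dd (HB_open _ _ _) h (mem_univ a))
  exact sob hν hr hr1 (this hg)
lemma lip [Nontrivial E] {D : Set E} (hD : Bornology.IsBounded D) (k : KK D) {g : E → ℝ}
    (hg : JJ D k =ᵐ[volume] g) {p : E} {R M : ℝ} (hM0 : 0 ≤ M)
    (hM : ∀ e, ∀ᵐ x, x ∈ Metric.ball p R → |inner ℝ ((k : Lp E 2 volume) x) e| ≤ M * ‖e‖)
    {x y : E} (hx : x ∈ Metric.ball p R) (hy : y ∈ Metric.ball p R) (cx : ContinuousAt g x) (cy : ContinuousAt g y) :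
    |g x - g y| ≤ M * ‖x - y‖ := by
  have hgm : MemLp g 2 volume := (memLp_congr_ae hg).1 (Lp.memLp _)
  have hgl : LocallyIntegrable g volume := hgm.locallyIntegrable (by norm_num)
  obtain ⟨s, hs1, hs2, hsR⟩ : ∃ s, dist x p < s ∧ dist y p < s ∧ s < R := by
    obtain ⟨s, h1, h2⟩ := exists_between (max_lt (Metric.mem_ball.1 hx) (Metric.mem_ball.1 hy))
    exact ⟨s, (le_max_left _ _).trans_lt h1, (le_max_right _ _).trans_lt h1, h2⟩
  refine le_of_forall_pos_le_add fun ε hε => ?_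
  obtain ⟨d1, hd1, H1⟩ := Metric.continuousAt_iff.1 cx (ε / 2) (by positivity)
  obtain ⟨d2, hd2, H2⟩ := Metric.continuousAt_iff.1 cy (ε / 2) (by positivity)
  obtain ⟨d, hd0, hd⟩ : ∃ d, 0 < d ∧ d < min (min d1 d2) (R - s) := exists_between (by
    simp only [lt_min_iff]; exact ⟨⟨hd1, hd2⟩, by linarith⟩)
  simp only [lt_min_iff] at hd
  let φ : ContDiffBump (0 : E) := ⟨d / 2, d, by positivity, by linarith⟩
  set ψ : E → ℝ := φ.normed volume with hψ
  have hψs : ContDiff ℝ ∞ ψ := φ.contDiff_normed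
  have hψc : HasCompactSupport ψ := φ.hasCompactSupport_normed
  have hψ0 : ∀ z, ψ z ≠ 0 → ‖z‖ < d := by
    intro z hz
    have : z ∈ Function.support ψ := hz
    rw [hψ, φ.support_normed_eq] at this
    simpa using this
  set L := ContinuousLinearMap.lsmul ℝ ℝ (E := ℝ)
  let c : E → ℝ := MeasureTheory.convolution ψ g L volume
  have hcx : |c x - g x| ≤ ε / 2 := by
    have := φ.dist_normed_convolution_le (x₀ := x) (g := g) (μ := volume) (ε := ε / 2) hgm.1 fun z hz =>
      (H1 ((Metric.mem_ball.1 hz).trans hd.1.1)).le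
    simpa [Real.dist_eq] using this
  have hcy : |c y - g y| ≤ ε / 2 := by
    have := φ.dist_normed_convolution_le (x₀ := y) (g := g) (μ := volume) (ε := ε / 2) hgm.1 fun z hz =>
      (H2 ((Metric.mem_ball.1 hz).trans hd.1.2)).le
    simpa [Real.dist_eq] using this
  have hc2 : c = MeasureTheory.convolution g ψ (ContinuousLinearMap.mul ℝ ℝ) volume := by
    ext z
    simp only [c]
    rw [← convolution_flip]
    simp [MeasureTheory.convolution_def, L, mul_comm]
  have hder : ∀ z, HasFDerivAt c ((MeasureTheory.convolution g (fderiv ℝ ψ)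
      ((ContinuousLinearMap.mul ℝ ℝ).precompR E) volume) z) z := by
    intro z
    rw [hc2]
    exact hψc.hasFDerivAt_convolution_right (ContinuousLinearMap.mul ℝ ℝ) hgl (hψs.of_le (by simp)) z
  have hbd : ∀ z ∈ Metric.ball p s, ‖fderiv ℝ c z‖ ≤ M := by
    intro z hz
    rw [(hder z).fderiv]
    refine ContinuousLinearMap.opNorm_le_bound _ hM0 fun e => ?_
    have hce : ConvolutionExistsAt g (fderiv ℝ ψ) z ((ContinuousLinearMap.mul ℝ ℝ).precompR E) volume :=
      (hψc.fderiv ℝ).convolutionExists_right _ hgl (hψs.continuous_fderiv (by simp)) z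
    have e1 : (MeasureTheory.convolution g (fderiv ℝ ψ) ((ContinuousLinearMap.mul ℝ ℝ).precompR E) volume) z e
        = ∫ t, g t * fderiv ℝ ψ (z - t) e := by
      rw [MeasureTheory.convolution_def, ContinuousLinearMap.integral_apply hce]
      rfl
    have e2 : ∀ t, fderiv ℝ (fun t => ψ (z - t)) t e = - fderiv ℝ ψ (z - t) e := by
      intro t
      have h1 : HasFDerivAt (fun t : E => z - t) (-ContinuousLinearMap.id ℝ E) t :=
        (hasFDerivAt_id t).const_sub z
      have h2 := ((hψs.differentiable (by simp) (z - t)).hasFDerivAt).comp t h1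
      have h3 : fderiv ℝ (fun t => ψ (z - t)) t = _ := h2.fderiv
      rw [h3]; simp
    have hs' : ContDiff ℝ ∞ (fun t => ψ (z - t)) := hψs.comp (contDiff_const.sub contDiff_id)
    have hc' : HasCompactSupport (fun t => ψ (z - t)) := hψc.comp_homeomorph (Homeomorph.subLeft z)
    have e3 := weak_grad hD k hs' hc' e
    have e4 : ∫ t, g t * fderiv ℝ ψ (z - t) e = ∫ t, inner ℝ ((k : Lp E 2 volume) t) e * ψ (z - t) := by
      have : ∫ t, g t * fderiv ℝ ψ (z - t) e = - ∫ t, JJ D k t * fderiv ℝ (fun t => ψ (z - t)) t e := by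
        rw [← integral_neg]
        apply integral_congr_ae
        filter_upwards [hg] with t ht
        rw [e2, ht]; ring
      rw [this, e3, neg_neg]
    rw [e1, e4]
    have hψi : Integrable (fun t => ψ (z - t)) volume := integ_cs hs'.continuous hc'
    calc _ ≤ ∫ t, M * ‖e‖ * ψ (z - t) := by
          refine norm_integral_le_of_norm_le (hψi.const_mul _) ?_
          filter_upwards [hM e] with t ht
          rw [norm_mul, Real.norm_of_nonneg (φ.nonneg_normed _)]
          by_cases h0 : ψ (z - t) = 0
          · rw [← hψ, h0]; simp
          · gcongr
            · exact φ.nonneg_normed _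
            · apply ht
              have h5 := hψ0 _ h0
              rw [Metric.mem_ball] at hz ⊢
              calc dist t p ≤ dist t z + dist z p := dist_triangle _ _ _
                _ < d + s := by rw [dist_comm t z, dist_eq_norm z t]; linarith
                _ < R := by linarith
      _ = M * ‖e‖ := by
          rw [integral_const_mul, integral_sub_left_eq_self ψ volume z, hψ, φ.integral_normed, mul_one]
  have hmv : ‖c x - c y‖ ≤ M * ‖x - y‖ :=
    (convex_ball p s).norm_image_sub_le_of_norm_fderiv_le (fun z _ => (hder z).differentiableAt) hbd
      (Metric.mem_ball.2 hs2) (Metric.mem_ball.2 hs1)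
  rw [Real.norm_eq_abs] at hmv
  rw [abs_le] at *
  constructor <;> linarith [hcx.1, hcx.2, hcy.1, hcy.2, hmv.1, hmv.2]
lemma QA_mono {N N' : Set E} (h : N' ⊆ N) {A : Set E} {g : E → ℝ} (hg : QA N A g) : QA N' A g :=
  ⟨hg.1.mono h, fun l hl => (hg.2 l hl).mono_measure (Measure.restrict_mono h le_rfl)⟩
lemma bdry_reg [Nontrivial E] {D : Set E} (hD : Bornology.IsBounded D) (hDo : IsOpen D) {A : Set E} (hA : IsClosed A)
    (r : L2E) (hr : ∀ᵐ x, x ∉ A → r x = 0) {w : E → ℝ}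
    (hw : GG D r =ᵐ[volume] w) (hws : ContDiffOn ℝ ∞ w (D \ A)) (hwl : ∀ x ∈ D \ A, Δ w x = 0)
    (hw0 : ∀ x, x ∉ D → w x = 0) {p : E} (hpA : p ∉ A) (hp : LocDef D p) (hpc : p ∈ closure D) (hpD : p ∉ D) :
    ContDiffWithinAt ℝ ∞ w (closure D) p := by
  obtain ⟨F, hFp, hSp, hFA⟩ := flat_exists hp hA hpA
  obtain ⟨S, p', ν, R, hR, hν, hFD⟩ := F
  dsimp only at *
  subst hFp
  have hss : ∀ x, S.symm.f (S.f x) = x := fun x => by simp [Dif.symm]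
  have hss' : ∀ x, S.f (S.symm.f x) = x := fun x => by simp [Dif.symm]
  have hDr : ∀ x, S.f x ∈ Metric.ball p' (3 * R) → (x ∈ D ↔ inner ℝ (S.f x - p') ν < 0) := by
    intro x hx; have := hFD _ hx; rwa [hss] at this
  have hAr : ∀ x, S.f x ∈ Metric.ball p' (3 * R) → x ∉ A := by
    intro x hx; have := hFA _ hx; rwa [hss] at this
  have hW : IsOpen (D \ A) := hDo.sdiff hA
  set v : E → ℝ := fun y => w (S.symm.f y) with hv
  have hwv : w = fun x => v (S.f x) := by ext x; simp only [hv, hss]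
  have hQ : QA (HB p' ν (R / 2)) univ v := by
    refine bdry_L2 hD ⟨S, p', ν, R, hR, hν, hFD⟩ r ?_ hw hW hws hwl ?_
    · filter_upwards [hr] with x hx h1
      exact hx (hAr x (Metric.closedBall_subset_ball (by linarith) h1))
    · intro y hy
      have h3 := Metric.ball_subset_ball (by linarith : R ≤ 3 * R) hy.1
      exact ⟨(hFD y h3).2 hy.2, hFA y h3⟩
  set r0 := min (R / 2) 1 with hr0
  have hr0p : 0 < r0 := lt_min (by positivity) one_pos
  have hB := BD_of_QA hν hr0p (min_le_right _ _) (QA_mono (HB_mono _ _ (min_le_left _ _)) hQ)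
  set N := HB p' ν (r0 / 2) with hN
  have hNo : IsOpen N := HB_open _ _ _
  have hNc : Convex ℝ N := HB_convex _ _ _
  have hr3 : r0 / 2 ≤ 3 * R := by linarith [min_le_left (R / 2) 1]
  set G := extendFrom N v with hG
  have hGs : ContDiffOn ℝ ∞ G (closure N) := contDiffOn_infty.2 fun m => BD_ext hNo hNc m hB
  have hGe : EqOn G v N := extendFrom_extends hB.1.continuousOn
  obtain ⟨M, hM0, hM⟩ := BD_fd hB
  obtain ⟨MS, hMS0, hMS⟩ := S.bound
  obtain ⟨δ, hδ, hδS⟩ : ∃ δ > 0, ∀ x ∈ Metric.ball p' δ, S.f x ∈ Metric.ball p' (r0 / 2) := by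
    have := Metric.continuousAt_iff.1 (S.f.continuous.continuousAt (x := p')) (r0 / 2) (by positivity)
    obtain ⟨δ, h1, h2⟩ := this
    refine ⟨δ, h1, fun x hx => ?_⟩
    have := h2 hx
    rwa [hSp] at this
  set B := Metric.ball p' δ with hBd
  have hBo : IsOpen B := Metric.isOpen_ball
  have hS3 : ∀ x ∈ B, S.f x ∈ Metric.ball p' (3 * R) := fun x hx => Metric.ball_subset_ball hr3 (hδS x hx)
  have hDN : ∀ x ∈ B, x ∈ D → S.f x ∈ N := fun x hx hxD => ⟨hδS x hx, (hDr x (hS3 x hx)).1 hxD⟩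
  set k := ContinuousLinearMap.adjoint (JJ D) r with hk
  have hwk : JJ D k =ᵐ[volume] w := hw
  have hOW : D ∩ B ⊆ D \ A := fun x hx => ⟨hx.1, hAr x (hS3 x hx.2)⟩
  have hid := ident hD k (hDo.inter hBo) (hws.mono hOW) (fun ψ _ _ _ => by
    apply integral_congr_ae; filter_upwards [hwk] with x hx; rw [hx])
  have hbd : ∀ e, ∀ᵐ x, x ∈ B → |inner ℝ ((k : Lp E 2 volume) x) e| ≤ (M * MS) * ‖e‖ := by
    intro e
    filter_upwards [hid.2 e, KK_off hDo.measurableSet k] with x h1 h2 hx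
    by_cases hxD : x ∈ D
    · rw [h1 ⟨hxD, hx⟩, hwv]
      have hy := hDN x hx hxD
      have h3 := (dfa hNo hB.1 hy).hasFDerivAt.comp x (S.hfd x)
      have h4 : fderiv ℝ (fun x => v (S.f x)) x = _ := h3.fderiv
      rw [h4, ContinuousLinearMap.comp_apply, ← Real.norm_eq_abs]
      calc _ ≤ ‖fderiv ℝ v (S.f x)‖ * (‖fderiv ℝ S.f x‖ * ‖e‖) :=
            (ContinuousLinearMap.le_opNorm _ _).trans (by gcongr; exact ContinuousLinearMap.le_opNorm _ _)
        _ ≤ M * (MS * ‖e‖) := by gcongr; exacts [hM _ hy, hMS x]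
        _ = _ := by ring
    · rw [h2 hxD]; simp; positivity
  have hMM : 0 ≤ M * MS := by positivity
  have hq : ∀ q ∈ B, q ∉ D → ∀ x ∈ B, x ∈ D → |w x| ≤ (M * MS) * ‖x - q‖ := by
    intro q hq hqD x hx hxD
    have hge : 0 ≤ inner ℝ (S.f q - p') ν := not_lt.1 fun h => hqD ((hDr q (hS3 q hq)).2 h)
    let y : ℝ → E := fun h => S.symm.f (S.f q + h • ν)
    have hyc : Continuous y := S.symm.f.continuous.comp (by fun_prop)
    have hy0 : y 0 = q := by simp [y, hss]
    have hyB : ∀ᶠ h in 𝓝[>] (0:ℝ), y h ∈ B := by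
      have : ∀ᶠ h in 𝓝 (0:ℝ), y h ∈ B := hyc.continuousAt.eventually (by rw [hy0]; exact hBo.mem_nhds hq)
      exact this.filter_mono nhdsWithin_le_nhds
    have hcx : ContinuousAt w x :=
      ((hws.contDiffAt (hW.mem_nhds (hOW ⟨hxD, hx⟩))).continuousAt)
    have hev : ∀ᶠ h in 𝓝[>] (0:ℝ), |w x| ≤ (M * MS) * ‖x - y h‖ := by
      filter_upwards [hyB, self_mem_nhdsWithin] with h hh hpos
      have hzero : w =ᶠ[𝓝 (y h)] fun _ => 0 := by
        have ho : IsOpen (B ∩ {z | 0 < inner ℝ (S.f z - p') ν}) :=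
          hBo.inter (isOpen_lt continuous_const (by have := S.f.continuous; fun_prop))
        have hm : y h ∈ B ∩ {z | 0 < inner ℝ (S.f z - p') ν} := by
          refine ⟨hh, ?_⟩
          simp only [mem_setOf_eq, y, hss']
          rw [add_sub_right_comm, inner_add_left, real_inner_smul_left, real_inner_self_eq_norm_sq, hν]
          have : 0 < h := hpos
          linarith
        filter_upwards [ho.mem_nhds hm] with z hz
        exact hw0 z fun hzD => absurd ((hDr z (hS3 z hz.1)).1 hzD) (not_lt.2 (le_of_lt hz.2))
      have h1 := lip hD k hwk hMM hbd hx hh hcx (continuousAt_const.congr hzero.symm)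
      rwa [hzero.eq_of_nhds, sub_zero] at h1
    have hlim : Tendsto (fun h => (M * MS) * ‖x - y h‖) (𝓝[>] (0:ℝ)) (𝓝 ((M * MS) * ‖x - q‖)) := by
      have : Continuous fun h => (M * MS) * ‖x - y h‖ := by fun_prop
      have h2 := this.tendsto 0
      rw [hy0] at h2
      exact h2.mono_left nhdsWithin_le_nhds
    exact ge_of_tendsto hlim hev
  have hcl : ∀ x ∈ B, x ∈ closure D → S.f x ∈ closure N := by
    intro x hx hxc
    have h1 : x ∈ closure (D ∩ B) := hBo.closure_inter ⟨hxc, hx⟩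
    have h2 := image_closure_subset_closure_image S.f.continuous (mem_image_of_mem S.f h1)
    refine closure_mono ?_ h2
    rintro _ ⟨z, hz, rfl⟩
    exact hDN z hz.2 hz.1
  have hG0 : ∀ q ∈ B, q ∈ closure D → q ∉ D → G (S.f q) = 0 := by
    intro q hqB hqc hqD
    refine extendFrom_eq (hcl q hqB hqc) ?_
    have hlim : Tendsto (fun y => (M * MS) * ‖S.symm.f y - q‖) (𝓝[N] (S.f q)) (𝓝 0) := by
      have : Continuous fun y => (M * MS) * ‖S.symm.f y - q‖ := by have := S.symm.f.continuous; fun_prop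
      have h2 := this.tendsto (S.f q)
      rw [hss, sub_self, norm_zero, mul_zero] at h2
      exact h2.mono_left nhdsWithin_le_nhds
    refine squeeze_zero_norm' ?_ hlim
    have hSB : ∀ᶠ y in 𝓝[N] (S.f q), S.symm.f y ∈ B := by
      have : ∀ᶠ y in 𝓝 (S.f q), S.symm.f y ∈ B :=
        S.symm.f.continuous.continuousAt.eventually (by rw [hss]; exact hBo.mem_nhds hqB)
      exact this.filter_mono nhdsWithin_le_nhds
    filter_upwards [hSB, self_mem_nhdsWithin] with y hy hyN
    rw [Real.norm_eq_abs]
    exact hq q hqB hqD _ hy ((hFD y (Metric.ball_subset_ball hr3 hyN.1)).2 hyN.2)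
  have hfin : ∀ x ∈ B, x ∈ closure D → w x = G (S.f x) := by
    intro x hx hxc
    by_cases hxD : x ∈ D
    · rw [hGe (hDN x hx hxD), hwv]
    · rw [hG0 x hx hxc hxD, hw0 x hxD]
  have hpB : p' ∈ B := Metric.mem_ball_self hδ
  have h1 : ContDiffWithinAt ℝ ∞ (fun x => G (S.f x)) (closure D ∩ B) p' :=
    ContDiffWithinAt.comp p' (hGs _ (hcl p' hpB hpc)) S.s.contDiffAt.contDiffWithinAt (fun x hx => hcl x hx.2 hx.1)
  have h2 : ContDiffWithinAt ℝ ∞ w (closure D ∩ B) p' :=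
    h1.congr (fun x hx => hfin x hx.2 hx.1) (hfin p' hpB hpc)
  exact (contDiffWithinAt_inter (hBo.mem_nhds hpB)).1 h2
lemma sol_exists [Nontrivial E] {D : Set E} (hD : Bornology.IsBounded D) (hDo : IsOpen D) {A : Set E} (hA : IsClosed A)
    (r : L2E) (hr : ∀ᵐ x, x ∉ A → r x = 0) :
    ∃ w : E → ℝ, GG D r =ᵐ[volume] w ∧ ContDiffOn ℝ ∞ w (D \ A) ∧ (∀ x ∈ D \ A, Δ w x = 0) ∧
      (∀ x, x ∉ D → w x = 0) ∧ ∀ p, p ∉ A → p ∉ D → p ∈ closure D → LocDef D p →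
        ContDiffWithinAt ℝ ∞ w (closure D) p := by
  classical
  have hW : IsOpen (D \ A) := hDo.sdiff hA
  obtain ⟨u, hus, hul, hue⟩ := weyl hW (w := GG D r) ((Lp.memLp _).locallyIntegrable (by norm_num)) (fun ψ hψ => by
    have hψD : ψ ∈ TF D := ⟨hψ.1, hψ.2.1, hψ.2.2.trans diff_subset⟩
    have hm : MemLp (Δ ψ) 2 volume := memLp_cs (contDiff_lap hψ.1).continuous (lap_mem hψ).2.1
    have hm' : MemLp ψ 2 volume := memLp_cs hψ.1.continuous hψ.2.1
    rw [← inner_tlR _ hm, GG_symm, GG_lap hD hψD, inner_neg_right, inner_tlR _ hm', neg_eq_zero]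
    apply integral_eq_zero_of_ae
    filter_upwards [hr] with x hx
    by_cases h : x ∈ A
    · have : ψ x = 0 := by
        by_contra h0
        exact (hψ.2.2 (subset_tsupport _ h0)).2 h
      simp [this]
    · simp [hx h])
  set w : E → ℝ := (D \ A).piecewise u (D.piecewise (GG D r) fun _ => 0) with hwd
  have hwu : EqOn w u (D \ A) := fun x hx => by rw [hwd, piecewise_eq_of_mem _ _ _ hx]
  have hw0 : ∀ x, x ∉ D → w x = 0 := fun x hx => by
    rw [hwd, piecewise_eq_of_notMem _ _ _ (fun h => hx h.1), piecewise_eq_of_notMem _ _ _ hx]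
  have hwe : GG D r =ᵐ[volume] w := by
    filter_upwards [hue, JJ_off hD hDo.measurableSet (ContinuousLinearMap.adjoint (JJ D) r)] with x h1 h2
    by_cases hx : x ∈ D \ A
    · rw [hwu hx, h1 hx]
    · rw [hwd, piecewise_eq_of_notMem _ _ _ hx]
      by_cases hxD : x ∈ D
      · rw [piecewise_eq_of_mem _ _ _ hxD]
      · rw [piecewise_eq_of_notMem _ _ _ hxD]; exact h2 hxD
  have hws : ContDiffOn ℝ ∞ w (D \ A) := hus.congr hwu
  have hwl : ∀ x ∈ D \ A, Δ w x = 0 := by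
    intro x hx
    rw [← hul x hx]
    exact (laplacian_congr_nhds (hwu.eventuallyEq_of_mem (hW.mem_nhds hx))).eq_of_nhds
  exact ⟨w, hwe, hws, hwl, hw0, fun p h1 h2 h3 h4 => bdry_reg hD hDo hA r hr hwe hws hwl hw0 h1 h4 h3 h2⟩
lemma thmA [Nontrivial E] {Ω Γ : Set E} (hΩ : IsOpen Ω) (hb : Bornology.IsBounded Ω)
    (hsm : ∀ x ∈ frontier Ω, ∃ (U : Set E) (ρ : E → ℝ),
    IsOpen U ∧ x ∈ U ∧ ContDiffOn ℝ ∞ ρ U ∧ (∀ y ∈ U, fderiv ℝ ρ y ≠ 0) ∧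
    Ω ∩ U = {y ∈ U | ρ y < 0} ∧ frontier Ω ∩ U = {y ∈ U | ρ y = 0})
    (hΓ : IsClosed Γ) (hΓs : Γ ⊆ frontier Ω) {x0 : E} (hx0 : x0 ∈ frontier Ω) (hx0Γ : x0 ∉ Γ) :
    ∃ (D : Set E) (δ : ℝ) (b : E) (ε : ℝ), Bornology.IsBounded D ∧ IsOpen D ∧ 0 < δ ∧ 0 < ε ∧ Ω ⊆ D ∧
      Metric.ball x0 δ ⊆ D ∧ Metric.ball b ε ⊆ Metric.ball x0 δ ∧ Disjoint (Metric.closedBall b ε) (closure Ω) ∧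
      ∀ (A : Set E) (r : L2E), IsClosed A → Disjoint A (closure Ω) →
        (∀ᵐ x, x ∉ A → r x = 0) → ∃ w : E → ℝ, GG D r =ᵐ[volume] w ∧ ContDiffOn ℝ ∞ w (closure Ω) ∧
          (∀ x ∈ Ω, Δ w x = 0) ∧ ∀ x ∈ Γ, w x = 0 := by
  obtain ⟨U, ρ, hU, hxU, hρ, hρd, hΩU, hfU⟩ := hsm x0 hx0
  have hρx : ρ x0 = 0 := (show x0 ∈ {y ∈ U | ρ y = 0} by rw [← hfU]; exact ⟨hx0, hxU⟩).2
  have hOmR : ∀ x ∈ U, (x ∈ Ω ↔ ρ x < 0) := fun x hx =>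
    ⟨fun h => (show x ∈ {y ∈ U | ρ y < 0} by rw [← hΩU]; exact ⟨h, hx⟩).2,
      fun h => (show x ∈ Ω ∩ U by rw [hΩU]; exact ⟨hx, h⟩).1⟩
  have hfrR : ∀ x ∈ U, (x ∈ frontier Ω ↔ ρ x = 0) := fun x hx =>
    ⟨fun h => (show x ∈ {y ∈ U | ρ y = 0} by rw [← hfU]; exact ⟨h, hx⟩).2,
      fun h => (show x ∈ frontier Ω ∩ U by rw [hfU]; exact ⟨hx, h⟩).1⟩
  obtain ⟨t, ht, htU⟩ := Metric.isOpen_iff.1 (hU.sdiff hΓ) x0 ⟨hxU, hx0Γ⟩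
  let φ : ContDiffBump x0 := ⟨t / 4, t / 2, by positivity, by linarith⟩
  have hφt : tsupport φ = Metric.closedBall x0 (t / 2) := φ.tsupport_eq
  have hφU : tsupport φ ⊆ U \ Γ := by
    rw [hφt]; exact (Metric.closedBall_subset_ball (by linarith)).trans htU
  have hφs : ContDiff ℝ ∞ φ := φ.contDiff
  set D := Ω ∪ {x ∈ U | ρ x < φ x} with hDd
  have hDo : IsOpen D := by
    refine hΩ.union ?_
    have : IsOpen (U ∩ (fun x => ρ x - φ x) ⁻¹' Iio 0) :=
      (hρ.continuousOn.sub hφs.continuous.continuousOn).isOpen_inter_preimage hU isOpen_Iio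
    convert this using 1
    ext x; simp
  have hDb : Bornology.IsBounded D := by
    refine (hb.union (Metric.isBounded_closedBall (x := x0) (r := t / 2))).subset ?_
    rintro x (hx | ⟨hxU', hx⟩)
    · exact Or.inl hx
    · by_cases h : x ∈ Ω
      · exact Or.inl h
      · right
        rw [← hφt]
        refine subset_tsupport _ ?_
        have : 0 ≤ ρ x := not_lt.1 fun h' => h ((hOmR x hxU').2 h')
        exact (lt_of_le_of_lt this hx).ne'
  have hx0D : x0 ∈ D := Or.inr ⟨hxU, by rw [hρx]; exact φ.pos_of_mem_ball (Metric.mem_ball_self φ.rOut_pos)⟩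
  obtain ⟨δ, hδ, hδD⟩ := Metric.isOpen_iff.1 hDo x0 hx0D
  have hDU : ∀ x ∈ U, (x ∈ D ↔ ρ x < φ x) := by
    intro x hx
    refine ⟨?_, fun h => Or.inr ⟨hx, h⟩⟩
    rintro (h | h)
    · exact ((hOmR x hx).1 h).trans_le φ.nonneg
    · exact h.2
  have hDn : ∀ x, x ∉ tsupport φ → (x ∈ D ↔ x ∈ Ω) := by
    intro x hx
    refine ⟨?_, fun h => Or.inl h⟩
    rintro (h | h)
    · exact h
    · rw [mem_setOf_eq, image_eq_zero_of_notMem_tsupport hx] at h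
      exact (hOmR x h.1).2 h.2
  have hDΓ : ∀ x ∈ Γ, x ∉ D := by
    intro x hx
    have h1 : x ∉ tsupport φ := fun h => (hφU h).2 hx
    rw [hDn x h1]
    intro h
    have := hΓs hx
    rw [hΩ.frontier_eq] at this
    exact this.2 h
  have hLoc : ∀ p ∈ closure Ω, p ∉ D → LocDef D p := by
    intro p hpc hpD
    have hpf : p ∈ frontier Ω := by
      rw [hΩ.frontier_eq]; exact ⟨hpc, fun h => hpD (Or.inl h)⟩
    by_cases hpt : p ∈ tsupport φ
    · have hpU := (hφU hpt).1
      have hρp := (hfrR p hpU).1 hpf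
      have hφp : φ p = 0 := le_antisymm (by
        rw [hDU p hpU, not_lt, hρp] at hpD; exact hpD) φ.nonneg
      refine ⟨U, fun x => ρ x - φ x, hU, hpU, hρ.sub hφs.contDiffOn, by simp [hρp, hφp], ?_, fun x hx => ?_⟩
      · have h1 : fderiv ℝ φ p = 0 := by
          apply IsLocalMin.fderiv_eq_zero
          exact Eventually.of_forall fun x => by rw [hφp]; exact φ.nonneg
        rw [fderiv_fun_sub (dfa hU hρ hpU) (hφs.differentiable (by simp) p), h1, sub_zero]
        exact hρd p hpU
      · rw [hDU x hx, sub_neg]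
    · obtain ⟨U', ρ', hU', hpU', hρ', hρd', hΩU', hfU'⟩ := hsm p hpf
      refine ⟨U' \ tsupport φ, ρ', hU'.sdiff (isClosed_tsupport _), ⟨hpU', hpt⟩, hρ'.mono diff_subset, ?_,
        hρd' p hpU', fun x hx => ?_⟩
      · exact (show p ∈ {y ∈ U' | ρ' y = 0} by rw [← hfU']; exact ⟨hpf, hpU'⟩).2
      · rw [hDn x hx.2]
        exact ⟨fun h => (show x ∈ {y ∈ U' | ρ' y < 0} by rw [← hΩU']; exact ⟨h, hx.1⟩).2,
          fun h => (show x ∈ Ω ∩ U' by rw [hΩU']; exact ⟨hx.1, h⟩).1⟩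
  obtain ⟨b, hbδ, hbU, hbρ⟩ : ∃ b ∈ Metric.ball x0 δ, b ∈ U ∧ 0 < ρ b := by
    by_contra! hcon
    apply hρd x0 hxU
    apply IsLocalMax.fderiv_eq_zero
    filter_upwards [Metric.ball_mem_nhds x0 hδ, hU.mem_nhds hxU] with x h1 h2
    rw [hρx]; exact hcon x h1 h2
  have hbc : b ∉ closure Ω := by
    intro h
    by_cases h1 : b ∈ Ω
    · exact absurd ((hOmR b hbU).1 h1) (not_lt.2 hbρ.le)
    · have : b ∈ frontier Ω := by rw [hΩ.frontier_eq]; exact ⟨h, h1⟩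
      exact hbρ.ne' ((hfrR b hbU).1 this)
  obtain ⟨ε, hε, hεb⟩ := Metric.isOpen_iff.1 (Metric.isOpen_ball.sdiff (isClosed_closure (s := Ω))) b ⟨hbδ, hbc⟩
  have hcb : Metric.closedBall b (ε / 2) ⊆ Metric.ball b ε := Metric.closedBall_subset_ball (by linarith)
  refine ⟨D, δ, b, ε / 2, hDb, hDo, hδ, by positivity, subset_union_left, hδD,
    fun x hx => (hεb (hcb (Metric.ball_subset_closedBall hx))).1,
    disjoint_left.2 fun x hx => (hεb (hcb hx)).2, ?_⟩
  intro A r hA hAΩ hr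
  obtain ⟨w, h1, h2, h3, h4, h5⟩ := sol_exists hDb hDo hA r hr
  have hΩA : ∀ x ∈ closure Ω, x ∉ A := fun x hx h => disjoint_left.1 hAΩ h hx
  refine ⟨w, h1, fun p hp => ?_, fun x hx => h3 x ⟨Or.inl hx, hΩA x (subset_closure hx)⟩, fun x hx => h4 x (hDΓ x hx)⟩
  have hcc : closure Ω ⊆ closure D := closure_mono subset_union_left
  by_cases hpD : p ∈ D
  · exact (h2.contDiffAt ((hDo.sdiff hA).mem_nhds ⟨hpD, hΩA p hp⟩)).contDiffWithinAt
  · exact (h5 p (hΩA p hp) hpD (hcc hp) (hLoc p hp hpD)).mono hcc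
lemma oned0 {α : Type} [MeasurableSpace α] {μ : Measure α} {G : α → ℂ} (hG : Integrable G μ) {t : α → ℝ}
    (ht : Measurable t) {c : ℝ} (hc : 0 < c) (ht0 : ∀ x, 0 ≤ t x) (htc : ∀ x, t x ≤ c) (hGt : ∀ x, G x ≠ 0 → 0 < t x)
    {C l0 : ℝ} (h : ∀ l : ℝ, l0 ≤ l → ‖∫ x, G x * Complex.exp (l * t x) ∂μ‖ ≤ C) (z : ℂ) :
    ∫ x, G x * Complex.exp (z * t x) ∂μ = 0 := by
  set H : ℂ → ℂ := fun z => ∫ x, G x * Complex.exp (z * t x) ∂μ with hH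
  set A := ∫ x, ‖G x‖ ∂μ with hA
  have hA0 : 0 ≤ A := integral_nonneg fun _ => norm_nonneg _
  have hexp : ∀ (z : ℂ) x, ‖Complex.exp (z * t x)‖ = Real.exp (z.re * t x) := by
    intro z x; rw [Complex.norm_exp]; simp
  have hmeas : ∀ z : ℂ, Measurable fun x => Complex.exp (z * t x) := fun z => by fun_prop
  have hbd : ∀ (z : ℂ) (B : ℝ), (∀ x, z.re * t x ≤ B) → ‖H z‖ ≤ A * Real.exp B := by
    intro z B hB
    calc ‖H z‖ ≤ ∫ x, ‖G x‖ * Real.exp B ∂μ := by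
          refine norm_integral_le_of_norm_le (hG.norm.mul_const _) (Eventually.of_forall fun x => ?_)
          rw [norm_mul, hexp]
          gcongr; exact hB x
      _ = _ := integral_mul_const _ _
  have hb1 : ∀ z : ℂ, z.re ≤ 0 → ‖H z‖ ≤ A := by
    intro z hz
    simpa using hbd z 0 fun x => mul_nonpos_of_nonpos_of_nonneg hz (ht0 x)
  have hb2 : ∀ z : ℂ, ‖H z‖ ≤ A * Real.exp (c * ‖z‖) := by
    intro z
    apply hbd
    intro x
    calc z.re * t x ≤ ‖z‖ * t x := by gcongr; exacts [ht0 x, (le_abs_self _).trans (Complex.abs_re_le_norm z)]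
      _ ≤ ‖z‖ * c := by gcongr; exact htc x
      _ = _ := mul_comm _ _
  have hdiff : Differentiable ℂ H := by
    intro z0
    refine (hasDerivAt_integral_of_dominated_loc_of_deriv_le (s := Metric.ball z0 1) (F := fun z x => G x * Complex.exp (z * t x))
      (F' := fun z x => G x * (Complex.exp (z * t x) * t x)) (bound := fun x => ‖G x‖ * (Real.exp ((‖z0‖ + 1) * c) * c))
      (Metric.ball_mem_nhds _ one_pos) ?_ ?_ ?_ ?_ ?_ ?_).2.differentiableAt
    · exact Eventually.of_forall fun z => hG.1.mul (hmeas z).aestronglyMeasurable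
    · refine hG.mul_bdd (c := Real.exp (‖z0‖ * c)) (hmeas z0).aestronglyMeasurable (Eventually.of_forall fun x => ?_)
      rw [hexp]
      gcongr
      exacts [ht0 x, (le_abs_self _).trans (Complex.abs_re_le_norm z0), htc x]
    · exact hG.1.mul ((hmeas z0).mul (by fun_prop)).aestronglyMeasurable
    · refine Eventually.of_forall fun x z hz => ?_
      rw [norm_mul, norm_mul, hexp, Complex.norm_real, Real.norm_of_nonneg (ht0 x)]
      have hz' : z.re ≤ ‖z0‖ + 1 := by
        have h1 : ‖z‖ ≤ ‖z0‖ + 1 := by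
          have : ‖z - z0‖ < 1 := by simpa [dist_eq_norm] using hz
          linarith [norm_le_norm_add_norm_sub z0 z, norm_sub_rev z z0]
        exact ((le_abs_self _).trans (Complex.abs_re_le_norm z)).trans h1
      have h5 : Real.exp (z.re * t x) ≤ Real.exp ((‖z0‖+1)*c) := Real.exp_le_exp.2 ((mul_le_mul_of_nonneg_right hz' (ht0 x)).trans (mul_le_mul_of_nonneg_left (htc x) (by positivity)))
      exact mul_le_mul_of_nonneg_left (mul_le_mul h5 (htc x) (ht0 x) (Real.exp_pos _).le) (norm_nonneg _)
    · exact hG.norm.mul_const _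
    · refine Eventually.of_forall fun x z hz => ?_
      have h1 : HasDerivAt (fun z : ℂ => z * (t x : ℂ)) (t x : ℂ) z := by simpa using (hasDerivAt_id z).mul_const (t x : ℂ)
      exact (h1.cexp).const_mul (G x)
  set C2 := max C (A * Real.exp (c * |l0|)) with hC2
  have hAC : A ≤ C2 := by
    refine le_trans ?_ (le_max_right _ _)
    exact le_mul_of_one_le_right hA0 (Real.one_le_exp (by positivity))
  have hre : ∀ x : ℝ, 0 ≤ x → ‖H x‖ ≤ C2 := by
    intro x hx
    rcases le_total l0 x with hl | hl
    · exact (h x hl).trans (le_max_left _ _)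
    · refine (hb2 x).trans (le_trans ?_ (le_max_right _ _))
      rw [Complex.norm_real, Real.norm_of_nonneg hx]
      gcongr; exact hl.trans (le_abs_self _)
  have him : ∀ x : ℝ, ‖H (x * Complex.I)‖ ≤ C2 := fun x => (hb1 _ (by simp)).trans hAC
  have hO : ∀ l : Filter ℂ, H =O[l] fun z => Real.exp (c * ‖z‖ ^ (1:ℝ)) := by
    intro l
    refine Asymptotics.IsBigO.of_bound A (Eventually.of_forall fun z => ?_)
    rw [Real.rpow_one, Real.norm_of_nonneg (Real.exp_pos _).le]
    exact hb2 z
  have hall : ∀ z, ‖H z‖ ≤ C2 := by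
    intro z
    rcases le_total z.re 0 with hz | hz
    · exact (hb1 z hz).trans hAC
    · rcases le_total 0 z.im with hi | hi
      · exact PhragmenLindelof.quadrant_I hdiff.diffContOnCl ⟨1, by norm_num, c, hO _⟩ hre (fun x _ => him x) hz hi
      · exact PhragmenLindelof.quadrant_IV hdiff.diffContOnCl ⟨1, by norm_num, c, hO _⟩ hre (fun x _ => him x) hz hi
  have hbdd : Bornology.IsBounded (range H) := isBounded_iff_forall_norm_le.2 ⟨C2, by rintro _ ⟨z, rfl⟩; exact hall z⟩
  have hconst : ∀ w, H w = H z := fun w => hdiff.apply_eq_apply_of_bounded hbdd w z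
  have hlim : Tendsto (fun n : ℕ => H (-(n : ℂ))) atTop (𝓝 (∫ x, (0 : ℂ) ∂μ)) := by
    refine tendsto_integral_of_dominated_convergence (fun x => ‖G x‖) (fun n => hG.1.mul (hmeas _).aestronglyMeasurable)
      hG.norm (fun n => Eventually.of_forall fun x => ?_) (Eventually.of_forall fun x => ?_)
    · rw [norm_mul, hexp]
      refine mul_le_of_le_one_right (norm_nonneg _) (Real.exp_le_one_iff.2 ?_)
      simp; have := ht0 x; positivity
    · by_cases hx : G x = 0
      · simp [hx]
      · rw [tendsto_zero_iff_norm_tendsto_zero]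
        have h1 : ∀ n : ℕ, ‖G x * Complex.exp (-(n : ℂ) * t x)‖ = ‖G x‖ * (Real.exp (- t x)) ^ n := by
          intro n
          rw [norm_mul, hexp, ← Real.exp_nat_mul]
          simp
        simp_rw [h1]
        rw [← mul_zero ‖G x‖]
        refine Tendsto.const_mul _ (tendsto_pow_atTop_nhds_zero_of_lt_one (Real.exp_pos _).le ?_)
        rw [Real.exp_lt_one_iff]; have := hGt x hx; linarith
  simp_rw [hconst, integral_zero] at hlim
  exact tendsto_nhds_unique tendsto_const_nhds hlim
lemma oned {α : Type} [MeasurableSpace α] {μ : Measure α} {G : α → ℂ} (hG : Integrable G μ) {T : α → ℝ}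
    (hT : Measurable T) {c : ℝ} (hc : 0 < c) (hT0 : ∀ x, G x ≠ 0 → T x ≤ 0) 
    {C l0 : ℝ} (h : ∀ l : ℝ, l0 ≤ l → ‖∫ x, G x * Complex.exp (l * T x) ∂μ‖ ≤ C * Real.exp (-c * l)) (τ : ℝ) :
    ∫ x, {x | -c < T x}.indicator G x * Complex.exp (τ * T x * Complex.I) ∂μ = 0 := by
  have hmS : MeasurableSet {x | -c < T x} := measurableSet_lt measurable_const hT
  set G1 := {x | -c < T x}.indicator G with hG1
  have hG1i : Integrable G1 μ := hG.indicator hmS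
  have hmS2 : MeasurableSet {x | -c < T x}ᶜ := hmS.compl
  set G2 := {x | -c < T x}ᶜ.indicator G with hG2
  have hG2i : Integrable G2 μ := hG.indicator hmS2
  have hG12 : ∀ x, G x = G1 x + G2 x := fun x => by
    by_cases hx : x ∈ {x | -c < T x}
    · simp [hG1, hG2, hx]
    · simp [hG1, hG2, hx]
  have hs1 : ∀ x, G1 x ≠ 0 → -c < T x ∧ T x ≤ 0 := by
    intro x hx
    by_cases h1 : x ∈ {x | -c < T x}
    · rw [hG1, indicator_of_mem h1] at hx; exact ⟨h1, hT0 x hx⟩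
    · rw [hG1, indicator_of_notMem h1] at hx; exact absurd rfl hx
  have hs2 : ∀ x, G2 x ≠ 0 → T x ≤ -c := by
    intro x hx
    by_cases h1 : x ∈ {x | -c < T x}
    · rw [hG2, indicator_of_notMem (by simpa using h1)] at hx; exact absurd rfl hx
    · exact not_lt.1 h1
  let t : α → ℝ := fun x => max 0 (min (T x + c) c)
  have htm : Measurable t := by fun_prop
  have hte : ∀ x, G1 x ≠ 0 → t x = T x + c := by
    intro x hx
    obtain ⟨h1, h2⟩ := hs1 x hx
    simp only [t]
    rw [min_eq_left (by linarith), max_eq_right (by linarith)]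
  have hGe : ∀ (z : ℂ) x, G1 x * Complex.exp (z * t x) = Complex.exp (z * c) * (G1 x * Complex.exp (z * T x)) := by
    intro z x
    by_cases hx : G1 x = 0
    · simp [hx]
    · rw [hte x hx]; push_cast
      rw [mul_add, Complex.exp_add]; ring
  have key : ∀ z : ℂ, ∫ x, G1 x * Complex.exp (z * t x) ∂μ = 0 := by
    refine oned0 (c := c) hG1i htm hc (fun x => le_max_left _ _) (fun x => max_le hc.le (min_le_right _ _)) (fun x hx => ?_)
      (C := C + ∫ x, ‖G x‖ ∂μ) (l0 := max l0 0) (fun l hl => ?_)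
    · rw [hte x hx]; linarith [(hs1 x hx).1]
    · have hl0 : 0 ≤ l := (le_max_right _ _).trans hl
      simp_rw [hGe]
      rw [integral_const_mul, norm_mul]
      have hn : ∀ x : α, ‖Complex.exp ((l : ℂ) * T x)‖ = Real.exp (l * T x) := fun x => by
        rw [Complex.norm_exp]; simp
      have hme : Measurable fun x => Complex.exp ((l : ℂ) * T x) := by fun_prop
      have hb : ∀ x, ‖G x * Complex.exp ((l : ℂ) * T x)‖ ≤ ‖G x‖ := by
        intro x
        by_cases hx : G x = 0
        · simp [hx]
        · rw [norm_mul, hn]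
          exact mul_le_of_le_one_right (norm_nonneg _) (Real.exp_le_one_iff.2 (mul_nonpos_of_nonneg_of_nonpos hl0 (hT0 x hx)))
      have hi : Integrable (fun x => G x * Complex.exp ((l : ℂ) * T x)) μ :=
        hG.norm.mono' (hG.1.mul hme.aestronglyMeasurable) (Eventually.of_forall hb)
      have hb2 : ∀ x, ‖G2 x * Complex.exp ((l : ℂ) * T x)‖ ≤ ‖G x‖ * Real.exp (-c * l) := by
        intro x
        by_cases hx : G2 x = 0
        · rw [hx]; simp; positivity
        · rw [norm_mul, hn]
          have : ‖G2 x‖ ≤ ‖G x‖ := norm_indicator_le_norm_self _ _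
          have h3 := hs2 x hx
          exact mul_le_mul this (Real.exp_le_exp.2 (by nlinarith)) (Real.exp_pos _).le (norm_nonneg _)
      have hi2 : Integrable (fun x => G2 x * Complex.exp ((l : ℂ) * T x)) μ :=
        (hG.norm.mul_const _).mono' (hG2i.1.mul hme.aestronglyMeasurable) (Eventually.of_forall hb2)
      have e1 : ∫ x, G1 x * Complex.exp ((l : ℂ) * T x) ∂μ =
          ∫ x, G x * Complex.exp ((l : ℂ) * T x) ∂μ - ∫ x, G2 x * Complex.exp ((l : ℂ) * T x) ∂μ := by
        rw [← integral_sub hi hi2]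
        congr 1; ext x; rw [hG12]; ring
      have e2 : ‖∫ x, G2 x * Complex.exp ((l : ℂ) * T x) ∂μ‖ ≤ (∫ x, ‖G x‖ ∂μ) * Real.exp (-c * l) := by
        rw [← integral_mul_const]
        exact norm_integral_le_of_norm_le (hG.norm.mul_const _) (Eventually.of_forall hb2)
      have e3 : ‖∫ x, G1 x * Complex.exp ((l : ℂ) * T x) ∂μ‖ ≤ (C + ∫ x, ‖G x‖ ∂μ) * Real.exp (-c * l) := by
        rw [e1, add_mul]
        exact (norm_sub_le _ _).trans (add_le_add (h l ((le_max_left _ _).trans hl)) e2)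
      have e4 : ‖Complex.exp ((l : ℂ) * c)‖ = Real.exp (c * l) := by
        rw [Complex.norm_exp]; simp [mul_comm]
      rw [e4]
      calc _ ≤ Real.exp (c * l) * ((C + ∫ x, ‖G x‖ ∂μ) * Real.exp (-c * l)) := by gcongr
        _ = (C + ∫ x, ‖G x‖ ∂μ) * (Real.exp (c * l) * Real.exp (-c * l)) := by ring
        _ = _ := by rw [← Real.exp_add]; simp
  have k2 := key (τ * Complex.I)
  simp_rw [hGe] at k2
  rw [integral_const_mul] at k2
  have k3 := (mul_eq_zero.1 k2).resolve_left (Complex.exp_ne_zero _)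
  rw [← k3]
  congr 1; ext x; ring_nf
def kap (c x : E) : E := (‖x - c‖ ^ 2)⁻¹ • (x - c)
lemma kap_meas (c : E) : Measurable (kap c) := by unfold kap; fun_prop
lemma kap_inv (c x : E) : c + (‖kap c x‖ ^ 2)⁻¹ • kap c x = x := by
  by_cases h : x - c = 0
  · simp [kap, h]; exact (sub_eq_zero.1 h).symm
  · have h0 : ‖x - c‖ ≠ 0 := norm_ne_zero_iff.2 h
    have h1 : (‖kap c x‖ ^ 2)⁻¹ * (‖x - c‖ ^ 2)⁻¹ = 1 := by
      rw [kap, norm_smul, norm_inv, norm_pow, norm_norm]; field_simp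
    conv_lhs => rw [show (‖kap c x‖ ^ 2)⁻¹ • kap c x = ((‖kap c x‖ ^ 2)⁻¹ * (‖x - c‖ ^ 2)⁻¹) • (x - c) by rw [mul_smul]; rfl]
    rw [h1]; simp
lemma four {c : E} {g : E → ℝ} (hg : Integrable g volume)
    (h : ∀ ξ : E, ∫ x, (g x : ℂ) * Complex.exp (inner ℝ (kap c x) ξ * Complex.I) = 0) : g =ᵐ[volume] 0 := by
  have hkm := kap_meas c
  have fin : ∀ k : E → ℝ, Integrable k volume → IsFiniteMeasure (volume.withDensity fun x => ENNReal.ofReal (k x)) := fun k hk =>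
    isFiniteMeasure_withDensity_ofReal hk.2
  have hcf : ∀ k : E → ℝ, Integrable k volume → ∀ ξ : E, charFun ((volume.withDensity fun x => ENNReal.ofReal (k x)).map (kap c)) ξ
      = ∫ x, ((max (k x) 0 : ℝ) : ℂ) * Complex.exp (inner ℝ (kap c x) ξ * Complex.I) := by
    intro k hk ξ
    rw [charFun_apply, integral_map hkm.aemeasurable (by fun_prop), integral_withDensity_eq_integral_toReal_smul₀ hk.1.aemeasurable.ennreal_ofReal
      (Eventually.of_forall fun x => ENNReal.ofReal_lt_top)]
    rfl
  haveI := fin g hg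
  haveI := fin (fun x => - g x) hg.neg
  have hi : ∀ k : E → ℝ, Integrable k volume → ∀ ξ : E, Integrable fun x => ((max (k x) 0 : ℝ) : ℂ) * Complex.exp (inner ℝ (kap c x) ξ * Complex.I) := by
    intro k hk ξ
    refine (hk.pos_part.ofReal (𝕜 := ℂ)).mul_bdd (c := 1) (Measurable.aestronglyMeasurable (by fun_prop)) (Eventually.of_forall fun x => ?_)
    rw [Complex.norm_exp]; simp
  have e1 : (volume.withDensity fun x => ENNReal.ofReal (g x)).map (kap c) = (volume.withDensity fun x => ENNReal.ofReal (- g x)).map (kap c) := by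
    apply Measure.ext_of_charFun
    ext ξ
    rw [hcf g hg, hcf (fun x => - g x) hg.neg, ← sub_eq_zero, ← integral_sub (hi g hg ξ) (hi (fun x => - g x) hg.neg ξ), ← h ξ]
    congr 1; ext x
    rw [← sub_mul]; congr 1
    rw [← Complex.ofReal_sub]; congr 1
    rcases le_total (g x) 0 with h | h
    · rw [max_eq_right h, max_eq_left (by linarith)]; ring
    · rw [max_eq_left h, max_eq_right (by linarith)]; ring
  have e2 := congrArg (fun m => m.map fun z : E => c + (‖z‖ ^ 2)⁻¹ • z) e1
  have hm : Measurable fun z : E => c + (‖z‖ ^ 2)⁻¹ • z := by fun_prop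
  rw [Measure.map_map hm hkm, Measure.map_map hm hkm, show (fun z : E => c + (‖z‖ ^ 2)⁻¹ • z) ∘ kap c = id from funext fun x => kap_inv c x,
    Measure.map_id, Measure.map_id, withDensity_eq_iff hg.1.aemeasurable.ennreal_ofReal (show AEMeasurable (fun x => ENNReal.ofReal (- g x)) volume from hg.neg.1.aemeasurable.ennreal_ofReal)] at e2
  · filter_upwards [e2] with x hx
    rcases le_total (g x) 0 with h | h
    · rw [ENNReal.ofReal_of_nonpos h] at hx
      have := ENNReal.ofReal_eq_zero.1 hx.symm
      simp; linarith
    · rw [ENNReal.ofReal_of_nonpos (by linarith : - g x ≤ 0)] at hx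
      have := ENNReal.ofReal_eq_zero.1 hx
      simp; linarith
  · exact ((lintegral_ofReal_le_lintegral_enorm g).trans_lt hg.2).ne
lemma exists_perp (hn : 2 ≤ Module.finrank ℝ E) (e : E) : ∃ η : E, ‖η‖ = 1 ∧ inner ℝ e η = 0 := by
  have h1 := Submodule.finrank_add_finrank_orthogonal (ℝ ∙ e)
  have h2 := (finrank_span_le_card (R := ℝ) {e}).trans (by simp : _ ≤ 1)
  have h3 : (ℝ ∙ e)ᗮ ≠ ⊥ := by
    intro h; rw [h, finrank_bot] at h1; omega
  obtain ⟨w, hw, hw0⟩ := Submodule.exists_mem_ne_zero_of_ne_bot h3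
  have h4 := Submodule.mem_orthogonal_singleton_iff_inner_right.1 hw
  exact ⟨‖w‖⁻¹ • w, by rw [norm_smul, norm_inv, norm_norm]; exact inv_mul_cancel₀ (norm_ne_zero_iff.2 hw0), by rw [inner_smul_right, h4, mul_zero]⟩
lemma lemX (hn : 2 ≤ Module.finrank ℝ E) {c e : E} (he : ‖e‖ = 1) {φ0 c1 : ℝ} (hc1 : 0 < c1) {g : E → ℝ} (hg : Integrable g volume)
    (hφ : ∀ x, g x ≠ 0 → inner ℝ e (kap c x) ≤ φ0)
    (h : ∀ η : E, ‖η‖ = 1 → inner ℝ e η = 0 → ∀ s θ : ℝ, ∃ C l0 : ℝ, ∀ l, l0 ≤ l →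
      |∫ x, g x * (Real.exp (l * inner ℝ e (kap c x)) * Real.cos (s * inner ℝ η (kap c x) + θ))| ≤ C * Real.exp (l * (φ0 - c1))) :
    ∀ᵐ x, φ0 - c1 < inner ℝ e (kap c x) → g x = 0 := by
  have hkm := kap_meas c
  set T : E → ℝ := fun x => inner ℝ e (kap c x) - φ0 with hT
  have hTm : Measurable T := by fun_prop
  have hmS : MeasurableSet {x | -c1 < T x} := measurableSet_lt measurable_const hTm
  have main : ∀ η : E, ‖η‖ = 1 → inner ℝ e η = 0 → ∀ s τ : ℝ, ∫ x, (({x | -c1 < T x}.indicator g x : ℝ) : ℂ) * Complex.exp (inner ℝ (kap c x) (τ • e + s • η) * Complex.I) = 0 := by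
    intro η hη heη s τ
    obtain ⟨C, l0, hC⟩ := h η hη heη s 0
    obtain ⟨C', l0', hC'⟩ := h η hη heη s (-(Real.pi / 2))
    have hGi : Integrable (fun x => (g x : ℂ) * Complex.exp ((s * inner ℝ η (kap c x) : ℝ) * Complex.I)) volume := by
      refine (hg.ofReal (𝕜 := ℂ)).mul_bdd (c := 1) (Measurable.aestronglyMeasurable (by fun_prop)) (Eventually.of_forall fun x => ?_)
      rw [Complex.norm_exp_ofReal_mul_I]
    have := oned (μ := volume) (G := fun x => (g x : ℂ) * Complex.exp ((s * inner ℝ η (kap c x) : ℝ) * Complex.I)) hGi hTm hc1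
      (fun x hx => by have := hφ x (fun h0 => hx (by simp [h0])); simp only [hT]; linarith) (C := C + C') (l0 := max (max l0 l0') 0) (fun l hl => ?_) τ
    · rw [← mul_zero (Complex.exp ((τ * φ0 : ℝ) * Complex.I)), ← this, ← integral_const_mul]
      congr 1; ext x
      by_cases hx : x ∈ {x | -c1 < T x}
      · rw [indicator_of_mem hx, indicator_of_mem hx, mul_assoc, mul_left_comm, ← Complex.exp_add, ← Complex.exp_add]
        congr 2
        rw [inner_add_right, inner_smul_right, inner_smul_right, real_inner_comm, real_inner_comm η]
        simp only [hT]; push_cast; ring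
      · rw [indicator_of_notMem hx, indicator_of_notMem hx]; simp
    · have hl0 : 0 ≤ l := (le_max_right _ _).trans hl
      have b1 := hC l (((le_max_left _ _).trans (le_max_left _ _)).trans hl)
      have b2 := hC' l (((le_max_right _ _).trans (le_max_left _ _)).trans hl)
      have hint : ∀ θ : ℝ, Integrable (fun x => g x * (Real.exp (l * inner ℝ e (kap c x)) * Real.cos (s * inner ℝ η (kap c x) + θ))) volume := by
        intro θ
        refine (hg.norm.mul_const (Real.exp (l * φ0))).mono' (hg.1.mul (Measurable.aestronglyMeasurable (by fun_prop))) (Eventually.of_forall fun x => ?_)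
        by_cases hx : g x = 0
        · simp [hx]
        · rw [norm_mul, norm_mul, Real.norm_of_nonneg (Real.exp_pos _).le]
          refine mul_le_mul_of_nonneg_left ?_ (norm_nonneg _)
          rw [← mul_one (Real.exp (l * φ0))]
          exact mul_le_mul (Real.exp_le_exp.2 (mul_le_mul_of_nonneg_left (hφ x hx) hl0)) (Real.abs_cos_le_one _) (norm_nonneg _) (Real.exp_pos _).le
      have hiC : ∀ θ : ℝ, Integrable (fun x => ((g x * (Real.exp (l * inner ℝ e (kap c x)) * Real.cos (s * inner ℝ η (kap c x) + θ)) : ℝ) : ℂ)) volume :=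
        fun θ => (hint θ).ofReal (𝕜 := ℂ)
      have e1 : ∫ x, (g x : ℂ) * Complex.exp ((s * inner ℝ η (kap c x) : ℝ) * Complex.I) * Complex.exp (l * T x) =
          Real.exp (-(l * φ0)) * (((∫ x, g x * (Real.exp (l * inner ℝ e (kap c x)) * Real.cos (s * inner ℝ η (kap c x) + 0)) : ℝ) : ℂ)
          + (∫ x, g x * (Real.exp (l * inner ℝ e (kap c x)) * Real.cos (s * inner ℝ η (kap c x) + -(Real.pi/2))) : ℝ) * Complex.I) := by
        rw [← integral_complex_ofReal, ← integral_complex_ofReal, ← integral_mul_const, ← integral_add (hiC 0) ((hiC (-(Real.pi / 2))).mul_const _),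
          ← integral_const_mul]
        congr 1; ext x
        rw [Complex.exp_mul_I, ← Complex.ofReal_cos, ← Complex.ofReal_sin, add_zero, ← sub_eq_add_neg, Real.cos_sub_pi_div_two,
          show (l : ℂ) * T x = ((-(l * φ0) + l * inner ℝ e (kap c x) : ℝ) : ℂ) by simp only [hT]; push_cast; ring, ← Complex.ofReal_exp, Real.exp_add]
        push_cast; ring
      rw [e1, norm_mul, Complex.norm_real, Real.norm_of_nonneg (Real.exp_pos _).le]
      calc _ ≤ Real.exp (-(l * φ0)) * (C * Real.exp (l * (φ0 - c1)) + C' * Real.exp (l * (φ0 - c1))) := by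
            refine mul_le_mul_of_nonneg_left ((norm_add_le _ _).trans (add_le_add ?_ ?_)) (Real.exp_pos _).le
            · rw [Complex.norm_real]; exact b1
            · rw [norm_mul, Complex.norm_I, mul_one, Complex.norm_real]; exact b2
        _ = (C + C') * (Real.exp (-(l * φ0)) * Real.exp (l * (φ0 - c1))) := by ring
        _ = _ := by rw [← Real.exp_add]; ring_nf
  have hz : {x | -c1 < T x}.indicator g =ᵐ[volume] 0 := by
    refine four (c := c) (hg.indicator hmS) fun ξ => ?_
    obtain ⟨η, s, hη, heη, hs⟩ : ∃ (η : E) (s : ℝ), ‖η‖ = 1 ∧ inner ℝ e η = 0 ∧ ξ = (inner ℝ e ξ) • e + s • η := by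
      by_cases h0 : ξ - (inner ℝ e ξ) • e = 0
      · obtain ⟨η, h1, h2⟩ := exists_perp hn e
        exact ⟨η, 0, h1, h2, by rw [zero_smul, add_zero]; exact sub_eq_zero.1 h0⟩
      · refine ⟨‖ξ - (inner ℝ e ξ : ℝ) • e‖⁻¹ • (ξ - (inner ℝ e ξ : ℝ) • e), ‖ξ - (inner ℝ e ξ : ℝ) • e‖, ?_, ?_, ?_⟩
        · rw [norm_smul, norm_inv, norm_norm]; exact inv_mul_cancel₀ (norm_ne_zero_iff.2 h0)
        · rw [inner_smul_right, inner_sub_right, inner_smul_right, real_inner_self_eq_norm_sq, he]; simp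
        · rw [smul_smul, mul_inv_cancel₀ (norm_ne_zero_iff.2 h0)]; simp
    rw [hs]
    exact main η hη heη s _
  filter_upwards [hz] with x hx hx2
  rwa [indicator_of_mem (by simp only [hT, mem_setOf_eq]; linarith)] at hx
def HL (x : E) (f : E → ℝ) (g : E) (l : ℝ) : Prop := ContDiffAt ℝ ∞ f x ∧ fderiv ℝ f x = innerSL ℝ g ∧ Δ f x = l
lemma HL.cl {x : E} {f : E → ℝ} {g : E} {l l' : ℝ} (h : HL x f g l) (e : l' = l) : HL x f g l' := e ▸ h
lemma sum_bi (b : OrthonormalBasis (Fin (Module.finrank ℝ E)) ℝ E) (g g' : E) :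
    ∑ i, inner ℝ g (b i) * inner ℝ g' (b i) = inner ℝ g g' := by
  rw [← b.sum_inner_mul_inner g g']
  exact Finset.sum_congr rfl fun i _ => by rw [real_inner_comm (b i) g']
lemma cda_fd {f : E → ℝ} {x : E} (h : ContDiffAt ℝ ∞ f x) (e : E) : DifferentiableAt ℝ (fun y => fderiv ℝ f y e) x :=
  ((h.fderiv_right (m := ∞) (by simp)).differentiableAt (by simp)).clm_apply (differentiableAt_const e)
lemma cda_ev {f : E → ℝ} {x : E} (h : ContDiffAt ℝ ∞ f x) : ∀ᶠ y in 𝓝 x, DifferentiableAt ℝ f y :=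
  ((contDiffAt_infty.1 h 1).eventually (by simp)).mono fun y hy => hy.differentiableAt (by simp)
lemma HL.mul {x : E} {f f' : E → ℝ} {g g' : E} {l l' : ℝ} (h : HL x f g l) (h' : HL x f' g' l') :
    HL x (fun y => f y * f' y) (f x • g' + f' x • g) (f x * l' + f' x * l + 2 * inner ℝ g g') := by
  obtain ⟨h1, h2, h3⟩ := h
  obtain ⟨h1', h2', h3'⟩ := h'
  have hd := h1.differentiableAt (by simp)
  have hd' := h1'.differentiableAt (by simp)
  refine ⟨h1.mul h1', ?_, ?_⟩
  · rw [(hd.hasFDerivAt.fun_mul hd'.hasFDerivAt).fderiv, h2, h2']; simp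
  · have b := stdOrthonormalBasis ℝ E
    rw [← h3, ← h3', lap_at (contDiffAt_infty.1 (h1.mul h1') 2) b, lap_at (contDiffAt_infty.1 h1 2) b, lap_at (contDiffAt_infty.1 h1' 2) b,
      ← sum_bi b, Finset.mul_sum, Finset.mul_sum, Finset.mul_sum, ← Finset.sum_add_distrib, ← Finset.sum_add_distrib]
    refine Finset.sum_congr rfl fun i _ => ?_
    have e1 : (fun y => fderiv ℝ (fun y => f y * f' y) y (b i)) =ᶠ[𝓝 x] fun y => f y * fderiv ℝ f' y (b i) + f' y * fderiv ℝ f y (b i) := by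
      filter_upwards [cda_ev h1, cda_ev h1'] with y hy hy'
      rw [(hy.hasFDerivAt.fun_mul hy'.hasFDerivAt).fderiv]; simp
    rw [e1.fderiv_eq, ((hd.hasFDerivAt.fun_mul (cda_fd h1' (b i)).hasFDerivAt).fun_add (hd'.hasFDerivAt.fun_mul (cda_fd h1 (b i)).hasFDerivAt)).fderiv]
    simp [h2, h2']; ring
lemma HL.comp {x : E} {f : E → ℝ} {g : E} {l : ℝ} (h : HL x f g l) {φ φ' : ℝ → ℝ} {φ'' : ℝ} (hφ : ContDiffAt ℝ ∞ φ (f x))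
    (hd : ∀ᶠ t in 𝓝 (f x), HasDerivAt φ (φ' t) t) (hd2 : HasDerivAt φ' φ'' (f x)) :
    HL x (fun y => φ (f y)) (φ' (f x) • g) (φ'' * inner ℝ g g + φ' (f x) * l) := by
  obtain ⟨h1, h2, h3⟩ := h
  have hdf := h1.differentiableAt (by simp)
  have h4 : ContDiffAt ℝ ∞ (fun y => φ (f y)) x := hφ.comp x h1
  refine ⟨h4, ?_, ?_⟩
  · have h5 : fderiv ℝ (fun y => φ (f y)) x = _ := (hd.self_of_nhds.comp_hasFDerivAt x hdf.hasFDerivAt).fderiv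
    rw [h5, h2]; simp
  · have b := stdOrthonormalBasis ℝ E
    rw [← h3, lap_at (contDiffAt_infty.1 h4 2) b, lap_at (contDiffAt_infty.1 h1 2) b,
      ← sum_bi b, Finset.mul_sum, Finset.mul_sum, ← Finset.sum_add_distrib]
    refine Finset.sum_congr rfl fun i _ => ?_
    have e1 : (fun y => fderiv ℝ (fun y => φ (f y)) y (b i)) =ᶠ[𝓝 x] fun y => φ' (f y) * fderiv ℝ f y (b i) := by
      filter_upwards [cda_ev h1, h1.continuousAt.eventually hd] with y hy hy'
      have h5 : fderiv ℝ (fun y => φ (f y)) y = _ := (hy'.comp_hasFDerivAt y hy.hasFDerivAt).fderiv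
      rw [h5]; simp
    have e2 : HasFDerivAt (fun y => φ' (f y)) _ x := hd2.comp_hasFDerivAt x hdf.hasFDerivAt
    rw [e1.fderiv_eq, (e2.fun_mul (cda_fd h1 (b i)).hasFDerivAt).fderiv]
    simp [h2]; ring
lemma HL.lin (a c x : E) : HL x (fun y => inner ℝ a (y - c)) a 0 := by
  have hf : ∀ y, fderiv ℝ (fun y => inner ℝ a (y - c)) y = innerSL ℝ a := by
    intro y
    have : HasFDerivAt (fun y => innerSL ℝ a (y - c)) _ y := (innerSL ℝ a).hasFDerivAt.comp y ((hasFDerivAt_id y).sub_const c)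
    simpa using this.fderiv
  have hc : ContDiff ℝ ∞ (fun y => inner ℝ a (y - c)) := contDiff_const.inner ℝ (contDiff_id.sub contDiff_const)
  refine ⟨hc.contDiffAt, hf x, ?_⟩
  rw [lap_at (contDiff_infty.1 hc 2).contDiffAt (stdOrthonormalBasis ℝ E)]
  simp [hf]
lemma HL.q (c x : E) : HL x (fun y => ‖y - c‖ ^ 2) ((2 : ℝ) • (x - c)) (2 * Module.finrank ℝ E) := by
  have hf : ∀ y, fderiv ℝ (fun y => ‖y - c‖ ^ 2) y = innerSL ℝ ((2 : ℝ) • (y - c)) := by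
    intro y
    have := (((hasFDerivAt_id y).sub_const c).norm_sq).fderiv
    simp only [id] at this
    rw [this]; ext v; simp [inner_smul_left]
  have hc : ContDiff ℝ ∞ (fun y : E => ‖y - c‖ ^ 2) := (contDiff_id.sub contDiff_const).norm_sq ℝ
  refine ⟨hc.contDiffAt, hf x, ?_⟩
  rw [lap_at (contDiff_infty.1 hc 2).contDiffAt (stdOrthonormalBasis ℝ E)]
  have : ∀ i, fderiv ℝ (fun y => fderiv ℝ (fun y => ‖y - c‖ ^ 2) y (stdOrthonormalBasis ℝ E i)) x (stdOrthonormalBasis ℝ E i) = 2 := by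
    intro i
    have e : (fun y => fderiv ℝ (fun y => ‖y - c‖ ^ 2) y (stdOrthonormalBasis ℝ E i)) = fun y => inner ℝ ((2 : ℝ) • stdOrthonormalBasis ℝ E i) (y - c) := by
      ext y; rw [hf, innerSL_apply_apply, inner_smul_left, inner_smul_left, real_inner_comm]
    rw [e, (HL.lin _ c x).2.1]; simp [inner_smul_left]
  simp [this]; ring
def KT (c a b : E) (θ : ℝ) (x : E) : ℝ :=
  (‖x - c‖ ^ 2) ^ ((2 - Module.finrank ℝ E : ℝ) / 2) * (Real.exp (inner ℝ a (kap c x)) * Real.cos (inner ℝ b (kap c x) + θ))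
lemma inner_kap (c a x : E) : inner ℝ a (kap c x) = inner ℝ a (x - c) * (‖x - c‖ ^ 2)⁻¹ := by
  rw [kap, inner_smul_right]; ring
lemma HL.A {c x : E} (hx : x ≠ c) (a : E) : HL x (fun y => inner ℝ a (kap c y))
    ((‖x - c‖ ^ 2)⁻¹ • a - (2 * inner ℝ a (x - c) * ((‖x - c‖ ^ 2)⁻¹) ^ 2) • (x - c))
    ((4 - 2 * Module.finrank ℝ E) * inner ℝ a (x - c) * ((‖x - c‖ ^ 2)⁻¹) ^ 2) := by
  have hq : ‖x - c‖ ^ 2 ≠ 0 := pow_ne_zero _ (norm_ne_zero_iff.2 (sub_ne_zero.2 hx))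
  have h1 := (HL.q c x).comp (φ := fun t => t⁻¹) (φ' := fun t => -(t ^ 2)⁻¹) (φ'' := 2 * ((‖x - c‖ ^ 2)⁻¹) ^ 3) (contDiffAt_inv ℝ hq)
    ((isOpen_ne.eventually_mem hq).mono fun t ht => hasDerivAt_inv ht) (by
      have : HasDerivAt (fun t : ℝ => -(t ^ 2)⁻¹) _ _ := ((hasDerivAt_pow 2 (‖x - c‖ ^ 2)).inv (pow_ne_zero 2 hq)).neg
      convert this using 1
      norm_num; field_simp)
  have h2 := (HL.lin a c x).mul h1
  simp only [← inner_kap] at h2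
  convert h2 using 1
  · rw [smul_smul, smul_smul, add_comm, sub_eq_add_neg, ← neg_smul]; congr 2; field_simp
  · simp only [inner_smul_left, inner_smul_right, real_inner_self_eq_norm_sq]
    simp
    field_simp
    ring
lemma HL.T {c x a b : E} (hx : x ≠ c) (hab : inner ℝ a b = 0) (θ : ℝ) : ∃ g, HL x (KT c a b θ) g ((‖a‖ ^ 2 - ‖b‖ ^ 2) * ((‖x - c‖ ^ 2)⁻¹) ^ 2 * KT c a b θ x) ∧
    ‖g‖ ≤ (|(2 - Module.finrank ℝ E : ℝ)| * (‖x - c‖ ^ 2) ^ ((2 - Module.finrank ℝ E : ℝ) / 2) * ‖x - c‖⁻¹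
      + 3 * (‖x - c‖ ^ 2) ^ ((2 - Module.finrank ℝ E : ℝ) / 2) * (‖x - c‖ ^ 2)⁻¹ * (‖a‖ + ‖b‖)) * Real.exp (inner ℝ a (kap c x)) := by
  have hX0 : 0 < ‖x - c‖ := norm_pos_iff.2 (sub_ne_zero.2 hx)
  have hq : 0 < ‖x - c‖ ^ 2 := by positivity
  set n : ℝ := ((Module.finrank ℝ E : ℕ) : ℝ) with hn
  set α : ℝ := (2 - n) / 2 with hα
  have h1 := (HL.q c x).comp (φ := fun t => t ^ α) (φ' := fun t => α * t ^ (α - 1)) (φ'' := α * ((α - 1) * (‖x - c‖ ^ 2) ^ (α - 1 - 1)))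
    (contDiffAt_id.rpow_const_of_ne hq.ne') ((isOpen_ne.eventually_mem hq.ne').mono fun t ht => Real.hasDerivAt_rpow_const (Or.inl ht))
    ((Real.hasDerivAt_rpow_const (Or.inl hq.ne')).const_mul α)
  have hA := HL.A hx a
  have hB := HL.A hx b
  have h2 := hA.comp (φ := Real.exp) (φ' := Real.exp) Real.contDiff_exp.contDiffAt (Eventually.of_forall fun t => Real.hasDerivAt_exp t) (Real.hasDerivAt_exp _)
  have h3 := hB.comp (φ := fun t => Real.cos (t + θ)) (φ' := fun t => - Real.sin (t + θ)) (φ'' := - Real.cos (inner ℝ b (kap c x) + θ))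
    (by fun_prop) (Eventually.of_forall fun t => by simpa using ((hasDerivAt_id t).add_const θ).cos)
    (by have := (((hasDerivAt_id (inner ℝ b (kap c x))).add_const θ).sin).neg
        rw [mul_one] at this; exact this)
  have h4 := h1.mul (h2.mul h3)
  have hw : 0 < (‖x - c‖ ^ 2) ^ α := Real.rpow_pos_of_pos hq _
  simp only [Real.rpow_sub_one hq.ne'] at h4
  refine ⟨_, h4.cl ?_, ?_⟩
  · have hba : inner ℝ b a = 0 := by rw [real_inner_comm]; exact hab
    have hXa : inner ℝ (x - c) a = inner ℝ a (x - c) := real_inner_comm _ _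
    have hXb : inner ℝ (x - c) b = inner ℝ b (x - c) := real_inner_comm _ _
    rw [KT, ← hn, ← hα]
    simp only [inner_smul_left, inner_smul_right, inner_sub_left _ _ ((2 * _ : ℝ) • _), inner_sub_left (_ • a), inner_sub_left (_ • b), inner_sub_right _ (_ • a), inner_sub_right _ (_ • b),
      inner_add_right, real_inner_self_eq_norm_sq, hab, hba, hXa, hXb, RCLike.conj_to_real]
    generalize inner ℝ a (x - c) = La
    generalize inner ℝ b (x - c) = Lb
    generalize (‖x - c‖ ^ 2) ^ α = w
    generalize ‖x - c‖ ^ 2 = Q at *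
    rw [hα]; field_simp; ring
  · have hg : ∀ v : E, ‖(‖x - c‖ ^ 2)⁻¹ • v - (2 * inner ℝ v (x - c) * ((‖x - c‖ ^ 2)⁻¹) ^ 2) • (x - c)‖ ≤ 3 * (‖x - c‖ ^ 2)⁻¹ * ‖v‖ := by
      intro v
      refine (norm_sub_le _ _).trans ?_
      rw [norm_smul, norm_smul, norm_mul, norm_mul, Real.norm_of_nonneg (by positivity : 0 ≤ (‖x - c‖ ^ 2)⁻¹), Real.norm_of_nonneg (by positivity : 0 ≤ ((‖x - c‖ ^ 2)⁻¹) ^ 2)]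
      have := norm_inner_le_norm (𝕜 := ℝ) v (x - c)
      calc _ ≤ (‖x - c‖ ^ 2)⁻¹ * ‖v‖ + ‖(2 : ℝ)‖ * (‖v‖ * ‖x - c‖) * ((‖x - c‖ ^ 2)⁻¹) ^ 2 * ‖x - c‖ := by gcongr
        _ = _ := by norm_num; field_simp; ring
    have he := Real.exp_pos (inner ℝ a (kap c x))
    have hs := Real.abs_sin_le_one (inner ℝ b (kap c x) + θ)
    have hc := Real.abs_cos_le_one (inner ℝ b (kap c x) + θ)
    calc _ ≤ (‖x - c‖ ^ 2) ^ α * (Real.exp (inner ℝ a (kap c x)) * (1 * (3 * (‖x - c‖ ^ 2)⁻¹ * ‖b‖)) + 1 * (Real.exp (inner ℝ a (kap c x)) * (3 * (‖x - c‖ ^ 2)⁻¹ * ‖a‖)))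
          + (Real.exp (inner ℝ a (kap c x)) * 1) * (|α| * ((‖x - c‖ ^ 2) ^ α / ‖x - c‖ ^ 2) * (2 * ‖x - c‖)) := by
          refine (norm_add_le _ _).trans (add_le_add ?_ ?_)
          · rw [norm_smul, Real.norm_of_nonneg hw.le]
            refine mul_le_mul_of_nonneg_left ((norm_add_le _ _).trans (add_le_add ?_ ?_)) hw.le
            · rw [norm_smul, norm_smul, Real.norm_of_nonneg he.le, norm_neg]
              gcongr; exacts [hs, hg b]
            · rw [norm_smul, norm_smul, Real.norm_of_nonneg he.le]
              gcongr; exacts [hc, hg a]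
          · rw [norm_smul, norm_smul, norm_smul, norm_mul, norm_mul, Real.norm_of_nonneg he.le, Real.norm_of_nonneg (div_pos hw hq).le, Real.norm_two]
            gcongr; exacts [hc, le_rfl]
      _ = _ := by
          rw [hα, abs_div, abs_two]; field_simp; ring
lemma KT_bd {c : E} {χ : E → ℝ} (hχ : ContDiff ℝ ∞ χ) (hcs : HasCompactSupport χ) (hc : c ∉ tsupport χ) :
    ∃ C : ℝ, 0 ≤ C ∧ ∀ (a b : E) (θ : ℝ), inner ℝ a b = 0 → (fun x => χ x * KT c a b θ x) ∈ TF (tsupport χ) ∧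
      (∀ x, |χ x * KT c a b θ x| ≤ C * Real.exp (inner ℝ a (kap c x))) ∧
      (∀ x, |Δ (fun x => χ x * KT c a b θ x) x - χ x * ((‖a‖ ^ 2 - ‖b‖ ^ 2) * ((‖x - c‖ ^ 2)⁻¹) ^ 2 * KT c a b θ x)| ≤ C * (1 + ‖a‖ + ‖b‖) * Real.exp (inner ℝ a (kap c x))) ∧
      ∀ x, Δ (fun x => χ x * KT c a b θ x) x ≠ χ x * ((‖a‖ ^ 2 - ‖b‖ ^ 2) * ((‖x - c‖ ^ 2)⁻¹) ^ 2 * KT c a b θ x) → ¬ ∃ k, χ =ᶠ[𝓝 x] fun _ => k := by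
  have hK : IsCompact (tsupport χ) := hcs
  have hne : ∀ x ∈ tsupport χ, x ≠ c := fun x hx h => hc (h ▸ hx)
  have hnz : ∀ x ∈ tsupport χ, ‖x - c‖ ≠ 0 := fun x hx => norm_ne_zero_iff.2 (sub_ne_zero.2 (hne x hx))
  have bd : ∀ f : E → ℝ, ContinuousOn f (tsupport χ) → ∃ C, 0 ≤ C ∧ ∀ x ∈ tsupport χ, |f x| ≤ C := by
    intro f hf
    obtain ⟨C, hC⟩ := hK.exists_bound_of_continuousOn hf
    exact ⟨max C 0, le_max_right _ _, fun x hx => (hC x hx).trans (le_max_left _ _)⟩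
  set α : ℝ := (2 - Module.finrank ℝ E : ℝ) / 2 with hα
  have c0 : ContinuousOn (fun x => (‖x - c‖ ^ 2) ^ α) (tsupport χ) :=
    ContinuousOn.rpow_const (by fun_prop) fun x hx => Or.inl (pow_ne_zero _ (hnz x hx))
  obtain ⟨M0, p0, h0⟩ := bd _ c0
  obtain ⟨M1, p1, h1⟩ := bd (fun x => |(2 - Module.finrank ℝ E : ℝ)| * (‖x - c‖ ^ 2) ^ α * ‖x - c‖⁻¹)
    ((continuousOn_const.mul c0).mul (ContinuousOn.inv₀ (by fun_prop) hnz))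
  obtain ⟨M2, p2, h2⟩ := bd (fun x => 3 * (‖x - c‖ ^ 2) ^ α * (‖x - c‖ ^ 2)⁻¹)
    ((continuousOn_const.mul c0).mul (ContinuousOn.inv₀ (by fun_prop) fun x hx => pow_ne_zero _ (hnz x hx)))
  obtain ⟨N0, q0, k0⟩ := bd χ hχ.continuous.continuousOn
  obtain ⟨N1, q1, k1⟩ := bd (fun x => ‖fderiv ℝ χ x‖) (hχ.continuous_fderiv (by simp)).norm.continuousOn
  obtain ⟨N2, q2, k2⟩ := bd (Δ χ) (contDiff_lap hχ).continuous.continuousOn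
  have hχL : ∀ x, ∃ g, HL x χ g (Δ χ x) ∧ ‖g‖ = ‖fderiv ℝ χ x‖ := fun x =>
    ⟨(toDual ℝ E).symm (fderiv ℝ χ x), ⟨hχ.contDiffAt, ((toDual ℝ E).apply_symm_apply _).symm, rfl⟩, LinearIsometryEquiv.norm_map _ _⟩
  refine ⟨max (N0 * M0) (M0 * N2 + 2 * (N1 * (M1 + M2))), le_max_of_le_left (by positivity), fun a b θ hab => ?_⟩
  have hTb : ∀ x ∈ tsupport χ, |KT c a b θ x| ≤ M0 * Real.exp (inner ℝ a (kap c x)) := by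
    intro x hx
    rw [KT, abs_mul, abs_mul, abs_of_pos (Real.exp_pos _)]
    have := Real.abs_cos_le_one (inner ℝ b (kap c x) + θ)
    have := h0 x hx
    calc _ ≤ M0 * (Real.exp (inner ℝ a (kap c x)) * 1) := by gcongr
      _ = _ := by ring
  have hoff : ∀ x, x ∉ tsupport χ → Δ (fun x => χ x * KT c a b θ x) x = 0 := fun x hx =>
    image_eq_zero_of_notMem_tsupport fun h => hx (tsupport_mul_subset_left (tsupport_lap _ h))
  have hon : ∀ x ∈ tsupport χ, ∃ g g', HL x χ g (Δ χ x) ∧ ‖g‖ ≤ N1 ∧ ‖g'‖ ≤ (M1 + M2 * (‖a‖ + ‖b‖)) * Real.exp (inner ℝ a (kap c x)) ∧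
      Δ (fun x => χ x * KT c a b θ x) x - χ x * ((‖a‖ ^ 2 - ‖b‖ ^ 2) * ((‖x - c‖ ^ 2)⁻¹) ^ 2 * KT c a b θ x) = KT c a b θ x * Δ χ x + 2 * inner ℝ g g' := by
    intro x hx
    obtain ⟨g, hg, hgn⟩ := hχL x
    obtain ⟨g', hg', hgn'⟩ := HL.T (hne x hx) hab θ
    refine ⟨g, g', hg, ?_, hgn'.trans ?_, ?_⟩
    · rw [hgn]; exact (le_abs_self _).trans (k1 x hx)
    · have := (le_abs_self _).trans (h1 x hx)
      have := (le_abs_self _).trans (h2 x hx)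
      gcongr
    · rw [(hg.mul hg').2.2]; ring
  refine ⟨⟨?_, hcs.mul_right, tsupport_mul_subset_left⟩, fun x => ?_, fun x => ?_, fun x hx => ?_⟩
  · rw [contDiff_iff_contDiffAt]
    intro x
    by_cases hx : x ∈ tsupport χ
    · obtain ⟨g, hg, -⟩ := HL.T (hne x hx) hab θ
      exact hχ.contDiffAt.mul hg.1
    · refine contDiffAt_const (c := 0) |>.congr_of_eventuallyEq ?_
      filter_upwards [(isClosed_tsupport χ).isOpen_compl.mem_nhds hx] with y hy
      rw [image_eq_zero_of_notMem_tsupport hy, zero_mul]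
  · by_cases hx : x ∈ tsupport χ
    · rw [abs_mul]
      calc _ ≤ N0 * (M0 * Real.exp (inner ℝ a (kap c x))) := mul_le_mul (k0 x hx) (hTb x hx) (abs_nonneg _) q0
        _ = (N0 * M0) * Real.exp (inner ℝ a (kap c x)) := by ring
        _ ≤ _ := by gcongr; exact le_max_left _ _
    · rw [image_eq_zero_of_notMem_tsupport hx, zero_mul, abs_zero]; positivity
  · by_cases hx : x ∈ tsupport χ
    · obtain ⟨g, g', -, hg, hg', he⟩ := hon x hx
      rw [he]
      have h5 := hTb x hx
      have h6 := k2 x hx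
      calc _ ≤ |KT c a b θ x| * |Δ χ x| + 2 * (‖g‖ * ‖g'‖) := by
            refine (abs_add_le _ _).trans ?_
            rw [abs_mul, abs_mul, abs_two]
            gcongr; exact abs_real_inner_le_norm g g'
        _ ≤ (M0 * Real.exp (inner ℝ a (kap c x))) * N2 + 2 * (N1 * ((M1 + M2 * (‖a‖ + ‖b‖)) * Real.exp (inner ℝ a (kap c x)))) := by gcongr
        _ = (M0 * N2 + 2 * (N1 * (M1 + M2 * (‖a‖ + ‖b‖)))) * Real.exp (inner ℝ a (kap c x)) := by ring
        _ ≤ ((M0 * N2 + 2 * (N1 * (M1 + M2))) * (1 + ‖a‖ + ‖b‖)) * Real.exp (inner ℝ a (kap c x)) := by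
            gcongr
            have ha := norm_nonneg a
            have hb := norm_nonneg b
            have e : (M0 * N2 + 2 * (N1 * (M1 + M2))) * (1 + ‖a‖ + ‖b‖) - (M0 * N2 + 2 * (N1 * (M1 + M2 * (‖a‖ + ‖b‖)))) =
              (M0 * N2 + 2 * (N1 * M1)) * (‖a‖ + ‖b‖) + 2 * (N1 * M2) := by ring
            have : 0 ≤ (M0 * N2 + 2 * (N1 * M1)) * (‖a‖ + ‖b‖) + 2 * (N1 * M2) := by positivity
            linarith
        _ ≤ _ := by gcongr; exact le_max_right _ _
    · rw [image_eq_zero_of_notMem_tsupport hx, hoff x hx, zero_mul, sub_zero, abs_zero]; positivity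
  · rintro ⟨k, hk⟩
    apply hx
    by_cases hxt : x ∈ tsupport χ
    · obtain ⟨g, g', hg1, -, -, he⟩ := hon x hxt
      rw [← sub_eq_zero, he]
      have e1 : g = 0 := by
        have : innerSL ℝ g = 0 := by rw [← hg1.2.1, hk.fderiv_eq]; simp
        have h3 := congrArg (fun L => L g) this
        simpa using h3
      have e2 : Δ χ x = 0 := by
        rw [(laplacian_congr_nhds hk).self_of_nhds, lap_at contDiffAt_const (stdOrthonormalBasis ℝ E)]; simp
      rw [e1, e2]; simp
    · rw [image_eq_zero_of_notMem_tsupport hxt, hoff x hxt, zero_mul]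
lemma geom {S O : Set E} (hS : IsOpen S) (hSc : IsPreconnected S) (hO : IsOpen O) (hOS : O ⊆ S) (hne : O.Nonempty) (hOS' : O ≠ S) :
    ∃ (c e p : E) (φ0 c0 t : ℝ) (χ : E → ℝ), ‖e‖ = 1 ∧ 0 < c0 ∧ 0 < t ∧ p ∈ S ∧ p ∉ O ∧ p ∈ closure O ∧ p ≠ c ∧ inner ℝ e (kap c p) = φ0 ∧
      ContDiff ℝ ∞ χ ∧ HasCompactSupport χ ∧ tsupport χ ⊆ S ∧ c ∉ tsupport χ ∧ (∀ x ∈ Metric.ball p t, χ x = 1) ∧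
      (∀ x, x ∉ O → inner ℝ e (kap c x) ≤ φ0) ∧
      (∀ x, x ∉ O → (¬ ∃ k, χ =ᶠ[𝓝 x] fun _ => k) → inner ℝ e (kap c x) ≤ φ0 - c0) := by
  obtain ⟨z, hzS, hzO⟩ : ∃ z ∈ S, z ∉ O := by
    by_contra! h; exact hOS' (hOS.antisymm h)
  obtain ⟨y, hyS, hyf⟩ : (S ∩ frontier O).Nonempty := by
    by_contra h
    rw [not_nonempty_iff_eq_empty] at h
    have := hSc.subset_of_closure_inter_subset hO (by obtain ⟨w, hw⟩ := hne; exact ⟨w, hOS hw, hw⟩) (fun w hw => by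
      by_contra hwO
      have : w ∈ S ∩ frontier O := ⟨hw.2, by rw [hO.frontier_eq]; exact ⟨hw.1, hwO⟩⟩
      rw [h] at this; exact this)
    exact hzO (this hzS)
  obtain ⟨s, hs, hsS⟩ := Metric.isOpen_iff.1 hS y hyS
  obtain ⟨c, hcO, hcy⟩ := Metric.mem_closure_iff.1 (frontier_subset_closure hyf) (s / 2) (by positivity)
  have hyO : y ∉ O := by rw [hO.frontier_eq] at hyf; exact hyf.2
  obtain ⟨p, hpO, hpd⟩ := hO.isClosed_compl.exists_infDist_eq_dist ⟨y, hyO⟩ c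
  have hmin : ∀ x, x ∉ O → ‖p - c‖ ≤ ‖x - c‖ := by
    intro x hx
    have := Metric.infDist_le_dist_of_mem (x := c) (s := Oᶜ) (y := x) hx
    rw [hpd, dist_comm, dist_comm c, dist_eq_norm, dist_eq_norm] at this; exact this
  have hpc : p ≠ c := fun h => hpO (h ▸ hcO)
  have hr : 0 < ‖p - c‖ := norm_pos_iff.2 (sub_ne_zero.2 hpc)
  have hpcl : p ∈ closure O := by
    have h1 : Metric.ball c ‖p - c‖ ⊆ O := fun x hx => by
      by_contra hh
      rw [Metric.mem_ball, dist_eq_norm] at hx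
      exact absurd (hmin x hh) (not_le.2 hx)
    refine closure_mono h1 ?_
    rw [closure_ball c hr.ne', Metric.mem_closedBall, dist_eq_norm]
  have hpS : p ∈ S := hsS (by
    have h1 := hmin y hyO
    rw [dist_eq_norm] at hcy
    rw [Metric.mem_ball, dist_eq_norm]
    calc ‖p - y‖ ≤ ‖p - c‖ + ‖c - y‖ := norm_sub_le_norm_sub_add_norm_sub _ _ _
      _ < s := by rw [norm_sub_rev c y]; linarith)
  obtain ⟨u, hu, huS⟩ := Metric.isOpen_iff.1 hS p hpS
  set t := min (u / 4) (‖p - c‖ / 4) with ht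
  have ht0 : 0 < t := by positivity
  have ht1 : t ≤ u / 4 := min_le_left _ _
  have ht2 : t ≤ ‖p - c‖ / 4 := min_le_right _ _
  let χ : ContDiffBump p := ⟨t, 2 * t, ht0, by linarith⟩
  have hχt : tsupport χ = Metric.closedBall p (2 * t) := χ.tsupport_eq
  have hin : ∀ x, inner ℝ (‖p - c‖⁻¹ • (p - c)) (kap c x) = inner ℝ (p - c) (x - c) / (‖p - c‖ * ‖x - c‖ ^ 2) := by
    intro x; rw [inner_kap, inner_smul_left]; simp; field_simp
  have hlt : ∀ x, x ∉ O → x ≠ p → inner ℝ (‖p - c‖⁻¹ • (p - c)) (kap c x) < ‖p - c‖⁻¹ := by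
    intro x hx hxp
    have h1 := hmin x hx
    have h2 : 0 < ‖x - c‖ := hr.trans_le h1
    rw [hin, div_lt_iff₀ (by positivity)]
    have h3 : 0 < ‖(p - c) - (x - c)‖ := norm_pos_iff.2 (by rw [sub_sub_sub_cancel_right]; exact sub_ne_zero.2 hxp.symm)
    have h4 := norm_sub_sq_real (p - c) (x - c)
    have h5 : ‖p - c‖⁻¹ * (‖p - c‖ * ‖x - c‖ ^ 2) = ‖x - c‖ ^ 2 := by field_simp
    rw [h5]
    nlinarith
  have hpp : inner ℝ (‖p - c‖⁻¹ • (p - c)) (kap c p) = ‖p - c‖⁻¹ := by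
    rw [hin, real_inner_self_eq_norm_sq]; field_simp
  have hA : IsCompact ((Metric.closedBall p (2 * t) \ Metric.ball p t) \ O) :=
    ((isCompact_closedBall p _).diff Metric.isOpen_ball).diff hO
  have hcont : ContinuousOn (fun x => inner ℝ (‖p - c‖⁻¹ • (p - c)) (kap c x)) ((Metric.closedBall p (2 * t) \ Metric.ball p t) \ O) := by
    unfold kap
    refine continuousOn_const.inner ((ContinuousOn.inv₀ (by fun_prop) fun x hx => ?_).smul (by fun_prop))
    exact pow_ne_zero _ (hr.trans_le (hmin x hx.2)).ne'
  obtain ⟨c0, hc0, hc0'⟩ : ∃ c0 > 0, ∀ x ∈ (Metric.closedBall p (2 * t) \ Metric.ball p t) \ O, inner ℝ (‖p - c‖⁻¹ • (p - c)) (kap c x) ≤ ‖p - c‖⁻¹ - c0 := by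
    rcases eq_empty_or_nonempty ((Metric.closedBall p (2 * t) \ Metric.ball p t) \ O) with h | h
    · exact ⟨1, one_pos, fun x hx => by rw [h] at hx; exact hx.elim⟩
    · obtain ⟨x1, hx1, hm⟩ := hA.exists_isMaxOn h hcont
      refine ⟨‖p - c‖⁻¹ - inner ℝ (‖p - c‖⁻¹ • (p - c)) (kap c x1), sub_pos.2 (hlt x1 hx1.2 fun h => hx1.1.2 (h ▸ Metric.mem_ball_self ht0)), fun x hx => ?_⟩
      have := hm hx
      simp only [mem_setOf_eq] at this
      linarith
  refine ⟨c, ‖p - c‖⁻¹ • (p - c), p, ‖p - c‖⁻¹, c0, t, χ, ?_, hc0, ht0, hpS, hpO, hpcl, hpc, hpp, χ.contDiff, χ.hasCompactSupport, ?_, ?_, ?_, ?_, ?_⟩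
  · rw [norm_smul, norm_inv, norm_norm]; exact inv_mul_cancel₀ hr.ne'
  · rw [hχt]; exact (Metric.closedBall_subset_ball (by linarith)).trans huS
  · rw [hχt, Metric.mem_closedBall, dist_comm, dist_eq_norm]; linarith
  · exact fun x hx => χ.one_of_mem_closedBall (Metric.ball_subset_closedBall hx)
  · intro x hx
    by_cases hxp : x = p
    · rw [hxp, hpp]
    · exact (hlt x hx hxp).le
  · intro x hx hk
    refine hc0' x ⟨⟨?_, fun hb => hk ⟨1, ?_⟩⟩, hx⟩
    · by_contra hb
      refine hk ⟨0, ?_⟩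
      filter_upwards [Metric.isClosed_closedBall.isOpen_compl.mem_nhds hb] with w hw
      exact image_eq_zero_of_notMem_tsupport (by rw [hχt]; exact hw)
    · filter_upwards [Metric.isOpen_ball.mem_nhds hb] with w hw
      exact χ.one_of_mem_closedBall (Metric.ball_subset_closedBall hw)
def ZO (f : E → ℝ) : Set E := ⋃₀ {U | IsOpen U ∧ ∀ᵐ y, y ∈ U → f y = 0}
lemma ZO_open (f : E → ℝ) : IsOpen (ZO f) := isOpen_sUnion fun U hU => hU.1
lemma ZO_sub {f : E → ℝ} {U : Set E} (hU : IsOpen U) (h : ∀ᵐ y, y ∈ U → f y = 0) : U ⊆ ZO f := subset_sUnion_of_mem ⟨hU, h⟩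
lemma ZO_ae (f : E → ℝ) : ∀ᵐ y, y ∈ ZO f → f y = 0 := by
  obtain ⟨T, hT, hTs, hTu⟩ := TopologicalSpace.isOpen_sUnion_countable {U | IsOpen U ∧ ∀ᵐ y, y ∈ U → f y = 0} fun U hU => hU.1
  have : ∀ᵐ y, ∀ U ∈ T, y ∈ U → f y = 0 := (ae_ball_iff hT).2 fun U hU => (hTs hU).2
  filter_upwards [this] with y hy hyZ
  rw [ZO, ← hTu] at hyZ
  obtain ⟨U, hU, hyU⟩ := hyZ
  exact hy U hU hyU
lemma near_p {c e p : E} {φ0 c1 t : ℝ} (hc1 : 0 < c1) (ht : 0 < t) (hpc : p ≠ c) (hp : inner ℝ e (kap c p) = φ0) :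
    ∃ U, IsOpen U ∧ p ∈ U ∧ U ⊆ Metric.ball p t ∧ ∀ x ∈ U, x ≠ c ∧ φ0 - c1 < inner ℝ e (kap c x) := by
  have hc : ContinuousAt (fun x => inner ℝ e (kap c x)) p := by
    have h0 : ContinuousAt (fun x : E => (‖x - c‖ ^ 2)⁻¹) p :=
      ContinuousAt.inv₀ (f := fun x : E => ‖x - c‖ ^ 2) (by fun_prop) (pow_ne_zero _ (norm_ne_zero_iff.2 (sub_ne_zero.2 hpc)))
    have h1 : ContinuousAt (fun x : E => x - c) p := by fun_prop
    exact continuousAt_const.inner (h0.smul h1)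
  have h1 : ∀ᶠ x in 𝓝 p, φ0 - c1 < inner ℝ e (kap c x) := hc.eventually (lt_mem_nhds (by simp only [hp]; linarith))
  obtain ⟨U, hU, hUo, hpU⟩ := mem_nhds_iff.1 (inter_mem (inter_mem (Metric.ball_mem_nhds p ht) (isOpen_ne.mem_nhds hpc)) h1)
  exact ⟨U, hUo, hpU, fun x hx => (hU hx).1.1, fun x hx => ⟨(hU hx).1.2, (hU hx).2⟩⟩
lemma uc (hn : 2 ≤ Module.finrank ℝ E) {W B : Set E} (hW : IsOpen W) (hWc : IsPreconnected W) {q : E → ℝ} (hq : MemLp q 2 volume)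
    (h : ∀ ψ ∈ TF W, ∫ x, q x * Δ ψ x = 0) (hBo : IsOpen B) (hBn : B.Nonempty) (hBW : B ⊆ W) (hB : ∀ᵐ x, x ∈ B → q x = 0) :
    ∀ᵐ x, x ∈ W → q x = 0 := by
  set O := W ∩ ZO q with hOdef
  have hOo : IsOpen O := hW.inter (ZO_open q)
  have hqO : ∀ᵐ x, x ∈ O → q x = 0 := (ZO_ae q).mono fun x hx h => hx h.2
  by_cases hOW : O = W
  · rwa [hOW] at hqO
  exfalso
  obtain ⟨c, e, p, φ0, c0, t, χ, he, hc0, ht, hpW, hpO, -, hpc, hpφ, hχ, hcs, hχW, hcχ, hχ1, hφ, hφ'⟩ :=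
    geom hW hWc hOo inter_subset_left (by obtain ⟨b, hb⟩ := hBn; exact ⟨b, hBW hb, ZO_sub hBo hB hb⟩) hOW
  obtain ⟨C, hC, hKT⟩ := KT_bd hχ hcs hcχ
  set α : ℝ := (2 - Module.finrank ℝ E : ℝ) / 2 with hα
  set q1 := (tsupport χ).indicator q with hq1
  have hq1i : Integrable q1 volume :=
    (((hq.locallyIntegrable (by norm_num)).integrableOn_isCompact hcs).integrable_indicator (isClosed_tsupport χ).measurableSet)
  have hq1e : ∀ x, χ x ≠ 0 → q1 x = q x := fun x hx => indicator_of_mem (subset_tsupport χ hx) q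
  obtain ⟨d, hd, hdb⟩ := Metric.isOpen_iff.1 (isClosed_tsupport χ).isOpen_compl c hcχ
  set m : E → ℝ := fun x => ((‖x - c‖ ^ 2)⁻¹) ^ 2 * (χ x * KT c 0 0 0 x) with hm
  have hKT0 : ∀ x, KT c 0 0 0 x = (‖x - c‖ ^ 2) ^ α := by intro x; simp [KT, hα]
  have hχm : Measurable χ := hχ.continuous.measurable
  have hmm : Measurable m := by simp only [hm, hKT0]; fun_prop
  have hmb : ∀ x, ‖m x‖ ≤ ((d ^ 2)⁻¹) ^ 2 * C := by
    intro x
    by_cases hx : χ x = 0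
    · simp only [hm, hx, zero_mul, mul_zero, norm_zero]; positivity
    · have h1 : d ≤ ‖x - c‖ := by
        by_contra! hl
        exact hdb (by rw [Metric.mem_ball, dist_eq_norm]; exact hl) (subset_tsupport χ hx)
      have h2 := (hKT 0 0 0 (by simp)).2.1 x
      rw [inner_zero_left, Real.exp_zero, mul_one] at h2
      rw [norm_mul, Real.norm_of_nonneg (by positivity), Real.norm_eq_abs]
      gcongr
  set g := Oᶜ.indicator (fun x => q1 x * m x) with hg
  have hgi : Integrable g volume := (hq1i.mul_bdd hmm.aestronglyMeasurable (Eventually.of_forall hmb)).indicator hOo.measurableSet.compl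
  have hgae : ∀ᵐ x, g x = q x * m x := by
    filter_upwards [hqO] with x hx
    by_cases hxO : x ∈ O
    · rw [hg, indicator_of_notMem (by simpa using hxO), hx hxO, zero_mul]
    · rw [hg, indicator_of_mem hxO]
      by_cases hx : χ x = 0
      · simp [hm, hx]
      · rw [hq1e x hx]
  have key := lemX hn he hc0 hgi (fun x hx => hφ x fun hxO => hx (by rw [hg, indicator_of_notMem (by simpa using hxO)])) (c := c) ?_
  · obtain ⟨U, hU, hpU, hUt, hUc⟩ := near_p (c1 := c0) hc0 ht hpc hpφ
    refine hpO ⟨hpW, ZO_sub hU ?_ hpU⟩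
    filter_upwards [key, hgae] with x hx hx2 hxU
    have h1 := hx (hUc x hxU).2
    rw [hx2] at h1
    refine (mul_eq_zero.1 h1).resolve_right ?_
    have hn0 : 0 < ‖x - c‖ := norm_pos_iff.2 (sub_ne_zero.2 (hUc x hxU).1)
    simp only [hm, hKT0, hχ1 x (hUt hxU)]
    have := Real.rpow_pos_of_pos (pow_pos hn0 2) α
    positivity
  · intro η hη heη s θ
    have hK0 : 0 ≤ ∫ x, ‖q1 x‖ := integral_nonneg fun x => norm_nonneg _
    refine ⟨2 * C * ∫ x, ‖q1 x‖, |s| + 1, fun l hl => ?_⟩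
    have hs := abs_nonneg s
    have hab : inner ℝ (l • e) (s • η) = 0 := by rw [inner_smul_left, inner_smul_right, heη]; simp
    obtain ⟨k1, -, k3, k4⟩ := hKT (l • e) (s • η) θ hab
    set ψ : E → ℝ := fun x => χ x * KT c (l • e) (s • η) θ x with hψ
    have hψW : ψ ∈ TF W := ⟨k1.1, k1.2.1, k1.2.2.trans hχW⟩
    have hna : ‖l • e‖ = l := by rw [norm_smul, he, mul_one]; exact abs_of_nonneg (by linarith)
    have hnb : ‖s • η‖ = |s| := by rw [norm_smul, hη, mul_one]; rfl
    rw [hna, hnb, sq_abs] at k4 k3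
    by_cases hi : Integrable (fun x => g x * (Real.exp (l * inner ℝ e (kap c x)) * Real.cos (s * inner ℝ η (kap c x) + θ))) volume
    swap
    · rw [integral_undef hi, abs_zero]; positivity
    have hi2 : Integrable (fun x => q x * Δ ψ x) volume := hq.integrable_mul (memLp_cs (contDiff_lap k1.1).continuous (lap_mem hψW).2.1)
    have hls : l + |s| ≤ l ^ 2 - s ^ 2 := by rw [← sq_abs s]; nlinarith
    have e1 : (l ^ 2 - s ^ 2) * (∫ x, g x * (Real.exp (l * inner ℝ e (kap c x)) * Real.cos (s * inner ℝ η (kap c x) + θ))) =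
        - ∫ x, (q x * Δ ψ x - (l ^ 2 - s ^ 2) * (g x * (Real.exp (l * inner ℝ e (kap c x)) * Real.cos (s * inner ℝ η (kap c x) + θ)))) := by
      rw [integral_sub hi2 (hi.const_mul _), h ψ hψW, integral_const_mul]; ring
    have e2 : ‖∫ x, (q x * Δ ψ x - (l ^ 2 - s ^ 2) * (g x * (Real.exp (l * inner ℝ e (kap c x)) * Real.cos (s * inner ℝ η (kap c x) + θ))))‖
        ≤ ∫ x, ‖q1 x‖ * (C * (1 + l + |s|) * Real.exp (l * (φ0 - c0))) := by
      refine norm_integral_le_of_norm_le (hq1i.norm.mul_const _) ?_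
      filter_upwards [hgae, hqO] with x hx hxO
      have e3 : q x * Δ ψ x - (l ^ 2 - s ^ 2) * (g x * (Real.exp (l * inner ℝ e (kap c x)) * Real.cos (s * inner ℝ η (kap c x) + θ)))
          = q x * (Δ ψ x - χ x * ((l ^ 2 - s ^ 2) * ((‖x - c‖ ^ 2)⁻¹) ^ 2 * KT c (l • e) (s • η) θ x)) := by
        rw [hx]; simp only [hm, hKT0]; simp only [KT, inner_smul_left, RCLike.conj_to_real, ← hα]; ring
      rw [e3]
      have hr : 0 ≤ ‖q1 x‖ * (C * (1 + l + |s|) * Real.exp (l * (φ0 - c0))) := by have : 0 ≤ 1 + l + |s| := by linarith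
                                                                                  positivity
      by_cases hz : Δ ψ x = χ x * ((l ^ 2 - s ^ 2) * ((‖x - c‖ ^ 2)⁻¹) ^ 2 * KT c (l • e) (s • η) θ x)
      · rw [hz]; simpa using hr
      · by_cases hO' : x ∈ O
        · rw [hxO hO']; simpa using hr
        · have hxt : x ∈ tsupport χ := by
            by_contra hh
            exact k4 x hz ⟨0, notMem_tsupport_iff_eventuallyEq.1 hh⟩
          have h1 := k3 x
          have h2 := hφ' x hO' (k4 x hz)
          rw [inner_smul_left] at h1
          rw [norm_mul, hq1, indicator_of_mem hxt]
          refine mul_le_mul_of_nonneg_left (h1.trans ?_) (norm_nonneg _)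
          have : 0 ≤ l := by linarith
          simp only [RCLike.conj_to_real]
          gcongr
    rw [integral_mul_const] at e2
    have e4 : (l ^ 2 - s ^ 2) * |∫ x, g x * (Real.exp (l * inner ℝ e (kap c x)) * Real.cos (s * inner ℝ η (kap c x) + θ))| ≤
        (l ^ 2 - s ^ 2) * (2 * C * (∫ x, ‖q1 x‖) * Real.exp (l * (φ0 - c0))) := by
      rw [← abs_of_pos (by linarith : 0 < l ^ 2 - s ^ 2), ← abs_mul, e1, abs_neg, abs_of_pos (by linarith : 0 < l ^ 2 - s ^ 2)]
      refine e2.trans ?_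
      calc _ = (1 + l + |s|) * (C * (∫ x, ‖q1 x‖) * Real.exp (l * (φ0 - c0))) := by ring
        _ ≤ (2 * (l ^ 2 - s ^ 2)) * (C * (∫ x, ‖q1 x‖) * Real.exp (l * (φ0 - c0))) := by gcongr; linarith
        _ = _ := by ring
    exact le_of_mul_le_mul_left e4 (by linarith)
lemma mulF {f : E → ℝ} (hf : AEStronglyMeasurable f volume) {M : ℝ} (hM : ∀ᵐ x, |f x| ≤ M) :
    ∃ F : L2E →L[ℝ] L2E, (∀ u : L2E, F u =ᵐ[volume] fun x => f x * u x) ∧ ∀ u v, inner ℝ (F u) v = inner ℝ u (F v) := by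
  have hm : ∀ u : L2E, MemLp (fun x => f x * u x) 2 volume := fun u =>
    (Lp.memLp u).of_le_mul (c := M) (hf.mul (Lp.aestronglyMeasurable u)) (by
      filter_upwards [hM] with x hx; rw [norm_mul]; exact mul_le_mul_of_nonneg_right hx (norm_nonneg _))
  let F0 : L2E →ₗ[ℝ] L2E :=
    { toFun := fun u => tl fun x => f x * u x
      map_add' := fun u v => tl_eq (hm _) (by
        filter_upwards [Lp.coeFn_add u v, Lp.coeFn_add (tl fun x => f x * u x) (tl fun x => f x * v x), tl_ae (hm u), tl_ae (hm v)] with x h1 h2 h3 h4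
        rw [h1, h2, Pi.add_apply, Pi.add_apply, h3, h4]; ring)
      map_smul' := fun c u => tl_eq (hm _) (by
        filter_upwards [Lp.coeFn_smul c u, Lp.coeFn_smul c (tl fun x => f x * u x), tl_ae (hm u)] with x h1 h2 h3
        simp only [RingHom.id_apply]
        rw [h1, h2, Pi.smul_apply, Pi.smul_apply, h3]; simp only [smul_eq_mul]; ring) }
  have hF : ∀ u : L2E, F0 u =ᵐ[volume] fun x => f x * u x := fun u => tl_ae (hm u)
  refine ⟨F0.mkContinuous M fun u => ?_, hF, fun u v => ?_⟩
  · apply Lp.norm_le_mul_norm_of_ae_le_mul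
    filter_upwards [hM, hF u] with x hx h1
    rw [h1, norm_mul]; exact mul_le_mul_of_nonneg_right hx (norm_nonneg _)
  · show inner ℝ (F0 u) v = inner ℝ u (F0 v)
    rw [L2.inner_def, L2.inner_def]; apply integral_congr_ae
    filter_upwards [hF u, hF v] with x h1 h2
    rw [h1, h2]; simp; ring
lemma half (hn : 2 ≤ Module.finrank ℝ E) [Nontrivial E] {D W B : Set E} (hD : Bornology.IsBounded D) (hW : IsOpen W) (hWc : IsPreconnected W)
    (hWD : W ⊆ D) (hBo : IsOpen B) (hBn : B.Nonempty) (hBW : B ⊆ W) {w : L2E} (hw : ∀ᵐ x, x ∈ W → w x = 0)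
    (h : ∀ r : L2E, (∀ᵐ x, x ∉ B → r x = 0) → inner ℝ (GG D r) w = 0) (r : L2E) (hr : ∀ᵐ x, x ∉ W → r x = 0) :
    inner ℝ (GG D r) w = 0 := by
  set q : L2E := GG D w with hq
  have hmB : MemLp (B.indicator q) 2 volume := (Lp.memLp q).indicator hBo.measurableSet
  have h1 : ∀ᵐ x, x ∈ B → q x = 0 := by
    have h2 := h (tl (B.indicator q)) (by filter_upwards [tl_ae hmB] with x hx hxB; rw [hx, indicator_of_notMem hxB])
    rw [GG_symm, ← hq, real_inner_comm, inner_tlR _ hmB] at h2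
    have h3 : (fun x => q x * B.indicator q x) = fun x => B.indicator q x * B.indicator q x := by
      ext x; by_cases hx : x ∈ B <;> simp [hx]
    rw [h3, ← inner_tlRR hmB hmB, inner_self_eq_zero] at h2
    have h4 := tl_ae hmB
    rw [h2] at h4
    filter_upwards [h4, Lp.coeFn_zero ℝ 2 (volume : Measure E)] with x h5 h6 hx
    rw [h6, indicator_of_mem hx] at h5; exact h5.symm
  have h2 := uc hn hW hWc (Lp.memLp q) (fun ψ hψ => ?_) hBo hBn hBW h1
  · rw [GG_symm, ← hq, L2.inner_def]
    refine integral_eq_zero_of_ae ?_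
    filter_upwards [h2, hr] with x h3 h4
    by_cases hx : x ∈ W
    · simp [h3 hx]
    · simp [h4 hx]
  · have hψm := memLp_cs hψ.1.continuous hψ.2.1
    rw [← inner_tlR q (memLp_cs (contDiff_lap hψ.1).continuous (lap_mem hψ).2.1), hq, GG_symm,
      GG_lap hD ⟨hψ.1, hψ.2.1, hψ.2.2.trans hWD⟩, inner_neg_right, inner_tlR _ hψm, neg_eq_zero]
    refine integral_eq_zero_of_ae ?_
    filter_upwards [hw] with x hx
    by_cases hxW : x ∈ W
    · simp [hx hxW]
    · simp [image_eq_zero_of_notMem_tsupport fun hh => hxW (hψ.2.2 hh)]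
lemma runge (hn : 2 ≤ Module.finrank ℝ E) [Nontrivial E] {D W B : Set E} (hD : Bornology.IsBounded D) (hW : IsOpen W) (hWc : IsPreconnected W)
    (hWD : W ⊆ D) (hBo : IsOpen B) (hBn : B.Nonempty) (hBW : B ⊆ W) {f : E → ℝ} (hf0 : ∀ᵐ x, x ∈ W → f x = 0)
    {F : L2E →L[ℝ] L2E} (hF : ∀ u : L2E, F u =ᵐ[volume] fun x => f x * u x) (hFs : ∀ u v, inner ℝ (F u) v = inner ℝ u (F v))
    (h : ∀ r r' : L2E, (∀ᵐ x, x ∉ B → r x = 0) → (∀ᵐ x, x ∉ B → r' x = 0) → inner ℝ (GG D r) (F (GG D r')) = 0)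
    (r r' : L2E) (hr : ∀ᵐ x, x ∉ W → r x = 0) (hr' : ∀ᵐ x, x ∉ W → r' x = 0) : inner ℝ (GG D r) (F (GG D r')) = 0 := by
  have hw : ∀ u : L2E, ∀ᵐ x, x ∈ W → F u x = 0 := fun u => by
    filter_upwards [hF u, hf0] with x h1 h2 hx
    rw [h1, h2 hx, zero_mul]
  refine half hn hD hW hWc hWD hBo hBn hBW (hw _) (fun s hs => ?_) r hr
  rw [← hFs, real_inner_comm]
  exact half hn hD hW hWc hWD hBo hBn hBW (hw _) (fun s' hs' => by rw [← hFs, real_inner_comm]; exact h s s' hs hs') r' hr'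
lemma mInd {u : E → ℝ} (hu : MemLp u 2 volume) {W : Set E} (hW : MeasurableSet W) : MemLp (W.indicator u) 2 volume := hu.indicator hW
lemma tl_split {u : E → ℝ} (hu : MemLp u 2 volume) {W : Set E} (hW : MeasurableSet W) :
    tl u = tl (W.indicator u) + tl (Wᶜ.indicator u) := by
  have h1 := mInd hu hW
  have h2 := mInd hu hW.compl
  rw [← tl_add h1 h2, indicator_self_add_compl]
lemma gbd [Nontrivial E] {D W : Set E} (hD : Bornology.IsBounded D) (hW : IsOpen W) {c e : E} {φ0 c0 : ℝ} {χ : E → ℝ} (he : ‖e‖ = 1) (hc0 : 0 < c0)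
    (hχ : ContDiff ℝ ∞ χ) (hcs : HasCompactSupport χ) (hχD : tsupport χ ⊆ D) (hcχ : c ∉ tsupport χ)
    (hφ : ∀ x, x ∉ W → inner ℝ e (kap c x) ≤ φ0)
    (hφ' : ∀ x, x ∉ W → (¬ ∃ k, χ =ᶠ[𝓝 x] fun _ => k) → inner ℝ e (kap c x) ≤ φ0 - c0)
    {f : E → ℝ} {M : ℝ} (hM : ∀ᵐ x, |f x| ≤ M) (hf0 : ∀ᵐ x, x ∈ W → f x = 0) {F : L2E →L[ℝ] L2E} (hF : ∀ u : L2E, F u =ᵐ[volume] fun x => f x * u x) :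
    ∃ K, 0 ≤ K ∧ ∀ μ, 0 ≤ μ → ∀ η, ‖η‖ = 1 → inner ℝ e η = 0 → ∀ θ,
      (fun x => χ x * KT c (μ • e) (μ • η) θ x) ∈ TF (tsupport χ) ∧
      ‖F (tl fun x => χ x * KT c (μ • e) (μ • η) θ x)‖ ≤ K * Real.exp (μ * φ0) ∧
      ∃ r g : L2E, (∀ᵐ x, x ∉ W → r x = 0) ∧ GG D r = -((tl fun x => χ x * KT c (μ • e) (μ • η) θ x) + g) ∧
        ‖g‖ ≤ K * Real.exp (μ * φ0) * Real.exp (-(c0 * μ / 2)) := by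
  obtain ⟨C, hC, hKT⟩ := KT_bd hχ hcs hcχ
  set o : E → ℝ := (tsupport χ).indicator fun _ => 1 with ho
  have hom : MemLp o 2 volume := by
    refine memLp_indicator_const 2 (isClosed_tsupport χ).measurableSet 1 (Or.inr ?_)
    exact (IsCompact.measure_lt_top hcs).ne
  set N := ‖tl o‖ with hN
  have hN0 : 0 ≤ N := norm_nonneg _
  have hM0 : 0 ≤ M := by obtain ⟨x, hx⟩ := hM.exists; exact (abs_nonneg _).trans hx
  refine ⟨M * C * N + ‖GG D‖ * (C * (1 + 4 / c0) * N), by positivity, fun μ hμ η hη heη θ => ?_⟩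
  have hab : inner ℝ (μ • e) (μ • η) = 0 := by rw [inner_smul_left, inner_smul_right, heη]; simp
  obtain ⟨k1, k2, k3, k4⟩ := hKT (μ • e) (μ • η) θ hab
  set ψ : E → ℝ := fun x => χ x * KT c (μ • e) (μ • η) θ x with hψ
  have hna : ‖μ • e‖ = μ := by rw [norm_smul, he, mul_one]; exact abs_of_nonneg hμ
  have hnb : ‖μ • η‖ = μ := by rw [norm_smul, hη, mul_one]; exact abs_of_nonneg hμ
  simp only [hna, hnb, sub_self, zero_mul, mul_zero, sub_zero, inner_smul_left, RCLike.conj_to_real] at k2 k3 k4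
  have hψm := memLp_cs k1.1.continuous k1.2.1
  have hlm := memLp_cs (contDiff_lap k1.1).continuous (lap_mem k1).2.1
  refine ⟨k1, ?_, tl (W.indicator (Δ ψ)), GG D (tl (Wᶜ.indicator (Δ ψ))), ?_, ?_, ?_⟩
  · have h1 : ‖F (tl ψ)‖ ≤ (M * C * Real.exp (μ * φ0)) * N := by
      apply Lp.norm_le_mul_norm_of_ae_le_mul
      filter_upwards [hF (tl ψ), tl_ae hψm, tl_ae hom, hM, hf0] with x h1 h2 h3 h4 h5
      rw [h1, h2, h3]
      by_cases hx : x ∈ W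
      · rw [h5 hx, zero_mul, norm_zero]; positivity
      by_cases hxt : x ∈ tsupport χ
      · rw [ho, indicator_of_mem hxt, norm_one, mul_one, norm_mul, mul_assoc]
        refine mul_le_mul h4 ((k2 x).trans ?_) (norm_nonneg _) hM0
        exact mul_le_mul_of_nonneg_left (Real.exp_le_exp.2 (mul_le_mul_of_nonneg_left (hφ x hx) hμ)) hC
      · have : ψ x = 0 := by simp [hψ, image_eq_zero_of_notMem_tsupport hxt]
        rw [this, mul_zero, norm_zero]; positivity
    refine h1.trans ?_
    have : 0 ≤ ‖GG D‖ * (C * (1 + 4 / c0) * N) * Real.exp (μ * φ0) := by positivity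
    linarith
  · filter_upwards [tl_ae (mInd hlm hW.measurableSet)] with x hx hxW
    rw [hx, indicator_of_notMem hxW]
  · have h1 := tl_split hlm hW.measurableSet
    have h2 := GG_lap hD (φ := ψ) ⟨k1.1, k1.2.1, k1.2.2.trans hχD⟩
    rw [h1, map_add] at h2
    rw [neg_add, ← h2]; abel
  · have h1 : ‖tl (Wᶜ.indicator (Δ ψ))‖ ≤ (C * (1 + μ + μ) * Real.exp (μ * (φ0 - c0))) * N := by
      refine norm_tl_le (mInd hlm hW.measurableSet.compl) hom fun x => ?_
      by_cases hx : x ∈ W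
      · rw [indicator_of_notMem (by simpa using hx), norm_zero]; positivity
      rw [indicator_of_mem hx]
      by_cases hz : Δ ψ x = 0
      · rw [hz, norm_zero]; positivity
      have hxt : x ∈ tsupport χ := by
        by_contra hh
        exact k4 x hz ⟨0, notMem_tsupport_iff_eventuallyEq.1 hh⟩
      rw [ho, indicator_of_mem hxt, norm_one, mul_one]
      refine (k3 x).trans ?_
      have := hφ' x hx (k4 x hz)
      gcongr
    have h2 : 1 + μ + μ ≤ (1 + 4 / c0) * Real.exp (c0 * μ / 2) := by
      have h3 : 1 ≤ Real.exp (c0 * μ / 2) := Real.one_le_exp (by positivity)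
      have h4 : c0 * μ / 2 ≤ Real.exp (c0 * μ / 2) := by linarith [Real.add_one_le_exp (c0 * μ / 2)]
      have h5 : 4 / c0 * (c0 * μ / 2) ≤ 4 / c0 * Real.exp (c0 * μ / 2) := mul_le_mul_of_nonneg_left h4 (by positivity)
      have h6 : 4 / c0 * (c0 * μ / 2) = μ + μ := by field_simp; ring
      linarith
    have h3 : Real.exp (c0 * μ / 2) * Real.exp (μ * (φ0 - c0)) = Real.exp (μ * φ0) * Real.exp (-(c0 * μ / 2)) := by
      rw [← Real.exp_add, ← Real.exp_add]; congr 1; ring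
    calc ‖GG D (tl (Wᶜ.indicator (Δ ψ)))‖ ≤ ‖GG D‖ * ((C * (1 + μ + μ) * Real.exp (μ * (φ0 - c0))) * N) :=
          (ContinuousLinearMap.le_opNorm _ _).trans (mul_le_mul_of_nonneg_left h1 (norm_nonneg _))
      _ ≤ ‖GG D‖ * ((C * ((1 + 4 / c0) * Real.exp (c0 * μ / 2)) * Real.exp (μ * (φ0 - c0))) * N) := by gcongr
      _ = ‖GG D‖ * (C * (1 + 4 / c0) * N) * (Real.exp (c0 * μ / 2) * Real.exp (μ * (φ0 - c0))) := by ring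
      _ ≤ _ := by
        rw [h3]
        have : 0 ≤ M * C * N * (Real.exp (μ * φ0) * Real.exp (-(c0 * μ / 2))) := by positivity
        linarith
lemma hil {H : Type} [NormedAddCommGroup H] [InnerProductSpace ℝ H] {F : H →L[ℝ] H} (hFs : ∀ u v, inner ℝ (F u) v = inner ℝ u (F v))
    {p1 p2 g1 g2 : H} (h : inner ℝ (-(p1 + g1)) (F (-(p2 + g2))) = 0) {K a1 a2 b1 b2 : ℝ} (hK : 0 ≤ K)
    (ha1 : 0 ≤ a1) (ha2 : 0 ≤ a2) (hb1 : 0 ≤ b1) (hb2 : 0 ≤ b2)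
    (h1 : ‖F p1‖ ≤ K * a1) (h2 : ‖F p2‖ ≤ K * a2) (h3 : ‖g1‖ ≤ K * a1 * b1) (h4 : ‖g2‖ ≤ K * a2 * b2) :
    |inner ℝ p1 (F p2)| ≤ K ^ 2 * (a1 * a2) * (b2 + b1 + ‖F‖ * (b1 * b2)) := by
  rw [map_neg, inner_neg_neg, map_add, inner_add_left, inner_add_right, inner_add_right] at h
  have e1 : |inner ℝ p1 (F g2)| ≤ (K * a1) * (K * a2 * b2) := by
    rw [← hFs]; exact (abs_real_inner_le_norm _ _).trans (mul_le_mul h1 h4 (norm_nonneg _) (by positivity))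
  have e2 : |inner ℝ g1 (F p2)| ≤ (K * a1 * b1) * (K * a2) :=
    (abs_real_inner_le_norm _ _).trans (mul_le_mul h3 h2 (norm_nonneg _) (by positivity))
  have e3 : |inner ℝ g1 (F g2)| ≤ (K * a1 * b1) * (‖F‖ * (K * a2 * b2)) :=
    (abs_real_inner_le_norm _ _).trans (mul_le_mul h3 ((F.le_opNorm _).trans (mul_le_mul_of_nonneg_left h4 (norm_nonneg _))) (norm_nonneg _) (by positivity))
  have e4 : inner ℝ p1 (F p2) = -(inner ℝ p1 (F g2)) - inner ℝ g1 (F p2) - inner ℝ g1 (F g2) := by linarith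
  rw [e4, abs_le]
  rw [abs_le] at e1 e2 e3
  constructor <;> nlinarith
lemma main (hn : 2 ≤ Module.finrank ℝ E) [Nontrivial E] {D S B : Set E} (hD : Bornology.IsBounded D) (hS : IsOpen S) (hSc : IsPreconnected S) (hSD : S ⊆ D)
    (hBo : IsOpen B) (hBn : B.Nonempty) (hBc : IsPreconnected B) (hBS : B ⊆ S) {f : E → ℝ} (hf : AEStronglyMeasurable f volume) {M : ℝ} (hM : ∀ᵐ x, |f x| ≤ M)
    (hfB : ∀ᵐ x, x ∈ B → f x = 0)
    (h : ∀ r r' : L2E, (∀ᵐ x, x ∉ B → r x = 0) → (∀ᵐ x, x ∉ B → r' x = 0) → ∫ x, f x * GG D r x * GG D r' x = 0) :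
    ∀ᵐ x, x ∈ S → f x = 0 := by
  obtain ⟨F, hF, hFs⟩ := mulF hf hM
  obtain ⟨b, hb⟩ := hBn
  set W := connectedComponentIn (S ∩ ZO f) b with hWdef
  have hWo : IsOpen W := (hS.inter (ZO_open f)).connectedComponentIn
  have hWc : IsPreconnected W := isPreconnected_connectedComponentIn
  have hWS' : W ⊆ S ∩ ZO f := connectedComponentIn_subset _ _
  have hBW : B ⊆ W := hBc.subset_connectedComponentIn hb (subset_inter hBS (ZO_sub hBo hfB))
  have hf0 : ∀ᵐ x, x ∈ W → f x = 0 := (ZO_ae f).mono fun x hx h => hx (hWS' h).2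
  by_cases hWS : W = S
  · rwa [hWS] at hf0
  exfalso
  obtain ⟨c, e, p, φ0, c0, t, χ, he, hc0, ht, hpS, hpW, hpcl, hpc, hpφ, hχ, hcs, hχS, hcχ, hχ1, hφ, hφ'⟩ :=
    geom hS hSc hWo (hWS'.trans inter_subset_left) ⟨b, hBW hb⟩ hWS
  have hR := runge hn hD hWo hWc ((hWS'.trans inter_subset_left).trans hSD) hBo ⟨b, hb⟩ hBW hf0 hF hFs (fun r r' hr hr' => by
    rw [← h r r' hr hr', L2.inner_def]; apply integral_congr_ae
    filter_upwards [hF (GG D r')] with x hx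
    rw [hx]; simp; ring)
  obtain ⟨K, hK, hg⟩ := gbd hD hWo he hc0 hχ hcs (hχS.trans hSD) hcχ hφ hφ' hM hf0 hF
  obtain ⟨C, hC, hKT⟩ := KT_bd hχ hcs hcχ
  set α : ℝ := (2 - Module.finrank ℝ E : ℝ) / 2 with hα
  have hKT0 : ∀ x, KT c 0 0 0 x = (‖x - c‖ ^ 2) ^ α := by intro x; simp [KT, hα]
  set m : E → ℝ := fun x => χ x * KT c 0 0 0 x with hm
  obtain ⟨hmT, -, -, -⟩ := hKT 0 0 0 (by simp)
  have hmi : Integrable (fun x => f x * (m x * m x)) volume :=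
    (integ_cs (hmT.1.continuous.mul hmT.1.continuous) hmT.2.1.mul_right).bdd_mul (c := M) hf hM
  set g := Wᶜ.indicator (fun x => f x * (m x * m x)) with hgd
  have hgi : Integrable g volume := hmi.indicator hWo.measurableSet.compl
  have hgae : ∀ᵐ x, g x = f x * (m x * m x) := by
    filter_upwards [hf0] with x hx
    by_cases hxW : x ∈ W
    · rw [hgd, indicator_of_notMem (by simpa using hxW), hx hxW, zero_mul]
    · rw [hgd, indicator_of_mem hxW]
  have key := lemX hn he (by positivity : 0 < c0 / 4) hgi (fun x hx => hφ x fun hxO => hx (by rw [hgd, indicator_of_notMem (by simpa using hxO)])) (c := c) ?_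
  · obtain ⟨U, hU, hpU, hUt, hUc⟩ := near_p (c1 := c0 / 4) (by positivity) ht hpc hpφ
    have hpZ : p ∈ ZO f := by
      refine ZO_sub hU ?_ hpU
      filter_upwards [key, hgae] with x hx hx2 hxU
      have h1 := hx (hUc x hxU).2
      rw [hx2] at h1
      refine (mul_eq_zero.1 h1).resolve_right ?_
      have hn0 : 0 < ‖x - c‖ := norm_pos_iff.2 (sub_ne_zero.2 (hUc x hxU).1)
      simp only [hm, hKT0, hχ1 x (hUt hxU)]
      have := Real.rpow_pos_of_pos (pow_pos hn0 2) α
      positivity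
    have h1 : IsPreconnected (insert p W) := hWc.subset_closure (subset_insert _ _) (insert_subset hpcl subset_closure)
    have h2 : insert p W ⊆ S ∩ ZO f := insert_subset ⟨hpS, hpZ⟩ hWS'
    exact hpW (h1.subset_connectedComponentIn (mem_insert_of_mem p (hBW hb)) h2 (mem_insert _ _))
  · intro η hη heη s θ
    refine ⟨2 * (K ^ 2 * (2 + ‖F‖) * Real.exp (c0 * |s| / 4)), |s|, fun l hl => ?_⟩
    have hs1 := le_abs_self s
    have hs2 := neg_abs_le s
    have hη' : ‖-η‖ = 1 := by rwa [norm_neg]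
    have heη' : inner ℝ e (-η) = 0 := by rw [inner_neg_right, heη, neg_zero]
    have B1 : ∀ θ1 θ2, (Integrable (fun x => f x * ((χ x * KT c (((l + s) / 2) • e) (((l + s) / 2) • η) θ1 x) * (χ x * KT c (((l - s) / 2) • e) (((l - s) / 2) • (-η)) θ2 x))) volume) ∧
        |∫ x, f x * ((χ x * KT c (((l + s) / 2) • e) (((l + s) / 2) • η) θ1 x) * (χ x * KT c (((l - s) / 2) • e) (((l - s) / 2) • (-η)) θ2 x))| ≤
        K ^ 2 * (2 + ‖F‖) * Real.exp (c0 * |s| / 4) * Real.exp (l * (φ0 - c0 / 4)) := by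
      intro θ1 θ2
      obtain ⟨a1, a2, r1, g1, a3, a4, a5⟩ := hg ((l + s) / 2) (by linarith) η hη heη θ1
      obtain ⟨b1, b2, r2, g2, b3, b4, b5⟩ := hg ((l - s) / 2) (by linarith) (-η) hη' heη' θ2
      set ψ1 : E → ℝ := fun x => χ x * KT c (((l + s) / 2) • e) (((l + s) / 2) • η) θ1 x
      set ψ2 : E → ℝ := fun x => χ x * KT c (((l - s) / 2) • e) (((l - s) / 2) • (-η)) θ2 x
      have h0 := hR r1 r2 a3 b3
      rw [a4, b4] at h0
      have h1 := hil hFs h0 hK (Real.exp_nonneg _) (Real.exp_nonneg _) (Real.exp_nonneg _) (Real.exp_nonneg _) a2 b2 a5 b5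
      refine ⟨(integ_cs (a1.1.continuous.mul b1.1.continuous) b1.2.1.mul_left).bdd_mul (c := M) hf hM, ?_⟩
      have e1 : inner ℝ (tl ψ1) (F (tl ψ2)) = ∫ x, f x * (ψ1 x * ψ2 x) := by
        rw [L2.inner_def]; apply integral_congr_ae
        filter_upwards [hF (tl ψ2), tl_ae (memLp_cs a1.1.continuous a1.2.1), tl_ae (memLp_cs b1.1.continuous b1.2.1)] with x h1 h2 h3
        rw [h1, h2, h3]; simp; ring
      rw [e1, ← Real.exp_add] at h1
      refine h1.trans ?_
      have x1 : Real.exp (-(c0 * ((l + s) / 2) / 2)) ≤ Real.exp (c0 * |s| / 4) * Real.exp (-(c0 * l / 4)) := by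
        rw [← Real.exp_add, Real.exp_le_exp]; nlinarith
      have x2 : Real.exp (-(c0 * ((l - s) / 2) / 2)) ≤ Real.exp (c0 * |s| / 4) * Real.exp (-(c0 * l / 4)) := by
        rw [← Real.exp_add, Real.exp_le_exp]; nlinarith
      have x3 : Real.exp (-(c0 * ((l + s) / 2) / 2)) ≤ 1 := by
        rw [Real.exp_le_one_iff]; have : 0 ≤ c0 * ((l + s) / 2) := mul_nonneg hc0.le (by linarith)
        linarith
      have x4 : Real.exp (-(c0 * ((l + s) / 2) / 2)) * Real.exp (-(c0 * ((l - s) / 2) / 2)) ≤ 1 * (Real.exp (c0 * |s| / 4) * Real.exp (-(c0 * l / 4))) :=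
        mul_le_mul x3 x2 (Real.exp_nonneg _) zero_le_one
      have x5 : ‖F‖ * (Real.exp (-(c0 * ((l + s) / 2) / 2)) * Real.exp (-(c0 * ((l - s) / 2) / 2))) ≤ ‖F‖ * (1 * (Real.exp (c0 * |s| / 4) * Real.exp (-(c0 * l / 4)))) :=
        mul_le_mul_of_nonneg_left x4 (norm_nonneg _)
      have x6 : Real.exp (l * (φ0 - c0 / 4)) = Real.exp ((l + s) / 2 * φ0 + (l - s) / 2 * φ0) * Real.exp (-(c0 * l / 4)) := by
        rw [← Real.exp_add]; congr 1; ring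
      calc _ ≤ K ^ 2 * Real.exp ((l + s) / 2 * φ0 + (l - s) / 2 * φ0) * ((2 + ‖F‖) * (Real.exp (c0 * |s| / 4) * Real.exp (-(c0 * l / 4)))) :=
            mul_le_mul_of_nonneg_left (by linarith) (by positivity)
        _ = _ := by rw [x6]; ring
    obtain ⟨i1, B11⟩ := B1 θ 0
    obtain ⟨i2, B12⟩ := B1 (θ - Real.pi / 2) (-(Real.pi / 2))
    have e1 : (∫ x, g x * (Real.exp (l * inner ℝ e (kap c x)) * Real.cos (s * inner ℝ η (kap c x) + θ))) =
        ∫ x, (f x * ((χ x * KT c (((l + s) / 2) • e) (((l + s) / 2) • η) θ x) * (χ x * KT c (((l - s) / 2) • e) (((l - s) / 2) • (-η)) 0 x)) -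
        f x * ((χ x * KT c (((l + s) / 2) • e) (((l + s) / 2) • η) (θ - Real.pi / 2) x) * (χ x * KT c (((l - s) / 2) • e) (((l - s) / 2) • (-η)) (-(Real.pi / 2)) x))) := by
      apply integral_congr_ae
      filter_upwards [hgae] with x hx
      simp only [hx, hm, hKT0]
      simp only [KT, inner_smul_left, inner_neg_left, RCLike.conj_to_real, ← hα]
      have y1 : l * inner ℝ e (kap c x) = (l + s) / 2 * inner ℝ e (kap c x) + (l - s) / 2 * inner ℝ e (kap c x) := by ring
      have y2 : s * inner ℝ η (kap c x) + θ = ((l + s) / 2 * inner ℝ η (kap c x) + θ) + ((l - s) / 2 * -inner ℝ η (kap c x) + 0) := by ring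
      have y3 : (l + s) / 2 * inner ℝ η (kap c x) + (θ - Real.pi / 2) = ((l + s) / 2 * inner ℝ η (kap c x) + θ) - Real.pi / 2 := by ring
      have y4 : (l - s) / 2 * -inner ℝ η (kap c x) + -(Real.pi / 2) = ((l - s) / 2 * -inner ℝ η (kap c x) + 0) - Real.pi / 2 := by ring
      rw [y1, y2, y3, y4, Real.exp_add, Real.cos_add, Real.cos_sub_pi_div_two, Real.cos_sub_pi_div_two]
      ring
    rw [e1, integral_sub i1 i2]
    refine (abs_sub _ _).trans ?_
    linarith
lemma final (hn : 2 ≤ Module.finrank ℝ E) {Ω Γ : Set E} (hΩ : IsOpen Ω) (hcon : IsConnected Ω) (hb : Bornology.IsBounded Ω)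
    (hsm : ∀ x ∈ frontier Ω, ∃ (U : Set E) (ρ : E → ℝ),
    IsOpen U ∧ x ∈ U ∧ ContDiffOn ℝ ∞ ρ U ∧ (∀ y ∈ U, fderiv ℝ ρ y ≠ 0) ∧
    Ω ∩ U = {y ∈ U | ρ y < 0} ∧ frontier Ω ∩ U = {y ∈ U | ρ y = 0})
    (hΓ : IsClosed Γ) (hΓs : Γ ⊆ frontier Ω) (hΓp : Γ ≠ frontier Ω) {f : E → ℝ} (hf : MemLp f ⊤ (volume.restrict Ω))
    (hc : ∀ u v : E → ℝ, ContDiffOn ℝ ∞ u (closure Ω) → (∀ x ∈ Ω, Δ u x = 0) → (∀ x ∈ Γ, u x = 0) →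
      ContDiffOn ℝ ∞ v (closure Ω) → (∀ x ∈ Ω, Δ v x = 0) → (∀ x ∈ Γ, v x = 0) → ∫ x in Ω, f x * u x * v x = 0) :
    ∀ᵐ x, x ∈ Ω → f x = 0 := by
  haveI : Nontrivial E := Module.nontrivial_of_finrank_pos (R := ℝ) (by omega)
  obtain ⟨x0, hx0, hx0Γ⟩ : ∃ x ∈ frontier Ω, x ∉ Γ := by
    by_contra! h; exact hΓp (hΓs.antisymm h)
  obtain ⟨D, δ, b, ε, hD, -, hδ, hε, hΩD, hδD, hbδ, hdis, hA⟩ := thmA hΩ hb hsm hΓ hΓs hx0 hx0Γ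
  have hSc : IsPreconnected (Ω ∪ Metric.ball x0 δ) := by
    obtain ⟨y, hy1, hy2⟩ := mem_closure_iff.1 (frontier_subset_closure hx0) (Metric.ball x0 δ) Metric.isOpen_ball (Metric.mem_ball_self hδ)
    exact IsPreconnected.union y hy2 hy1 hcon.isPreconnected (convex_ball x0 δ).isPreconnected
  have hbΩ : ∀ x ∈ Metric.closedBall b ε, x ∉ Ω := fun x hx hxΩ => disjoint_left.1 hdis hx (subset_closure hxΩ)
  have hM : ∀ᵐ x, |Ω.indicator f x| ≤ (eLpNormEssSup f (volume.restrict Ω)).toReal := by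
    have h1 := ae_le_eLpNormEssSup (f := f) (μ := volume.restrict Ω)
    rw [ae_restrict_iff' hΩ.measurableSet] at h1
    filter_upwards [h1] with x hx
    by_cases hxΩ : x ∈ Ω
    · rw [indicator_of_mem hxΩ]
      have h2 : eLpNormEssSup f (volume.restrict Ω) ≠ ⊤ := by rw [← eLpNorm_exponent_top]; exact hf.2.ne
      have := ENNReal.toReal_mono h2 (hx hxΩ)
      simpa using this
    · rw [indicator_of_notMem hxΩ, abs_zero]; positivity
  have key := main hn hD (hΩ.union Metric.isOpen_ball) hSc (union_subset hΩD hδD) (B := Metric.ball b ε) Metric.isOpen_ball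
    (Metric.nonempty_ball.2 hε) (convex_ball b ε).isPreconnected (hbδ.trans subset_union_right) (f := Ω.indicator f)
    ((aestronglyMeasurable_indicator_iff hΩ.measurableSet).2 hf.1) hM
    (Eventually.of_forall fun x hx => indicator_of_notMem (hbΩ x (Metric.ball_subset_closedBall hx)) f) fun r r' hr hr' => ?_
  · filter_upwards [key] with x hx hxΩ
    have := hx (Or.inl hxΩ)
    rwa [indicator_of_mem hxΩ] at this
  · obtain ⟨w, w1, w2, w3, w4⟩ := hA (Metric.closedBall b ε) r Metric.isClosed_closedBall hdis (hr.mono fun x hx h => hx fun hh => h (Metric.ball_subset_closedBall hh))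
    obtain ⟨w', w1', w2', w3', w4'⟩ := hA (Metric.closedBall b ε) r' Metric.isClosed_closedBall hdis (hr'.mono fun x hx h => hx fun hh => h (Metric.ball_subset_closedBall hh))
    rw [← hc w w' w2 w3 w4 w2' w3' w4', ← integral_indicator hΩ.measurableSet]
    apply integral_congr_ae
    filter_upwards [w1, w1'] with x h1 h2
    rw [h1, h2]
    by_cases hx : x ∈ Ω <;> simp [hx]
end LC
end

/-- **Linearized local Calderón problem, uniqueness form.**
If `Ω ⊂ ℝⁿ`, `n ≥ 2`, is a connected bounded open set with smooth boundary, `Γ ⊊ ∂Ω` is a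
closed proper subset of the boundary, and `f ∈ L^∞(Ω)` satisfies `∫_Ω f u v = 0` for all
pairs of harmonic functions `u, v ∈ C^∞(Ω̄)` vanishing on `Γ`, then `f = 0` a.e. on `Ω`. -/
theorem linearized_calderon_uniqueness {n : ℕ} (hn : 2 ≤ n)
    (Ω : Set (EuclideanSpace ℝ (Fin n))) (hΩopen : IsOpen Ω) (hΩconn : IsConnected Ω)
    (hΩbdd : Bornology.IsBounded Ω) (hΩsmooth : HasSmoothBoundary Ω)
    (Γ : Set (EuclideanSpace ℝ (Fin n))) (hΓclosed : IsClosed Γ)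
    (hΓsub : Γ ⊆ frontier Ω) (hΓproper : Γ ≠ frontier Ω)
    (f : EuclideanSpace ℝ (Fin n) → ℝ) (hf : MemLp f ⊤ (volume.restrict Ω))
    (hcancel : ∀ u v : EuclideanSpace ℝ (Fin n) → ℝ,
      ContDiffOn ℝ (⊤ : ℕ∞) u (closure Ω) → IsHarmonicOn u Ω → (∀ x ∈ Γ, u x = 0) →
      ContDiffOn ℝ (⊤ : ℕ∞) v (closure Ω) → IsHarmonicOn v Ω → (∀ x ∈ Γ, v x = 0) →
      ∫ x in Ω, f x * u x * v x = 0) :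
    f =ᵐ[volume.restrict Ω] 0 := by
  have hH : ∀ u : EuclideanSpace ℝ (Fin n) → ℝ, ContDiffOn ℝ (⊤ : ℕ∞) u (closure Ω) →
      (∀ x ∈ Ω, Laplacian.laplacian u x = 0) → IsHarmonicOn u Ω := fun u h1 h2 =>
    ⟨(contDiffOn_infty.1 h1 2).mono subset_closure, fun x hx => by
      rw [← h2 x hx, InnerProductSpace.laplacian_eq_iteratedFDeriv_orthonormalBasis u (EuclideanSpace.basisFun (Fin n) ℝ)]
      simp [lap]⟩
  have h := LC.final (by simpa using hn) hΩopen hΩconn hΩbdd hΩsmooth hΓclosed hΓsub hΓproper hf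
    fun u v h1 h2 h3 h4 h5 h6 => hcancel u v h1 (hH u h1 h2) h3 h4 (hH v h4 h5) h6
  exact (MeasureTheory.ae_restrict_iff' hΩopen.measurableSet).2 h

end
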